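/- Let L(ε) ~ ε^{-λ} and a(ε) ~ ε^{α} as ε → 0 with λ, α > 0 satisfying λ + (d+1)α < 1, and let μ^ε := μ^{L,a,ε} be the corresponding Gibbs measures, regarded as measures on m_0 + L²(D) by extending functions in ℋ^{L,a} with ±1. Then μ^ε concentrates around the set M of minimizers exponentially fast: there exist constants c₀, δ₀ > 0 such that for all δ < δ₀, limsup_{ε↓0} ε · log μ^ε{ h : dist_{L²(D)}(h, M) > δ } ≤ −c₀ δ². -/

import Mathlib

open MeasureTheory Real Filter Topology
open scoped ENNReal RealInnerProductSpace

noncomputable section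

/-- `Eucl d` is the Euclidean space `ℝ^(d+1)`. -/
abbrev Eucl (d : ℕ) : Type := EuclideanSpace ℝ (Fin (d + 1))

/-- The unbounded domain `D = ℝ × (0,1)^d`, as a subset of `ℝ^(d+1)`. -/
def domD (d : ℕ) : Set (Eucl d) := {z | ∀ i : Fin d, z i.succ ∈ Set.Ioo (0 : ℝ) 1}

/-- The bounded domain `D_L = (-L,L) × (0,1)^d`. -/
def domDL (d : ℕ) (L : ℝ) : Set (Eucl d) :=
  {z | |z 0| < L ∧ ∀ i : Fin d, z i.succ ∈ Set.Ioo (0 : ℝ) 1}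

/-- The standing assumptions on the symmetric double well potential `F`. -/
structure IsStdPotential (F : ℝ → ℝ) : Prop where
  smooth : ContDiff ℝ 3 F
  symm : ∀ u, F (-u) = F u
  nonneg : ∀ u, 0 ≤ F u
  zero_iff : ∀ u, F u = 0 ↔ u = 1 ∨ u = -1
  deriv_zero_iff : ∀ u, deriv F u = 0 ↔ u = 0 ∨ u = 1 ∨ u = -1
  dd_zero_neg : deriv (deriv F) 0 < 0
  dd_one_pos : 0 < deriv (deriv F) 1
  dd_neg_one_pos : 0 < deriv (deriv F) (-1)

/-- The surface tension `C* = ∫_{-1}^1 √(2 F(u)) du`. -/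
def Cstar (F : ℝ → ℝ) : ℝ := ∫ u in (-1 : ℝ)..1, Real.sqrt (2 * F u)

/-- `m` is the optimal transition profile for the potential `F`: a solution of
`m' = √(2F(m))`, `m(±∞) = ±1`, `m(0) = 0`, with values in `[-1,1]`. -/
structure IsProfile (F m : ℝ → ℝ) : Prop where
  mem_Icc : ∀ x, m x ∈ Set.Icc (-1 : ℝ) 1
  ode : ∀ x, HasDerivAt m (Real.sqrt (2 * F (m x))) x
  limit_top : Tendsto m atTop (nhds 1)
  limit_bot : Tendsto m atBot (nhds (-1))
  zero : m 0 = 0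

/-- The `L²(D)` norm, as an extended real number. -/
def eL2 (d : ℕ) (f : Eucl d → ℝ) : ℝ≥0∞ :=
  (∫⁻ z in domD d, ENNReal.ofReal ((f z) ^ 2)) ^ (1/2 : ℝ)

/-- The `L²(D)` distance of `h` to the set of minimizers `M`, as an extended real number. -/
def eDistM (d : ℕ) (m : ℝ → ℝ) (h : Eucl d → ℝ) : ℝ≥0∞ :=
  ⨅ ξ : ℝ, eL2 d (fun z => h z - m (z 0 - ξ))

/-- The (not yet renormalized) Allen--Cahn energy `∫_D ½|∇h|² + F(h)`, as an extended
real number (the free energy is `𝓕(h) = eEnergyD d F h - C*`). -/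
def eEnergyD (d : ℕ) (F : ℝ → ℝ) (h : Eucl d → ℝ) : ℝ≥0∞ :=
  ∫⁻ z in domD d, ENNReal.ofReal (1/2 * ‖fderiv ℝ h z‖ ^ 2 + F (h z))

/-- `z` is a point of the lattice `aℤ^(d+1)`. -/
def latticePt (d : ℕ) (a : ℝ) (z : Eucl d) : Prop := ∀ i, ∃ k : ℤ, z i = a * k

/-- The grid `D_{L,a} = cl(D_{L-a}) ∩ aℤ^(d+1)`. -/
def gridSet (d : ℕ) (L a : ℝ) : Set (Eucl d) :=
  {z | latticePt d a z ∧ |z 0| ≤ L - a ∧ ∀ i : Fin d, z i.succ ∈ Set.Icc (0 : ℝ) 1}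

/-- `h` is piecewise linear w.r.t. the lattice of mesh `a`: it is continuous and affine on
each simplex of the standard (Kuhn) subdivision of each lattice cube into simplices. -/
def IsPLGrid (d : ℕ) (a : ℝ) (h : Eucl d → ℝ) : Prop :=
  Continuous h ∧
  ∀ (p : Fin (d + 1) → ℤ) (σp : Equiv.Perm (Fin (d + 1))),
    ∃ φ : Eucl d →ᵃ[ℝ] ℝ,
      ∀ z : Eucl d, (∀ i, a * p i ≤ z i ∧ z i ≤ a * p i + a) →
        (∀ k l : Fin (d + 1), k ≤ l → z (σp l) - a * (p (σp l)) ≤ z (σp k) - a * (p (σp k))) →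
        h z = φ z

/-- The discretized configuration space `ℋ^{L,a}` of piecewise linear functions with
boundary values `±1`, presented through the linear interpolation operator `interp0`
(zero boundary values, determined by the values on the grid and vanishing at all other
lattice points) and the fixed piecewise linear profile `bc` implementing the `±1`
boundary values.  Thus `ℋ^{L,a} = {bc + interp0 g}` and `ℋ₀^{L,a} = {interp0 g}`, where
`g` ranges over all functions on the grid, and both spaces are identified with `ℝ^N`
via the coordinates `g`. -/
structure Disc (d : ℕ) (L a : ℝ) where
  gridFin : Fintype (gridSet d L a)
  interp0 : ((gridSet d L a) → ℝ) →ₗ[ℝ] ((Eucl d) → ℝ)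
  bc : Eucl d → ℝ
  interp0_grid : ∀ (g) (z : Eucl d) (hz : z ∈ gridSet d L a), interp0 g z = g ⟨z, hz⟩
  interp0_lattice : ∀ (g) (z : Eucl d), latticePt d a z → z ∉ gridSet d L a → interp0 g z = 0
  interp0_bd : ∀ (g) (z : Eucl d), L ≤ |z 0| → interp0 g z = 0
  interp0_pl : ∀ g, IsPLGrid d a (interp0 g)
  bc_grid : ∀ z ∈ gridSet d L a, bc z = 0
  bc_lattice_pos : ∀ z : Eucl d, latticePt d a z → z ∉ gridSet d L a → 0 < z 0 → bc z = 1
  bc_lattice_neg : ∀ z : Eucl d, latticePt d a z → z ∉ gridSet d L a → z 0 < 0 → bc z = -1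
  bc_plus : ∀ z : Eucl d, L ≤ z 0 → bc z = 1
  bc_minus : ∀ z : Eucl d, z 0 ≤ -L → bc z = -1
  bc_pl : IsPLGrid d a bc

/-- The number of grid points, `N = dim ℋ^{L,a}`. -/
def gridCard (d : ℕ) (L a : ℝ) (disc : Disc d L a) : ℕ :=
  letI := disc.gridFin; Fintype.card (gridSet d L a)

/-- Lebesgue measure `𝓛^N` on `ℋ^{L,a} ≅ ℝ^N` (in grid coordinates). -/
def gridVol (d : ℕ) (L a : ℝ) (disc : Disc d L a) : Measure ((gridSet d L a) → ℝ) :=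
  letI := disc.gridFin; Measure.pi fun _ => (volume : Measure ℝ)

/-- The element of `ℋ^{L,a}` with grid values `g` (extended by `±1` to all of `ℝ^(d+1)`). -/
def discFun (d : ℕ) (L a : ℝ) (disc : Disc d L a) (g : (gridSet d L a) → ℝ) : Eucl d → ℝ :=
  fun z => disc.bc z + disc.interp0 g z

/-- The Dirichlet energy `∫_{D_L} |∇h|²`. -/
def dirEnergy (d : ℕ) (L : ℝ) (h : Eucl d → ℝ) : ℝ := ∫ z in domDL d L, ‖fderiv ℝ h z‖ ^ 2

/-- The squared `H¹(D_L)` norm `∫_{D_L} |∇h|² + h²`. -/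
def sobNormSq (d : ℕ) (L : ℝ) (h : Eucl d → ℝ) : ℝ :=
  ∫ z in domDL d L, (‖fderiv ℝ h z‖ ^ 2 + (h z) ^ 2)

/-- The potential energy `∫_{D_L} F(h)`. -/
def potEnergy (d : ℕ) (L : ℝ) (F : ℝ → ℝ) (h : Eucl d → ℝ) : ℝ :=
  ∫ z in domDL d L, F (h z)

/-- The energy `∫_{D_L} ½|∇h|² + F(h)`. -/
def fullEnergy (d : ℕ) (L : ℝ) (F : ℝ → ℝ) (h : Eucl d → ℝ) : ℝ :=
  ∫ z in domDL d L, (1/2 * ‖fderiv ℝ h z‖ ^ 2 + F (h z))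

/-- Normalization constant `Z₁^ε` of the Gaussian measure `ν₁^ε`. -/
def Z1 (d : ℕ) (L a : ℝ) (disc : Disc d L a) (ε : ℝ) : ℝ :=
  ∫ g, Real.exp (-(1/(2*ε)) * dirEnergy d L (discFun d L a disc g)) ∂(gridVol d L a disc)

/-- Normalization constant `Z₂^ε` of the unscaled Gaussian measure `ν₂^ε`. -/
def Z2 (d : ℕ) (L a : ℝ) (disc : Disc d L a) : ℝ :=
  ∫ g, Real.exp (-(1/2) * dirEnergy d L (discFun d L a disc g)) ∂(gridVol d L a disc)

/-- Normalization constant `Z₃^{ε,κ}` of the massive Gaussian measure `ρ^ε_κ` on `ℋ₀^{L,a}`. -/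
def Z3 (d : ℕ) (L a : ℝ) (disc : Disc d L a) (ε κ : ℝ) : ℝ :=
  ∫ g, Real.exp (-(κ/(2*ε)) * sobNormSq d L (disc.interp0 g)) ∂(gridVol d L a disc)

/-- Normalization constant `Z^{L,a,ε}` of the Gibbs measure `μ^{L,a,ε}`. -/
def Zmu (d : ℕ) (L a : ℝ) (disc : Disc d L a) (F : ℝ → ℝ) (ε : ℝ) : ℝ :=
  ∫ g, Real.exp (-(1/ε) * fullEnergy d L F (discFun d L a disc g)) ∂(gridVol d L a disc)

/-- The Gibbs measure `μ^{L,a,ε}`, in grid coordinates. -/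
def gibbs (d : ℕ) (L a : ℝ) (disc : Disc d L a) (F : ℝ → ℝ) (ε : ℝ) :
    Measure ((gridSet d L a) → ℝ) :=
  (gridVol d L a disc).withDensity fun g =>
    ENNReal.ofReal
      (Real.exp (-(1/ε) * fullEnergy d L F (discFun d L a disc g)) / Zmu d L a disc F ε)

/-- The massive Gaussian measure `ρ^ε_κ` on `ℋ₀^{L,a}`, in grid coordinates. -/
def rhoMeas (d : ℕ) (L a : ℝ) (disc : Disc d L a) (ε κ : ℝ) :
    Measure ((gridSet d L a) → ℝ) :=
  (gridVol d L a disc).withDensity fun g =>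
    ENNReal.ofReal
      (Real.exp (-(κ/(2*ε)) * sobNormSq d L (disc.interp0 g)) / Z3 d L a disc ε κ)

/-- The Gaussian measure `ν₁^ε` (scaled discrete free field with `±1` boundary values),
in grid coordinates. -/
def nu1 (d : ℕ) (L a : ℝ) (disc : Disc d L a) (ε : ℝ) : Measure ((gridSet d L a) → ℝ) :=
  (gridVol d L a disc).withDensity fun g =>
    ENNReal.ofReal
      (Real.exp (-(1/(2*ε)) * dirEnergy d L (discFun d L a disc g)) / Z1 d L a disc ε)

/-- Sum of the squared grid values. -/
def sumSq (d : ℕ) (L a : ℝ) (disc : Disc d L a) (g : (gridSet d L a) → ℝ) : ℝ :=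
  letI := disc.gridFin; ∑ z, (g z) ^ 2

/-! ### The potential near its wells -/

namespace IsStdPotential

variable {F : ℝ → ℝ}

theorem differentiable (hF : IsStdPotential F) : Differentiable ℝ F :=
  hF.smooth.differentiable (by norm_num)

theorem continuous (hF : IsStdPotential F) : Continuous F := hF.smooth.continuous

theorem contDiff_deriv (hF : IsStdPotential F) : ContDiff ℝ 2 (deriv F) :=
  ((contDiff_succ_iff_deriv (n := 2)).1 (by simpa using! hF.smooth)).2.2

theorem apply_one (hF : IsStdPotential F) : F 1 = 0 := (hF.zero_iff 1).2 (Or.inl rfl)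

theorem apply_neg_one (hF : IsStdPotential F) : F (-1) = 0 := (hF.zero_iff (-1)).2 (Or.inr rfl)

theorem pos (hF : IsStdPotential F) {u : ℝ} (h1 : u ≠ 1) (h2 : u ≠ -1) : 0 < F u :=
  lt_of_le_of_ne (hF.nonneg u) fun h => by
    rcases (hF.zero_iff u).1 h.symm with h | h <;> contradiction

theorem deriv_neg (hF : IsStdPotential F) (u : ℝ) : deriv F (-u) = -deriv F u := by
  have h : (fun x => F (-x)) = F := funext hF.symm
  have := deriv_comp_neg F u
  rw [h] at this
  linarith

/-- Quadratic bounds on `F` and linear bounds on its derivative near the well at `1`. -/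
theorem bounds_near_one (hF : IsStdPotential F) : ∃ η q : ℝ, 0 < η ∧ η < 1 ∧ 0 < q ∧
    ∀ u, |u - 1| ≤ η → q / 2 * |u - 1| ≤ |deriv F u| ∧ |deriv F u| ≤ 2 * q * |u - 1| ∧
      0 ≤ deriv F u * (u - 1) ∧ q / 4 * (u - 1) ^ 2 ≤ F u ∧ F u ≤ q * (u - 1) ^ 2 := by
  set q := deriv (deriv F) 1 with hq
  have hqpos : 0 < q := hF.dd_one_pos
  have hc : Continuous (deriv (deriv F)) := hF.contDiff_deriv.continuous_deriv (by norm_num)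
  have hd : Differentiable ℝ (deriv F) := hF.contDiff_deriv.differentiable (by norm_num)
  obtain ⟨η, hη, hball⟩ := Metric.continuousAt_iff.1 hc.continuousAt (q / 2) (by positivity)
  have hdd : ∀ u, |u - 1| < η → q / 2 ≤ deriv (deriv F) u ∧ deriv (deriv F) u ≤ 2 * q := by
    intro u hu
    have := hball (x := u) (by rwa [Real.dist_eq])
    rw [Real.dist_eq, abs_lt] at this
    constructor <;> linarith
  have h1 : deriv F 1 = 0 := (hF.deriv_zero_iff 1).2 (by simp)
  have hmono : ∀ (g : ℝ → ℝ), Differentiable ℝ g →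
      (∀ u, |u - 1| < η → 0 ≤ deriv g u) → MonotoneOn g (Set.Ioo (1 - η) (1 + η)) := by
    intro g hg h
    apply monotoneOn_of_deriv_nonneg (convex_Ioo _ _) hg.continuous.continuousOn
      hg.differentiableOn
    intro x hx
    rw [interior_Ioo] at hx
    exact h x (by rw [abs_lt]; constructor <;> linarith [hx.1, hx.2])
  have m1 : MonotoneOn (fun u => deriv F u - q / 2 * (u - 1)) (Set.Ioo (1 - η) (1 + η)) := by
    refine hmono _ (by fun_prop) fun u hu => ?_
    have : deriv (fun u => deriv F u - q / 2 * (u - 1)) u = deriv (deriv F) u - q / 2 := by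
      apply HasDerivAt.deriv
      convert! (hd u).hasDerivAt.sub (((hasDerivAt_id u).sub_const 1).const_mul (q / 2)) using 1
      ring
    rw [this]; linarith [(hdd u hu).1]
  have m2 : MonotoneOn (fun u => 2 * q * (u - 1) - deriv F u) (Set.Ioo (1 - η) (1 + η)) := by
    refine hmono _ (by fun_prop) fun u hu => ?_
    have : deriv (fun u => 2 * q * (u - 1) - deriv F u) u = 2 * q - deriv (deriv F) u := by
      apply HasDerivAt.deriv
      convert! (((hasDerivAt_id u).sub_const 1).const_mul (2 * q)).sub (hd u).hasDerivAt using 1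
      ring
    rw [this]; linarith [(hdd u hu).2]
  have one_mem : (1 : ℝ) ∈ Set.Ioo (1 - η) (1 + η) := ⟨by linarith, by linarith⟩
  have mem : ∀ {u}, |u - 1| < η → u ∈ Set.Ioo (1 - η) (1 + η) := by
    intro u hu
    rw [abs_lt] at hu
    exact ⟨by linarith, by linarith⟩
  have right : ∀ u, |u - 1| < η → 1 ≤ u →
      q / 2 * (u - 1) ≤ deriv F u ∧ deriv F u ≤ 2 * q * (u - 1) := by
    intro u hu h
    have a := m1 one_mem (mem hu) h
    have b := m2 one_mem (mem hu) h
    simp only [h1, sub_self, mul_zero] at a b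
    constructor <;> linarith
  have left : ∀ u, |u - 1| < η → u ≤ 1 →
      2 * q * (u - 1) ≤ deriv F u ∧ deriv F u ≤ q / 2 * (u - 1) := by
    intro u hu h
    have a := m1 (mem hu) one_mem h
    have b := m2 (mem hu) one_mem h
    simp only [h1, sub_self, mul_zero] at a b
    constructor <;> linarith
  have key : ∀ c : ℝ, ∀ u, deriv (fun u => F u - c * (u - 1) ^ 2) u
      = deriv F u - 2 * c * (u - 1) := by
    intro c u
    apply HasDerivAt.deriv
    convert! (hF.differentiable u).hasDerivAt.sub
      ((((hasDerivAt_id u).sub_const 1).pow 2).const_mul c) using 1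
    simp; ring
  have hdiff : ∀ c : ℝ, Differentiable ℝ (fun u => F u - c * (u - 1) ^ 2) := fun c =>
    hF.differentiable.sub (by fun_prop)
  have quad : ∀ u, |u - 1| < η → q / 4 * (u - 1) ^ 2 ≤ F u ∧ F u ≤ q * (u - 1) ^ 2 := by
    intro u hu
    rcases le_total 1 u with h | h
    · have e1 : MonotoneOn (fun u => F u - q / 4 * (u - 1) ^ 2) (Set.Icc 1 u) := by
        apply monotoneOn_of_deriv_nonneg (convex_Icc _ _) (hdiff _).continuous.continuousOn
          (hdiff _).differentiableOn
        intro x hx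
        rw [interior_Icc] at hx
        rw [key]
        have := right x (by rw [abs_lt] at *; constructor <;> linarith [hx.1, hx.2]) hx.1.le
        linarith
      have e2 : AntitoneOn (fun u => F u - q * (u - 1) ^ 2) (Set.Icc 1 u) := by
        apply antitoneOn_of_deriv_nonpos (convex_Icc _ _) (hdiff _).continuous.continuousOn
          (hdiff _).differentiableOn
        intro x hx
        rw [interior_Icc] at hx
        rw [key]
        have := right x (by rw [abs_lt] at *; constructor <;> linarith [hx.1, hx.2]) hx.1.le
        linarith
      have a := e1 (Set.left_mem_Icc.2 h) (Set.right_mem_Icc.2 h) h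
      have b := e2 (Set.left_mem_Icc.2 h) (Set.right_mem_Icc.2 h) h
      simp only [hF.apply_one, sub_self] at a b
      constructor <;> nlinarith
    · have e1 : AntitoneOn (fun u => F u - q / 4 * (u - 1) ^ 2) (Set.Icc u 1) := by
        apply antitoneOn_of_deriv_nonpos (convex_Icc _ _) (hdiff _).continuous.continuousOn
          (hdiff _).differentiableOn
        intro x hx
        rw [interior_Icc] at hx
        rw [key]
        have := left x (by rw [abs_lt] at *; constructor <;> linarith [hx.1, hx.2]) hx.2.le
        linarith
      have e2 : MonotoneOn (fun u => F u - q * (u - 1) ^ 2) (Set.Icc u 1) := by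
        apply monotoneOn_of_deriv_nonneg (convex_Icc _ _) (hdiff _).continuous.continuousOn
          (hdiff _).differentiableOn
        intro x hx
        rw [interior_Icc] at hx
        rw [key]
        have := left x (by rw [abs_lt] at *; constructor <;> linarith [hx.1, hx.2]) hx.2.le
        linarith
      have a := e1 (Set.left_mem_Icc.2 h) (Set.right_mem_Icc.2 h) h
      have b := e2 (Set.left_mem_Icc.2 h) (Set.right_mem_Icc.2 h) h
      simp only [hF.apply_one, sub_self] at a b
      constructor <;> nlinarith
  refine ⟨min (η / 2) (1 / 2), q, by positivity, ?_, hqpos, fun u hu => ?_⟩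
  · exact (min_le_right _ _).trans_lt (by norm_num)
  have hu' : |u - 1| < η := by
    have := min_le_left (η / 2) (1 / 2)
    linarith
  refine ⟨?_, ?_, ?_, quad u hu'⟩
  · rcases le_total 1 u with h | h
    · rw [abs_of_nonneg (by linarith : 0 ≤ u - 1)]
      exact (right u hu' h).1.trans (le_abs_self _)
    · rw [abs_of_nonpos (by linarith : u - 1 ≤ 0)]
      have := (left u hu' h).2
      exact le_trans (by linarith) (neg_le_abs _)
  · rcases le_total 1 u with h | h
    · have := right u hu' h
      rw [abs_of_nonneg (by linarith : 0 ≤ u - 1), abs_le]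
      constructor <;> nlinarith
    · have := left u hu' h
      rw [abs_of_nonpos (by linarith : u - 1 ≤ 0), abs_le]
      constructor <;> nlinarith
  · rcases le_total 1 u with h | h
    · have := right u hu' h
      exact mul_nonneg (le_trans (by nlinarith) this.1) (by linarith)
    · have := left u hu' h
      exact mul_nonneg_of_nonpos_of_nonpos (this.2.trans (by nlinarith)) (by linarith)

/-- The derivative of `F` is controlled by `√(2F)` on compact intervals. -/
theorem exists_abs_deriv_le (hF : IsStdPotential F) :
    ∃ Λ : ℝ, 0 < Λ ∧ ∀ u, |u| ≤ 2 → |deriv F u| ≤ Λ * Real.sqrt (2 * F u) := by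
  obtain ⟨η, q, hη, hη1, hq, hb⟩ := hF.bounds_near_one
  have hcd : Continuous (deriv F) := hF.contDiff_deriv.continuous
  have near : ∀ u, |u - 1| ≤ η → |deriv F u| ≤ 2 * Real.sqrt (2 * q) * Real.sqrt (2 * F u) := by
    intro u hu
    obtain ⟨-, h2, -, h4, -⟩ := hb u hu
    have : Real.sqrt (q / 2) * |u - 1| ≤ Real.sqrt (2 * F u) := by
      rw [← Real.sqrt_sq_eq_abs, ← Real.sqrt_mul (by positivity)]
      apply Real.sqrt_le_sqrt
      linarith
    calc |deriv F u| ≤ 2 * q * |u - 1| := h2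
      _ = 2 * Real.sqrt (2 * q) * (Real.sqrt (q / 2) * |u - 1|) := by
          have : Real.sqrt (2 * q) * Real.sqrt (q / 2) = q := by
            rw [← Real.sqrt_mul (by positivity), show 2 * q * (q / 2) = q ^ 2 by ring,
              Real.sqrt_sq hq.le]
          linear_combination (-2 * |u - 1|) * this
      _ ≤ _ := by gcongr
  have hK : IsCompact (Set.Icc (-2 : ℝ) 2 ∩ {u | η ≤ |u - 1| ∧ η ≤ |u + 1|}) :=
    isCompact_Icc.inter_right
      ((isClosed_le (f := fun _ : ℝ => η) (g := fun u : ℝ => |u - 1|) (by fun_prop)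
        (by fun_prop)).inter
        (isClosed_le (f := fun _ : ℝ => η) (g := fun u : ℝ => |u + 1|) (by fun_prop)
        (by fun_prop)))
  have hpos : ∀ u ∈ Set.Icc (-2 : ℝ) 2 ∩ {u | η ≤ |u - 1| ∧ η ≤ |u + 1|},
      0 < Real.sqrt (2 * F u) := by
    rintro u ⟨-, h1, h2⟩
    apply Real.sqrt_pos.2
    have := hF.pos (u := u) (by rintro rfl; simp at h1; linarith)
      (by rintro rfl; simp at h2; linarith)
    linarith
  obtain ⟨C, hC⟩ := hK.exists_bound_of_continuousOn
    (f := fun u => deriv F u / Real.sqrt (2 * F u))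
    (hcd.continuousOn.div ((continuous_const.mul hF.continuous).sqrt.continuousOn)
      fun u hu => (hpos u hu).ne')
  refine ⟨max (2 * Real.sqrt (2 * q)) C, by positivity, fun u hu => ?_⟩
  by_cases h1 : |u - 1| ≤ η
  · exact (near u h1).trans (by gcongr; exact le_max_left _ _)
  by_cases h2 : |u + 1| ≤ η
  · have := near (-u) (by rw [← abs_neg]; convert h2 using 2; ring)
    rw [hF.symm, hF.deriv_neg, abs_neg] at this
    exact this.trans (by gcongr; exact le_max_left _ _)
  have hm : u ∈ Set.Icc (-2 : ℝ) 2 ∩ {u | η ≤ |u - 1| ∧ η ≤ |u + 1|} :=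
    ⟨abs_le.1 hu, by push Not at h1; exact h1.le, by push Not at h2; exact h2.le⟩
  have := hC u hm
  rw [Real.norm_eq_abs, abs_div, abs_of_pos (hpos u hm), div_le_iff₀ (hpos u hm)] at this
  exact this.trans (by gcongr; exact le_max_right _ _)

end IsStdPotential

/-! ### The signed square root of `2F` -/

/-- The function `√(2F)` with its sign reversed outside of `[-1,1]`, so that `1` is an
attracting and `-1` a repelling rest point of `u' = signedW F u`. -/
def signedW (F : ℝ → ℝ) (u : ℝ) : ℝ :=
  if |u| ≤ 1 then Real.sqrt (2 * F u) else -Real.sqrt (2 * F u)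

theorem signedW_of_abs_le {F : ℝ → ℝ} {u : ℝ} (h : |u| ≤ 1) :
    signedW F u = Real.sqrt (2 * F u) := if_pos h

namespace IsStdPotential

variable {F : ℝ → ℝ}

theorem signedW_sq (hF : IsStdPotential F) (u : ℝ) : signedW F u ^ 2 = 2 * F u := by
  have h := Real.sq_sqrt (mul_nonneg (by norm_num : (0:ℝ) ≤ 2) (hF.nonneg u))
  unfold signedW
  split_ifs <;> simp only [neg_sq, h]

theorem continuous_sqrt (hF : IsStdPotential F) : Continuous fun u => Real.sqrt (2 * F u) :=
  (continuous_const.mul hF.continuous).sqrt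

theorem signedW_of_one_le_abs (hF : IsStdPotential F) {u : ℝ} (h : 1 ≤ |u|) :
    signedW F u = -Real.sqrt (2 * F u) := by
  unfold signedW
  split_ifs with h1
  · have : F u = 0 := by
      rw [hF.zero_iff]
      rcases abs_cases u with ⟨h2, h3⟩ | ⟨h2, h3⟩
      · left; linarith
      · right; linarith
    simp [this]
  · rfl

theorem continuous_signedW (hF : IsStdPotential F) : Continuous (signedW F) := by
  refine Continuous.if_le hF.continuous_sqrt hF.continuous_sqrt.neg continuous_abs
    continuous_const fun x hx => ?_
  exact (signedW_of_abs_le hx.le).symm.trans (hF.signedW_of_one_le_abs hx.ge)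

theorem hasDerivAt_sqrt (hF : IsStdPotential F) {u : ℝ} (h : |u| ≠ 1) :
    HasDerivAt (fun u => Real.sqrt (2 * F u)) (deriv F u / Real.sqrt (2 * F u)) u := by
  have hpos : 0 < F u := hF.pos (by rintro rfl; simp at h) (by rintro rfl; simp at h)
  have := ((hF.differentiable u).hasDerivAt.const_mul 2).sqrt (by positivity)
  convert! this using 1
  field_simp

theorem deriv_signedW_of_lt (hF : IsStdPotential F) {u : ℝ} (h : |u| < 1) :
    HasDerivAt (signedW F) (deriv F u / Real.sqrt (2 * F u)) u := by
  refine (hF.hasDerivAt_sqrt h.ne).congr_of_eventuallyEq ?_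
  filter_upwards [continuous_abs.continuousAt.eventually_lt continuousAt_const h] with x hx
  exact signedW_of_abs_le hx.le

theorem deriv_signedW_of_gt (hF : IsStdPotential F) {u : ℝ} (h : 1 < |u|) :
    HasDerivAt (signedW F) (-(deriv F u / Real.sqrt (2 * F u))) u := by
  refine (hF.hasDerivAt_sqrt h.ne').neg.congr_of_eventuallyEq ?_
  filter_upwards [continuousAt_const.eventually_lt continuous_abs.continuousAt h] with x hx
  exact hF.signedW_of_one_le_abs hx.le

theorem sqrt_pos (hF : IsStdPotential F) {u : ℝ} (h : |u| ≠ 1) : 0 < Real.sqrt (2 * F u) := by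
  have hpos : 0 < F u := hF.pos (by rintro rfl; simp at h) (by rintro rfl; simp at h)
  positivity

/-- Near `1`, the field `signedW F` is strictly contracting. -/
theorem exists_antitoneOn_signedW (hF : IsStdPotential F) : ∃ η κ : ℝ, 0 < η ∧ η < 1 ∧ 0 < κ ∧
    AntitoneOn (fun u => signedW F u + κ * u) (Set.Icc (1 - η) (1 + η)) := by
  obtain ⟨η, q, hη, hη1, hq, hb⟩ := hF.bounds_near_one
  set κ := q / 2 / Real.sqrt (2 * q) with hκ
  have hκ0 : 0 < κ := by positivity
  have ratio : ∀ u, |u - 1| ≤ η → u ≠ 1 → κ ≤ |deriv F u| / Real.sqrt (2 * F u) := by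
    intro u hu hne
    obtain ⟨h1, -, -, h4, h5⟩ := hb u hu
    have hs : Real.sqrt (2 * F u) ≤ Real.sqrt (2 * q) * |u - 1| := by
      rw [← Real.sqrt_sq_eq_abs, ← Real.sqrt_mul (by positivity)]
      apply Real.sqrt_le_sqrt
      linarith
    have hp : 0 < Real.sqrt (2 * F u) := by
      apply hF.sqrt_pos
      intro h
      rcases abs_eq (by norm_num : (0:ℝ) ≤ 1) |>.1 h with h | h
      · exact hne h
      · subst h; rw [abs_le] at hu; linarith [hu.1]
    rw [le_div_iff₀ hp]
    calc κ * Real.sqrt (2 * F u) ≤ κ * (Real.sqrt (2 * q) * |u - 1|) := by gcongr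
      _ = q / 2 * |u - 1| := by rw [hκ]; field_simp
      _ ≤ _ := h1
  have hcont : Continuous fun u => signedW F u + κ * u :=
    hF.continuous_signedW.add (by fun_prop)
  refine ⟨η, κ, hη, hη1, hκ0, ?_⟩
  rw [← Set.Icc_union_Icc_eq_Icc (by linarith : 1 - η ≤ 1) (by linarith : 1 ≤ 1 + η)]
  have hl : AntitoneOn (fun u => signedW F u + κ * u) (Set.Icc (1 - η) 1) := by
    apply antitoneOn_of_hasDerivWithinAt_nonpos (convex_Icc _ _) hcont.continuousOn
      (f' := fun u => deriv F u / Real.sqrt (2 * F u) + κ * 1)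
    · intro x hx
      rw [interior_Icc] at hx
      exact ((hF.deriv_signedW_of_lt (by rw [abs_lt]; constructor <;> linarith [hx.1, hx.2])).add
        ((hasDerivAt_id x).const_mul κ)).hasDerivWithinAt
    · intro x hx
      rw [interior_Icc] at hx
      have hx1 : |x - 1| ≤ η := by rw [abs_le]; constructor <;> linarith [hx.1, hx.2]
      have h := ratio x hx1 hx.2.ne
      have h0 : deriv F x ≤ 0 := by
        have := (hb x hx1).2.2.1
        by_contra hh
        push Not at hh
        nlinarith [hx.2]
      rw [abs_of_nonpos h0, neg_div] at h
      simp only [mul_one]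
      linarith
  have hr : AntitoneOn (fun u => signedW F u + κ * u) (Set.Icc 1 (1 + η)) := by
    apply antitoneOn_of_hasDerivWithinAt_nonpos (convex_Icc _ _) hcont.continuousOn
      (f' := fun u => -(deriv F u / Real.sqrt (2 * F u)) + κ * 1)
    · intro x hx
      rw [interior_Icc] at hx
      exact ((hF.deriv_signedW_of_gt (lt_abs.2 (Or.inl hx.1))).add
        ((hasDerivAt_id x).const_mul κ)).hasDerivWithinAt
    · intro x hx
      rw [interior_Icc] at hx
      have hx1 : |x - 1| ≤ η := by rw [abs_le]; constructor <;> linarith [hx.1, hx.2]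
      have h := ratio x hx1 hx.1.ne'
      have h0 : 0 ≤ deriv F x := by
        have := (hb x hx1).2.2.1
        by_contra hh
        push Not at hh
        nlinarith [hx.1]
      rw [abs_of_nonneg h0] at h
      simp only [mul_one]
      linarith
  exact hl.union_right hr (isGreatest_Icc (by linarith)) (isLeast_Icc (by linarith))

/-- On `[-2,2]`, the field `signedW F` satisfies a one-sided Lipschitz condition. -/
theorem exists_monotoneOn_sub_signedW (hF : IsStdPotential F) : ∃ Λ : ℝ, 0 < Λ ∧
    MonotoneOn (fun u => Λ * u - signedW F u) (Set.Icc (-2) 2) := by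
  obtain ⟨Λ, hΛ, hb⟩ := hF.exists_abs_deriv_le
  have ratio : ∀ u, |u| ≤ 2 → |deriv F u / Real.sqrt (2 * F u)| ≤ Λ := by
    intro u hu
    rw [abs_div, abs_of_nonneg (Real.sqrt_nonneg _)]
    exact div_le_of_le_mul₀ (Real.sqrt_nonneg _) hΛ.le (hb u hu)
  have hcont : Continuous fun u => Λ * u - signedW F u :=
    (by fun_prop : Continuous fun u => Λ * u).sub hF.continuous_signedW
  have piece : ∀ s t : ℝ, -2 ≤ s → t ≤ 2 → (∀ u ∈ Set.Ioo s t, |u| ≠ 1) →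
      MonotoneOn (fun u => Λ * u - signedW F u) (Set.Icc s t) := by
    intro s t hs ht hne
    apply monotoneOn_of_deriv_nonneg (convex_Icc _ _) hcont.continuousOn
    · intro x hx
      rw [interior_Icc] at hx
      have h2 : DifferentiableAt ℝ (signedW F) x := by
        rcases lt_or_gt_of_ne (hne x hx) with h | h
        · exact (hF.deriv_signedW_of_lt h).differentiableAt
        · exact (hF.deriv_signedW_of_gt h).differentiableAt
      exact ((by fun_prop : DifferentiableAt ℝ (fun u => Λ * u) x).sub h2).differentiableWithinAt
    · intro x hx
      rw [interior_Icc] at hx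
      have hr := abs_le.1 (ratio x (abs_le.2 ⟨by linarith [hx.1], by linarith [hx.2]⟩))
      rcases lt_or_gt_of_ne (hne x hx) with h | h
      · have := ((hasDerivAt_id x).const_mul Λ).sub (hF.deriv_signedW_of_lt h)
        rw [show deriv (fun u => Λ * u - signedW F u) x = _ from this.deriv]
        linarith
      · have := ((hasDerivAt_id x).const_mul Λ).sub (hF.deriv_signedW_of_gt h)
        rw [show deriv (fun u => Λ * u - signedW F u) x = _ from this.deriv]
        linarith
  refine ⟨Λ, hΛ, ?_⟩
  have h1 := piece (-2) (-1) le_rfl (by norm_num) fun u hu h => by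
    rcases abs_eq (by norm_num : (0:ℝ) ≤ 1) |>.1 h with h | h <;> linarith [hu.1, hu.2]
  have h2 := piece (-1) 1 (by norm_num) (by norm_num) fun u hu h => by
    rcases abs_eq (by norm_num : (0:ℝ) ≤ 1) |>.1 h with h | h <;> linarith [hu.1, hu.2]
  have h3 := piece 1 2 (by norm_num) le_rfl fun u hu h => by
    rcases abs_eq (by norm_num : (0:ℝ) ≤ 1) |>.1 h with h | h <;> linarith [hu.1, hu.2]
  have h12 := h1.union_right h2 (isGreatest_Icc (by norm_num)) (isLeast_Icc (by norm_num))
  rw [Set.Icc_union_Icc_eq_Icc (by norm_num) (by norm_num)] at h12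
  have h123 := h12.union_right h3 (isGreatest_Icc (by norm_num)) (isLeast_Icc (by norm_num))
  rwa [Set.Icc_union_Icc_eq_Icc (by norm_num) (by norm_num)] at h123

end IsStdPotential

/-! ### One-dimensional energies -/

/-- The one-dimensional energy of `f` on the interval from `s` to `t`. -/
def energy1 (F f : ℝ → ℝ) (s t : ℝ) : ℝ := ∫ x in s..t, (1/2 * (deriv f x) ^ 2 + F (f x))

/-- `f` is a Lipschitz transition from `-1` to `1` that takes place in `[-R, R]`. -/
structure IsTransition (f : ℝ → ℝ) (R : ℝ) : Prop where
  lip : ∃ K, LipschitzWith K f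
  right : ∀ x, R ≤ x → f x = 1
  left : ∀ x, x ≤ -R → f x = -1

theorem intervalIntegrable_of_abs_le {g : ℝ → ℝ} (hg : Measurable g) {B : ℝ}
    (hB : ∀ x, |g x| ≤ B) (s t : ℝ) : IntervalIntegrable g volume s t :=
  (intervalIntegrable_const (c := B)).mono_fun hg.aestronglyMeasurable
    (ae_of_all _ fun x => (hB x).trans (le_abs_self B))

theorem LipschitzWith.abs_deriv_le {K : NNReal} {f : ℝ → ℝ} (hf : LipschitzWith K f) (x : ℝ) :
    |deriv f x| ≤ K := norm_deriv_le_of_lipschitz hf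

theorem LipschitzWith.intervalIntegrable_deriv {K : NNReal} {f : ℝ → ℝ} (hf : LipschitzWith K f)
    (s t : ℝ) : IntervalIntegrable (deriv f) volume s t :=
  intervalIntegrable_of_abs_le (measurable_deriv f) hf.abs_deriv_le s t

theorem LipschitzWith.intervalIntegrable_deriv_sq {K : NNReal} {f : ℝ → ℝ}
    (hf : LipschitzWith K f) (s t : ℝ) :
    IntervalIntegrable (fun x => (deriv f x) ^ 2) volume s t :=
  intervalIntegrable_of_abs_le ((measurable_deriv f).pow_const 2) (B := (K : ℝ) ^ 2)
    (fun x => by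
      rw [abs_pow]
      exact pow_le_pow_left₀ (abs_nonneg _) (hf.abs_deriv_le x) 2) s t

theorem LipschitzWith.intervalIntegrable_energy {K : NNReal} {f : ℝ → ℝ}
    (hf : LipschitzWith K f) {F : ℝ → ℝ} (hF : Continuous F) (s t : ℝ) :
    IntervalIntegrable (fun x => 1/2 * (deriv f x) ^ 2 + F (f x)) volume s t :=
  ((hf.intervalIntegrable_deriv_sq s t).const_mul _).add
    ((hF.comp hf.continuous).intervalIntegrable s t)

/-- Chain rule and fundamental theorem of calculus for Lipschitz functions. -/
theorem LipschitzWith.integral_comp_mul_deriv {K : NNReal} {f : ℝ → ℝ} (hf : LipschitzWith K f)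
    {Φ w : ℝ → ℝ} (hΦ : ∀ u, HasDerivAt Φ (w u) u) (hw : Continuous w) (s t : ℝ) :
    ∫ x in s..t, w (f x) * deriv f x = Φ (f t) - Φ (f s) := by
  have hΦd : deriv Φ = w := funext fun u => (hΦ u).deriv
  have hC : ContDiff ℝ 1 Φ := contDiff_one_iff_deriv.2
    ⟨fun u => (hΦ u).differentiableAt, hΦd ▸ hw⟩
  have hcomp : IsCompact (f '' Set.uIcc s t) := isCompact_uIcc.image hf.continuous
  obtain ⟨B, hB⟩ := hcomp.isBounded.subset_closedBall 0
  obtain ⟨M, hM⟩ := hC.contDiffOn.exists_lipschitzOnWith one_ne_zero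
    (convex_closedBall (0 : ℝ) B) (isCompact_closedBall 0 B)
  have hlip : LipschitzOnWith (M * K) (fun x => Φ (f x)) (Set.uIcc s t) :=
    hM.comp hf.lipschitzOnWith fun x hx => hB ⟨x, hx, rfl⟩
  rw [← hlip.absolutelyContinuousOnInterval.integral_deriv_eq_sub]
  apply intervalIntegral.integral_congr_ae
  filter_upwards [hf.ae_differentiableAt_real] with x hx _
  exact ((hΦ (f x)).comp x hx.hasDerivAt).deriv.symm

theorem energy1_add {K : NNReal} {F f : ℝ → ℝ} (hF : Continuous F) (hf : LipschitzWith K f)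
    (s t u : ℝ) : energy1 F f s t + energy1 F f t u = energy1 F f s u :=
  intervalIntegral.integral_add_adjacent_intervals (hf.intervalIntegrable_energy hF s t)
    (hf.intervalIntegrable_energy hF t u)

/-- Completing the square in the energy. -/
theorem energy1_eq {K : NNReal} {F f Φ w : ℝ → ℝ} (hF : Continuous F) (hf : LipschitzWith K f)
    (hΦ : ∀ u, HasDerivAt Φ (w u) u) (hw : Continuous w) (hwF : ∀ u, w u ^ 2 = 2 * F u)
    (s t : ℝ) :
    energy1 F f s t = Φ (f t) - Φ (f s) + 1/2 * ∫ x in s..t, (deriv f x - w (f x)) ^ 2 := by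
  have hi : IntervalIntegrable (fun x => w (f x) * deriv f x) volume s t :=
    (hf.intervalIntegrable_deriv s t).continuousOn_mul (hw.comp hf.continuous).continuousOn
  have he := hf.intervalIntegrable_energy hF s t
  rw [← hf.integral_comp_mul_deriv hΦ hw s t, ← intervalIntegral.integral_const_mul,
    energy1]
  rw [show (fun x => 1/2 * (deriv f x - w (f x)) ^ 2)
    = fun x => (1/2 * (deriv f x) ^ 2 + F (f x)) - w (f x) * deriv f x from ?_]
  · rw [intervalIntegral.integral_sub he hi]; ring
  · funext x
    linear_combination (1/2) * hwF (f x)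

theorem sub_le_energy1 {K : NNReal} {F f Φ w : ℝ → ℝ} (hF : Continuous F)
    (hf : LipschitzWith K f) (hΦ : ∀ u, HasDerivAt Φ (w u) u) (hw : Continuous w)
    (hwF : ∀ u, w u ^ 2 = 2 * F u) {s t : ℝ} (hst : s ≤ t) :
    Φ (f t) - Φ (f s) ≤ energy1 F f s t := by
  rw [energy1_eq hF hf hΦ hw hwF]
  have := intervalIntegral.integral_nonneg (μ := volume) hst
    (f := fun x => (deriv f x - w (f x)) ^ 2) fun x _ => sq_nonneg _
  linarith

theorem abs_sub_le_energy1 {K : NNReal} {F f Φ w : ℝ → ℝ} (hF : Continuous F)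
    (hf : LipschitzWith K f) (hΦ : ∀ u, HasDerivAt Φ (w u) u) (hw : Continuous w)
    (hwF : ∀ u, w u ^ 2 = 2 * F u) {s t : ℝ} (hst : s ≤ t) :
    |Φ (f t) - Φ (f s)| ≤ energy1 F f s t := by
  rw [abs_le]
  have h1 := sub_le_energy1 hF hf hΦ hw hwF hst
  have h2 := sub_le_energy1 hF hf (Φ := fun u => -Φ u) (w := fun u => -w u)
    (fun u => (hΦ u).neg) hw.neg (fun u => by simp [hwF]) hst
  constructor <;> linarith

theorem hasDerivAt_primitive {w : ℝ → ℝ} (hw : Continuous w) (u : ℝ) :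
    HasDerivAt (fun u => ∫ x in (0:ℝ)..u, w x) (w u) u :=
  intervalIntegral.integral_hasDerivAt_right (hw.intervalIntegrable _ _)
    (hw.stronglyMeasurableAtFilter _ _) hw.continuousAt

theorem primitive_sub {w : ℝ → ℝ} (hw : Continuous w) (s t : ℝ) :
    (∫ x in (0:ℝ)..t, w x) - (∫ x in (0:ℝ)..s, w x) = ∫ x in s..t, w x :=
  intervalIntegral.integral_interval_sub_left (hw.intervalIntegrable _ _)
    (hw.intervalIntegrable _ _)

namespace IsTransition

variable {F f : ℝ → ℝ} {R : ℝ}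

theorem pos (h : IsTransition f R) : 0 < R := by
  by_contra hR
  push Not at hR
  have h1 := h.right R le_rfl
  have h2 := h.left R (by linarith)
  linarith

theorem mono (h : IsTransition f R) {R' : ℝ} (hR : R ≤ R') : IsTransition f R' :=
  ⟨h.lip, fun x hx => h.right x (hR.trans hx), fun x hx => h.left x (by linarith)⟩

theorem energy1_eq (h : IsTransition f R) (hF : IsStdPotential F) {R' : ℝ} (hR : R ≤ R') :
    energy1 F f (-R') R' = energy1 F f (-R) R := by
  obtain ⟨K, hK⟩ := h.lip
  have e1 : energy1 F f R R' = 0 := by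
    unfold energy1
    apply intervalIntegral.integral_zero_ae
    refine ae_of_all _ fun x hx => ?_
    rw [Set.uIoc_of_le hR] at hx
    have : f =ᶠ[𝓝 x] fun _ => 1 := by
      filter_upwards [lt_mem_nhds hx.1] with y hy
      exact h.right y hy.le
    rw [this.deriv_eq, h.right x hx.1.le, hF.apply_one]
    simp
  have e2 : energy1 F f (-R') (-R) = 0 := by
    unfold energy1
    rw [intervalIntegral.integral_of_le (by linarith), integral_Ioc_eq_integral_Ioo,
      setIntegral_congr_fun (g := fun _ => (0 : ℝ)) measurableSet_Ioo, integral_zero]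
    intro x hx
    have : f =ᶠ[𝓝 x] fun _ => -1 := by
      filter_upwards [gt_mem_nhds hx.2] with y hy
      exact h.left y hy.le
    simp only
    rw [this.deriv_eq, h.left x hx.2.le, hF.apply_neg_one]
    simp
  rw [← energy1_add hF.continuous hK (-R') (-R) R', ← energy1_add hF.continuous hK (-R) R R',
    e1, e2]
  ring

end IsTransition

theorem Cstar_eq_primitive {F : ℝ → ℝ} (hF : IsStdPotential F) :
    (∫ x in (0:ℝ)..1, signedW F x) - (∫ x in (0:ℝ)..(-1), signedW F x) = Cstar F := by
  rw [primitive_sub hF.continuous_signedW, Cstar]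
  apply intervalIntegral.integral_congr
  intro u hu
  rw [Set.uIcc_of_le (by norm_num)] at hu
  exact signedW_of_abs_le (abs_le.2 hu)

/-- The energy gap of a transition is the defect in the profile equation. -/
theorem IsTransition.defect_eq {F f : ℝ → ℝ} {R : ℝ} (h : IsTransition f R)
    (hF : IsStdPotential F) :
    energy1 F f (-R) R = Cstar F + 1/2 * ∫ x in (-R)..R, (deriv f x - signedW F (f x)) ^ 2 := by
  obtain ⟨K, hK⟩ := h.lip
  rw [_root_.energy1_eq hF.continuous hK (hasDerivAt_primitive hF.continuous_signedW)
    hF.continuous_signedW hF.signedW_sq, h.right R le_rfl, h.left (-R) le_rfl,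
    Cstar_eq_primitive hF]

theorem IsTransition.Cstar_le {F f : ℝ → ℝ} {R : ℝ} (h : IsTransition f R)
    (hF : IsStdPotential F) : Cstar F ≤ energy1 F f (-R) R := by
  rw [h.defect_eq hF]
  have := intervalIntegral.integral_nonneg (μ := volume) (by linarith [h.pos] : -R ≤ R)
    (f := fun x => (deriv f x - signedW F (f x)) ^ 2) fun x _ => sq_nonneg _
  linarith

/-- Transitions of small energy excess stay close to `[-1,1]`, and stay close to `1` once they
have come close to `1`. -/
theorem exists_transition_bounds {F : ℝ → ℝ} (hF : IsStdPotential F) {η : ℝ} (hη : 0 < η)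
    (hη1 : η < 1) : ∃ e₀ : ℝ, 0 < e₀ ∧ ∀ (f : ℝ → ℝ) (R : ℝ), IsTransition f R →
      energy1 F f (-R) R < Cstar F + e₀ →
      (∀ x, -1 - η ≤ f x ∧ f x ≤ 1 + η) ∧
      ∀ x y, x ≤ y → 1 - η / 2 ≤ f x → 1 - η ≤ f y := by
  have hw := hF.continuous_sqrt
  set w : ℝ → ℝ := fun u => Real.sqrt (2 * F u) with hwdef
  set G : ℝ → ℝ := fun u => ∫ x in (0:ℝ)..u, w x with hG
  have hGd : ∀ u, HasDerivAt G (w u) u := hasDerivAt_primitive hw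
  have hGmono : Monotone G := monotone_of_deriv_nonneg (fun u => (hGd u).differentiableAt)
    fun u => by rw [(hGd u).deriv]; exact Real.sqrt_nonneg _
  have hwF : ∀ u, w u ^ 2 = 2 * F u := fun u =>
    Real.sq_sqrt (mul_nonneg (by norm_num) (hF.nonneg u))
  have hC : G 1 - G (-1) = Cstar F := primitive_sub hw _ _
  have hGlt : ∀ s t : ℝ, s < t → (∀ x ∈ Set.Ioo s t, |x| ≠ 1) → G s < G t := by
    intro s t hst hne
    have : StrictMonoOn G (Set.Icc s t) := by
      apply strictMonoOn_of_deriv_pos (convex_Icc _ _)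
        (fun u _ => (hGd u).continuousAt.continuousWithinAt)
      intro x hx
      rw [interior_Icc] at hx
      rw [(hGd x).deriv]
      exact hF.sqrt_pos (hne x hx)
    exact this (Set.left_mem_Icc.2 hst.le) (Set.right_mem_Icc.2 hst.le) hst
  have g1 : G 1 < G (1 + η) := hGlt _ _ (by linarith) fun x hx => by
    rw [abs_of_pos (by linarith [hx.1])]; exact hx.1.ne'
  have g2 : G (-1 - η) < G (-1) := hGlt _ _ (by linarith) fun x hx => by
    rw [abs_of_neg (by linarith [hx.2])]; linarith [hx.2]
  have g3 : G (1 - η) < G (1 - η / 2) := hGlt _ _ (by linarith) fun x hx => by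
    rw [abs_of_pos (by linarith [hx.1])]; exact (by linarith [hx.2] : x < 1).ne
  refine ⟨min (G (1 + η) - G 1) (min (G (-1) - G (-1 - η)) (G (1 - η / 2) - G (1 - η))),
    by simp only [lt_min_iff, sub_pos]; exact ⟨g1, g2, g3⟩, ?_⟩
  intro f R h he
  obtain ⟨K, hK⟩ := h.lip
  have hR := h.pos
  have b1 := min_le_left (G (1 + η) - G 1)
    (min (G (-1) - G (-1 - η)) (G (1 - η / 2) - G (1 - η)))
  have b23 := min_le_right (G (1 + η) - G 1)
    (min (G (-1) - G (-1 - η)) (G (1 - η / 2) - G (1 - η)))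
  have b2 := b23.trans (min_le_left _ _)
  have b3 := b23.trans (min_le_right _ _)
  have en : ∀ s t, s ≤ t → |G (f t) - G (f s)| ≤ energy1 F f s t := fun s t hst =>
    abs_sub_le_energy1 hF.continuous hK hGd hw hwF hst
  have en0 : ∀ s t, s ≤ t → 0 ≤ energy1 F f s t := fun s t hst =>
    (abs_nonneg _).trans (en s t hst)
  have add := energy1_add hF.continuous hK
  have f1 : f R = 1 := h.right R le_rfl
  have f2 : f (-R) = -1 := h.left (-R) le_rfl
  constructor
  · intro x
    by_cases hx1 : R ≤ x
    · rw [h.right x hx1]; constructor <;> linarith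
    by_cases hx2 : x ≤ -R
    · rw [h.left x hx2]; constructor <;> linarith
    push Not at hx1 hx2
    have ha := add (-R) x R
    have hb := abs_le.1 (en (-R) x hx2.le)
    have hc := abs_le.1 (en x R hx1.le)
    have hd := en0 (-R) x hx2.le
    have hd' := en0 x R hx1.le
    rw [f1] at hc
    rw [f2] at hb
    constructor
    · by_contra hlt
      push Not at hlt
      have := hGmono hlt.le
      linarith
    · by_contra hlt
      push Not at hlt
      have := hGmono hlt.le
      linarith
  · intro x y hxy hx
    by_cases hy1 : R ≤ y
    · rw [h.right y hy1]; linarith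
    by_contra hlt
    push Not at hlt hy1
    have hx2 : -R < x := by
      by_contra hh
      push Not at hh
      rw [h.left x hh] at hx
      linarith
    have ha := add (-R) x R
    have ha' := add x y R
    have hb := abs_le.1 (en (-R) x hx2.le)
    have hc := abs_le.1 (en x y hxy)
    have hd := abs_le.1 (en y R hy1.le)
    rw [f1] at hd
    rw [f2] at hb
    have k1 := hGmono hlt.le
    have k2 := hGmono hx
    linarith

/-! ### Stability of the transition profile in one dimension -/

namespace IsProfile

variable {F m : ℝ → ℝ}

theorem monotone (hm : IsProfile F m) : Monotone m :=
  monotone_of_deriv_nonneg (fun x => (hm.ode x).differentiableAt)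
    fun x => by rw [(hm.ode x).deriv]; exact Real.sqrt_nonneg _

theorem lipschitz (hm : IsProfile F m) (hF : IsStdPotential F) : ∃ K, LipschitzWith K m := by
  obtain ⟨B, hB⟩ := (isCompact_Icc (a := (-1:ℝ)) (b := 1)).exists_bound_of_continuousOn
    hF.continuous_sqrt.continuousOn
  refine ⟨B.toNNReal, lipschitzWith_of_nnnorm_deriv_le (fun x => (hm.ode x).differentiableAt)
    fun x => ?_⟩
  rw [(hm.ode x).deriv, ← NNReal.coe_le_coe, coe_nnnorm]
  exact (hB _ (hm.mem_Icc x)).trans (Real.le_coe_toNNReal B)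

theorem abs_le (hm : IsProfile F m) (x : ℝ) : |m x| ≤ 1 := _root_.abs_le.2 (hm.mem_Icc x)

theorem reflect (hm : IsProfile F m) (hF : IsStdPotential F) : IsProfile F fun x => -m (-x) where
  mem_Icc x := by
    have := hm.mem_Icc (-x)
    exact ⟨by linarith [this.2], by linarith [this.1]⟩
  ode x := by
    have := ((hm.ode (-x)).comp x (hasDerivAt_neg x)).neg
    convert! this using 1
    rw [hF.symm]; ring
  limit_top := by
    have := (hm.limit_bot.comp tendsto_neg_atTop_atBot).neg
    simpa using! this
  limit_bot := (hm.limit_top.comp tendsto_neg_atBot_atTop).neg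
  zero := by simp [hm.zero]

end IsProfile

theorem IsTransition.reflect {f : ℝ → ℝ} {R : ℝ} (h : IsTransition f R) :
    IsTransition (fun x => -f (-x)) R where
  lip := by
    obtain ⟨K, hK⟩ := h.lip
    refine ⟨K, LipschitzWith.of_dist_le_mul fun x y => ?_⟩
    have := hK.dist_le_mul (-x) (-y)
    rwa [dist_neg_neg] at this ⊢
  right x hx := by rw [h.left (-x) (by linarith), neg_neg]
  left x hx := by rw [h.right (-x) (by linarith)]

theorem energy1_reflect {F : ℝ → ℝ} (hF : IsStdPotential F) (f : ℝ → ℝ) (R : ℝ) :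
    energy1 F (fun x => -f (-x)) (-R) R = energy1 F f (-R) R := by
  unfold energy1
  rw [← neg_neg R, neg_neg (-R), ← intervalIntegral.integral_comp_neg, neg_neg]
  congr 1
  funext x
  have : deriv (fun x => -f (-x)) (-x) = deriv f x := by
    rw [deriv.fun_neg, deriv_comp_neg, neg_neg, neg_neg]
  rw [this, hF.symm, neg_neg]

/-- A differential inequality for the squared distance to the profile. -/
theorem IsTransition.ae_deriv_sq {F f m : ℝ → ℝ} {R : ℝ} (h : IsTransition f R)
    (hm : IsProfile F m) (x₀ : ℝ) :
    ∀ᵐ x, deriv (fun x => (f x - m (x - x₀)) ^ 2) x =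
      2 * (f x - m (x - x₀)) * (signedW F (f x) - signedW F (m (x - x₀)) +
        (deriv f x - signedW F (f x))) := by
  obtain ⟨K, hK⟩ := h.lip
  filter_upwards [hK.ae_differentiableAt_real] with x hx
  have h1 : HasDerivAt (fun x => m (x - x₀)) (signedW F (m (x - x₀))) x := by
    have := (hm.ode (x - x₀)).comp_sub_const x x₀
    rwa [← signedW_of_abs_le (hm.abs_le _)] at this
  rw [show deriv (fun x => (f x - m (x - x₀)) ^ 2) x = _ from ((hx.hasDerivAt.sub h1).pow 2).deriv]
  simp only [Pi.sub_apply, Nat.cast_ofNat, Nat.add_one_sub_one, pow_one]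
  ring

set_option maxHeartbeats 1000000 in
/-- Stability of the profile on the half line to the right of its zero. -/
theorem exists_half_line_bound {F m : ℝ → ℝ} (hF : IsStdPotential F) (hm : IsProfile F m) :
    ∃ C e₀ : ℝ, 0 < C ∧ 0 < e₀ ∧ ∀ (f : ℝ → ℝ) (R e x₀ : ℝ), IsTransition f R → e < e₀ →
      energy1 F f (-R) R ≤ Cstar F + e → f x₀ = 0 → ∀ᶠ X in atTop,
        ∫ x in x₀..X, (f x - m (x - x₀)) ^ 2 ≤ C * e := by
  obtain ⟨η, κ, hη, hη1, hκ, hanti⟩ := hF.exists_antitoneOn_signedW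
  obtain ⟨Λ, hΛ, hmono⟩ := hF.exists_monotoneOn_sub_signedW
  obtain ⟨e₁, he₁, htr⟩ := exists_transition_bounds hF hη hη1
  obtain ⟨T, hT0, hT⟩ : ∃ T : ℝ, 0 ≤ T ∧ 1 - η / 4 ≤ m T :=
    ((eventually_ge_atTop (0 : ℝ)).and
      (hm.limit_top.eventually (le_mem_nhds (by linarith : 1 - η / 4 < 1)))).exists
  set c := 2 * Λ + 1 with hc
  have hc0 : 0 < c := by positivity
  set A := 2 * Real.exp (c * T) with hA
  have hA0 : 0 < A := by positivity
  refine ⟨T * A + (A + 2 / κ) / κ, min e₁ ((η / 4) ^ 2 / A), by positivity, by positivity, ?_⟩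
  intro f R e x₀ h he hen hx₀
  obtain ⟨hbd, hdip⟩ := htr f R h (hen.trans_lt (by linarith [min_le_left e₁ ((η / 4) ^ 2 / A)]))
  have heA : A * e ≤ (η / 4) ^ 2 := by
    have := he.le.trans (min_le_right e₁ ((η / 4) ^ 2 / A))
    rwa [le_div_iff₀ hA0, mul_comm] at this
  obtain ⟨K, hK⟩ := h.lip
  obtain ⟨Km, hKm⟩ := hm.lipschitz hF
  set μ : ℝ → ℝ := fun x => m (x - x₀) with hμ
  set r : ℝ → ℝ := fun x => deriv f x - signedW F (f x) with hr
  set v : ℝ → ℝ := fun x => (f x - μ x) ^ 2 with hv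
  have hμlip : LipschitzWith Km μ := LipschitzWith.of_dist_le_mul fun x y => by
    have := hKm.dist_le_mul (x - x₀) (y - x₀)
    rwa [dist_sub_right] at this
  have hwlip : LipschitzWith (K + Km) fun x => f x - μ x := hK.sub hμlip
  have hvcont : Continuous v := hwlip.continuous.pow 2
  have hvac : ∀ s t, AbsolutelyContinuousOnInterval v s t := fun s t => by
    have h1 := hwlip.lipschitzOnWith (s := Set.uIcc s t) |>.absolutelyContinuousOnInterval
    have := h1.fun_mul h1
    simpa only [hv, sq] using this
  have hrint : ∀ s t, IntervalIntegrable (fun x => r x ^ 2) volume s t := fun s t => by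
    have h1 := ((hK.intervalIntegrable_deriv_sq s t).sub
      (((hK.intervalIntegrable_deriv s t).continuousOn_mul
      (hF.continuous_signedW.comp hK.continuous).continuousOn).const_mul 2)).add
      (((hF.continuous_signedW.comp hK.continuous).pow 2).intervalIntegrable s t)
    convert! h1 using 1
    funext x
    simp only [hr, Pi.pow_apply, Function.comp_apply]
    ring
  have hr2 : ∀ s t, s ≤ t → ∫ x in s..t, r x ^ 2 ≤ 2 * e := by
    intro s t hst
    set R' := max R (max |s| |t|) with hR'
    have k1 : -R' ≤ s := by
      have : |s| ≤ R' := (le_max_left _ _).trans (le_max_right _ _)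
      linarith [neg_abs_le s]
    have k2 : t ≤ R' := by
      have : |t| ≤ R' := (le_max_right _ _).trans (le_max_right _ _)
      linarith [le_abs_self t]
    have d := (h.mono (le_max_left R (max |s| |t|))).defect_eq hF
    rw [h.energy1_eq hF (le_max_left _ _)] at d
    have := intervalIntegral.integral_mono_interval (μ := volume) k1 hst k2
      (f := fun x => r x ^ 2) (ae_of_all _ fun x => sq_nonneg _) (hrint _ _)
    simp only [hr] at this ⊢
    linarith
  have hfmem : ∀ x, f x ∈ Set.Icc (-2 : ℝ) 2 := fun x =>
    ⟨by linarith [(hbd x).1], by linarith [(hbd x).2]⟩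
  have hμmem : ∀ x, μ x ∈ Set.Icc (-2 : ℝ) 2 := fun x => by
    have := hm.mem_Icc (x - x₀)
    exact ⟨by linarith [this.1], by linarith [this.2]⟩
  have hder := h.ae_deriv_sq hm x₀
  have hosl : ∀ x, (f x - μ x) * (signedW F (f x) - signedW F (μ x)) ≤ Λ * v x := by
    intro x
    simp only [hv]
    rcases le_total (f x) (μ x) with hle | hle
    · have := hmono (hfmem x) (hμmem x) hle
      simp only at this
      nlinarith
    · have := hmono (hμmem x) (hfmem x) hle
      simp only at this
      nlinarith
  have hv0 : v x₀ = 0 := by simp [hv, hμ, hx₀, hm.zero]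
  have gron : ∀ x, x₀ ≤ x → x ≤ x₀ + T → v x ≤ A * e := by
    intro x hx hxT
    set φ : ℝ → ℝ := fun t => Real.exp (-c * (t - x₀)) with hφ
    have hφd : ∀ t, HasDerivAt φ (-c * φ t) t := fun t => by
      have := ((((hasDerivAt_id t).sub_const x₀).const_mul (-c))).exp
      convert! this using 1
      simp only [hφ, id]; ring
    have hφC : ContDiff ℝ 1 φ := by
      simp only [hφ]; fun_prop
    obtain ⟨Kφ, hKφ⟩ := hφC.contDiffOn.exists_lipschitzOnWith one_ne_zero
      (convex_uIcc x₀ x) isCompact_uIcc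
    have hpi := AbsolutelyContinuousOnInterval.integral_deriv_mul_eq_sub
      hKφ.absolutelyContinuousOnInterval (hvac x₀ x)
    have hle : ∫ t in x₀..x, (deriv φ t * v t + φ t * deriv v t) ≤ ∫ t in x₀..x, r t ^ 2 := by
      apply intervalIntegral.integral_mono_ae_restrict hx
      · exact (hKφ.absolutelyContinuousOnInterval.intervalIntegrable_deriv.mul_continuousOn
          hvcont.continuousOn).add
          ((hvac x₀ x).intervalIntegrable_deriv.continuousOn_mul hφC.continuous.continuousOn)
      · exact hrint _ _
      · refine (ae_restrict_iff' measurableSet_Icc).2 ?_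
        filter_upwards [hder] with t ht hmem
        have hd : deriv v t = _ := ht
        have hφ1 : φ t ≤ 1 := Real.exp_le_one_iff.2 (by nlinarith [hmem.1])
        have hφ0 : 0 < φ t := Real.exp_pos _
        have hdv : deriv v t ≤ c * v t + r t ^ 2 := by
          rw [hd]
          have := hosl t
          simp only [hv, hr, hc, hμ] at this ⊢
          nlinarith [sq_nonneg ((f t - m (t - x₀)) - (deriv f t - signedW F (f t)))]
        rw [(hφd t).deriv]
        nlinarith [mul_le_mul_of_nonneg_left hdv hφ0.le, sq_nonneg (r t)]
    rw [hpi, hv0, mul_zero, sub_zero] at hle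
    have h2 := hle.trans (hr2 x₀ x hx)
    have hexp : φ x * Real.exp (c * T) ≥ 1 := by
      simp only [hφ]
      rw [← Real.exp_add, ge_iff_le, Real.one_le_exp_iff]
      nlinarith
    have hvx : 0 ≤ v x := sq_nonneg _
    calc v x ≤ (φ x * Real.exp (c * T)) * v x := by nlinarith
      _ = Real.exp (c * T) * (φ x * v x) := by ring
      _ ≤ Real.exp (c * T) * (2 * e) := by gcongr
      _ = A * e := by rw [hA]; ring
  set x₁ := x₀ + T with hx₁
  have hvx₁ : v x₁ ≤ A * e := gron x₁ (by linarith) le_rfl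
  have hmx₁ : 1 - η / 4 ≤ μ x₁ := by
    simp only [hμ, hx₁, add_sub_cancel_left]; exact hT
  have hfx₁ : 1 - η / 2 ≤ f x₁ := by
    have := abs_le_of_sq_le_sq (hvx₁.trans heA) (by positivity)
    linarith [(abs_le.1 this).1]
  have hcontr : ∀ x, x₁ ≤ x →
      (f x - μ x) * (signedW F (f x) - signedW F (μ x)) ≤ -κ * v x := by
    intro x hx
    have hf' : f x ∈ Set.Icc (1 - η) (1 + η) := ⟨hdip x₁ x hx hfx₁, (hbd x).2⟩
    have hμ' : μ x ∈ Set.Icc (1 - η) (1 + η) := by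
      refine ⟨?_, by linarith [(hm.mem_Icc (x - x₀)).2]⟩
      have : m T ≤ m (x - x₀) := hm.monotone (by linarith)
      simp only [hμ]
      linarith
    simp only [hv]
    rcases le_total (f x) (μ x) with hle | hle
    · have := hanti hf' hμ' hle
      simp only at this
      nlinarith
    · have := hanti hμ' hf' hle
      simp only at this
      nlinarith
  filter_upwards [eventually_ge_atTop x₁] with X hX
  have hint1 : ∫ x in x₀..x₁, v x ≤ T * (A * e) := by
    have := intervalIntegral.integral_mono_on (μ := volume) (by linarith : x₀ ≤ x₁)
      (hvcont.intervalIntegrable _ _) (intervalIntegrable_const (c := A * e))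
      fun x hx => gron x hx.1 hx.2
    rw [intervalIntegral.integral_const, hx₁, add_sub_cancel_left, smul_eq_mul] at this
    exact this
  have hint2 : κ * ∫ x in x₁..X, v x ≤ A * e + 2 / κ * e := by
    have hle : ∫ x in x₁..X, deriv v x ≤ ∫ x in x₁..X, (-κ * v x + 1 / κ * r x ^ 2) := by
      apply intervalIntegral.integral_mono_ae_restrict hX
        (hvac _ _).intervalIntegrable_deriv
        (((hvcont.intervalIntegrable _ _).const_mul _).add ((hrint _ _).const_mul _))
      refine (ae_restrict_iff' measurableSet_Icc).2 ?_
      filter_upwards [hder] with t ht hmem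
      have hd : deriv v t = _ := ht
      have h1 := hcontr t hmem.1
      rw [hd]
      have h2 : 2 * (f t - μ t) * r t ≤ κ * v t + 1 / κ * r t ^ 2 := by
        have : 0 ≤ (κ * (f t - μ t) - r t) ^ 2 / κ := by positivity
        have e2 : (κ * (f t - μ t) - r t) ^ 2 / κ
          = κ * v t - 2 * (f t - μ t) * r t + 1 / κ * r t ^ 2 := by
          simp only [hv]; field_simp; ring
        linarith
      simp only [hμ, hr] at h1 h2 ⊢
      linarith
    rw [(hvac x₁ X).integral_deriv_eq_sub, intervalIntegral.integral_add
      ((hvcont.intervalIntegrable _ _).const_mul _) ((hrint _ _).const_mul _),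
      intervalIntegral.integral_const_mul, intervalIntegral.integral_const_mul] at hle
    have hvX : 0 ≤ v X := sq_nonneg _
    have : 1 / κ * ∫ x in x₁..X, r x ^ 2 ≤ 1 / κ * (2 * e) := by gcongr; exact hr2 _ _ hX
    have e3 : 1 / κ * (2 * e) = 2 / κ * e := by ring
    linarith
  rw [← intervalIntegral.integral_add_adjacent_intervals (hvcont.intervalIntegrable x₀ x₁)
    (hvcont.intervalIntegrable x₁ X)]
  have : ∫ x in x₁..X, v x ≤ (A * e + 2 / κ * e) / κ := by
    rw [le_div_iff₀ hκ, mul_comm]; exact hint2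
  calc _ ≤ T * (A * e) + (A * e + 2 / κ * e) / κ := add_le_add hint1 this
    _ = _ := by ring

/-- Transitions with small energy excess are close in `L²` to a translate of the profile. -/
theorem exists_profile_bound {F m : ℝ → ℝ} (hF : IsStdPotential F) (hm : IsProfile F m) :
    ∃ C e₀ : ℝ, 0 < C ∧ 0 < e₀ ∧ ∀ (f : ℝ → ℝ) (R e : ℝ), IsTransition f R → e < e₀ →
      energy1 F f (-R) R ≤ Cstar F + e → ∃ ξ : ℝ,
        ∫⁻ x, ENNReal.ofReal ((f x - m (x - ξ)) ^ 2) ≤ ENNReal.ofReal (C * e) := by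
  obtain ⟨C₁, e₁, hC₁, he₁, h₁⟩ := exists_half_line_bound hF hm
  obtain ⟨C₂, e₂, hC₂, he₂, h₂⟩ := exists_half_line_bound hF (hm.reflect hF)
  refine ⟨C₁ + C₂, min e₁ e₂, by positivity, by positivity, ?_⟩
  intro f R e h he hen
  obtain ⟨K, hK⟩ := h.lip
  obtain ⟨Km, hKm⟩ := hm.lipschitz hF
  obtain ⟨x₀, -, hx₀⟩ := intermediate_value_Icc (by linarith [h.pos] : -R ≤ R)
    hK.continuous.continuousOn (show (0:ℝ) ∈ Set.Icc (f (-R)) (f R) by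
      rw [h.left _ le_rfl, h.right _ le_rfl]; norm_num)
  refine ⟨x₀, ?_⟩
  have a := h₁ f R e x₀ h (he.trans_le (min_le_left _ _)) hen hx₀
  have b := h₂ _ R e (-x₀) h.reflect (he.trans_le (min_le_right _ _))
    (by rwa [energy1_reflect hF]) (by simp [hx₀])
  set v : ℝ → ℝ := fun x => (f x - m (x - x₀)) ^ 2 with hv
  have hvcont : Continuous v :=
    (hK.continuous.sub (hKm.continuous.comp (continuous_sub_right x₀))).pow 2
  have hev : ∀ᶠ X in atTop, ∫⁻ x in Set.Ioc (-X) X, ENNReal.ofReal (v x)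
      ≤ ENNReal.ofReal ((C₁ + C₂) * e) := by
    filter_upwards [a, b, eventually_ge_atTop |x₀|] with X ha hb hX
    have hX' := abs_le.1 hX
    have e1 : ∫ x in (-X)..x₀, v x ≤ C₂ * e := by
      rw [← neg_neg x₀, ← intervalIntegral.integral_comp_neg]
      convert! hb using 2
      funext x
      simp only [hv]
      rw [show -(x - -x₀) = -x - x₀ by ring]
      ring
    have e2 : ∫ x in (-X)..X, v x ≤ (C₁ + C₂) * e := by
      rw [← intervalIntegral.integral_add_adjacent_intervals (hvcont.intervalIntegrable (-X) x₀)
        (hvcont.intervalIntegrable x₀ X)]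
      linarith
    rw [intervalIntegral.integral_of_le (by linarith)] at e2
    rw [← ofReal_integral_eq_lintegral_ofReal]
    · exact ENNReal.ofReal_le_ofReal e2
    · exact (hvcont.intervalIntegrable _ _).1
    · exact ae_of_all _ fun x => sq_nonneg _
  refine le_of_tendsto (AECover.lintegral_tendsto_of_countably_generated
    (aecover_Ioc tendsto_neg_atTop_atBot tendsto_id) ?_) hev
  exact (hvcont.measurable.ennreal_ofReal).aemeasurable

/-! ### Poincaré inequality on the unit cube -/

/-- The open unit cube in `Fin d → ℝ`. -/
def cube (d : ℕ) : Set (Fin d → ℝ) := {y | ∀ i, y i ∈ Set.Ioo (0 : ℝ) 1}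

theorem cube_eq_pi (d : ℕ) : cube d = Set.univ.pi fun _ => Set.Ioo (0 : ℝ) 1 := by
  ext y; simp [cube]

theorem measurableSet_cube (d : ℕ) : MeasurableSet (cube d) := by
  rw [cube_eq_pi]; exact MeasurableSet.univ_pi fun _ => measurableSet_Ioo

theorem volume_cube (d : ℕ) : volume (cube d) = 1 := by
  rw [cube_eq_pi, volume_pi_pi]; simp

instance (d : ℕ) : IsProbabilityMeasure (volume.restrict (cube d)) :=
  ⟨by rw [Measure.restrict_apply_univ, volume_cube]⟩

theorem measurable_finCons {d : ℕ} :
    Measurable fun q : ℝ × (Fin d → ℝ) => (Fin.cons q.1 q.2 : Fin (d + 1) → ℝ) := by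
  refine measurable_pi_iff.2 fun i => ?_
  refine Fin.cases ?_ (fun j => ?_) i
  · simpa using measurable_fst
  · simpa using! (measurable_pi_apply j).comp measurable_snd

theorem measurePreserving_finCons (d : ℕ) : MeasurePreserving
    (fun q : ℝ × (Fin d → ℝ) => (Fin.cons q.1 q.2 : Fin (d + 1) → ℝ)) := by
  have := (volume_preserving_piFinSuccAbove (fun _ : Fin (d + 1) => ℝ) 0).symm
  convert! this using 1
  funext q
  simp [MeasurableEquiv.piFinSuccAbove, Fin.insertNthEquiv]

/-- Tonelli's theorem for products of a set of reals with the cube. -/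
theorem lintegral_cons_cube {d : ℕ} {s : Set ℝ} (hs : MeasurableSet s)
    {f : (Fin (d + 1) → ℝ) → ℝ≥0∞} (hf : Measurable f) :
    ∫⁻ w in {w | w 0 ∈ s ∧ ∀ i : Fin d, w i.succ ∈ Set.Ioo (0 : ℝ) 1}, f w =
      ∫⁻ y in cube d, ∫⁻ x in s, f (Fin.cons x y) := by
  have hset : MeasurableSet {w : Fin (d + 1) → ℝ |
      w 0 ∈ s ∧ ∀ i : Fin d, w i.succ ∈ Set.Ioo (0 : ℝ) 1} := by
    have h1 : MeasurableSet (⋂ i : Fin d, {w : Fin (d + 1) → ℝ | w i.succ ∈ Set.Ioo (0 : ℝ) 1}) :=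
      MeasurableSet.iInter fun i => measurable_pi_apply _ measurableSet_Ioo
    convert! (measurable_pi_apply (0 : Fin (d + 1)) hs).inter h1 using 1
    ext w
    simp
  rw [← (measurePreserving_finCons d).setLIntegral_comp_preimage hset hf]
  have : (fun q : ℝ × (Fin d → ℝ) => (Fin.cons q.1 q.2 : Fin (d + 1) → ℝ)) ⁻¹'
      {w | w 0 ∈ s ∧ ∀ i : Fin d, w i.succ ∈ Set.Ioo (0 : ℝ) 1} = s ×ˢ cube d := by
    ext q; simp [cube]
  rw [this, Measure.volume_eq_prod, ← Measure.prod_restrict,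
    lintegral_prod_symm' (fun q : ℝ × (Fin d → ℝ) => f (Fin.cons q.1 q.2))
      (hf.comp measurable_finCons)]

theorem lintegral_cube_succ {d : ℕ} {f : (Fin (d + 1) → ℝ) → ℝ≥0∞} (hf : Measurable f) :
    ∫⁻ w in cube (d + 1), f w = ∫⁻ y in cube d, ∫⁻ x in Set.Ioo (0 : ℝ) 1, f (Fin.cons x y) := by
  rw [← lintegral_cons_cube measurableSet_Ioo hf]
  congr 2
  ext w; simp [cube, Fin.forall_fin_succ]

theorem sq_sub_le_lintegral_deriv {K : NNReal} {φ : ℝ → ℝ} (hφ : LipschitzWith K φ) {s t : ℝ}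
    (hs : s ∈ Set.Ioo (0 : ℝ) 1) (ht : t ∈ Set.Ioo (0 : ℝ) 1) :
    ENNReal.ofReal ((φ s - φ t) ^ 2) ≤
      ∫⁻ x in Set.Ioo (0 : ℝ) 1, ENNReal.ofReal (deriv φ x ^ 2) := by
  wlog hst : t ≤ s generalizing s t
  · rw [show (φ s - φ t) ^ 2 = (φ t - φ s) ^ 2 by ring]
    exact this ht hs (not_le.1 hst).le
  have h1 : φ s - φ t = ∫ x in t..s, deriv φ x :=
    (hφ.lipschitzOnWith.absolutelyContinuousOnInterval.integral_deriv_eq_sub).symm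
  have hi := hφ.intervalIntegrable_deriv t s
  have hi2 := hφ.intervalIntegrable_deriv_sq t s
  set c := φ s - φ t with hc
  have h2 : c ^ 2 ≤ ∫ x in t..s, deriv φ x ^ 2 := by
    have : ∫ x in t..s, (2 * c * deriv φ x - c ^ 2) ≤ ∫ x in t..s, deriv φ x ^ 2 :=
      intervalIntegral.integral_mono_on hst
        ((hi.const_mul _).sub intervalIntegrable_const) hi2
        fun x _ => by nlinarith [sq_nonneg (c - deriv φ x)]
    rw [intervalIntegral.integral_sub (hi.const_mul _) intervalIntegrable_const,
      intervalIntegral.integral_const_mul, ← h1, intervalIntegral.integral_const,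
      smul_eq_mul] at this
    have : s - t ≤ 1 := by linarith [hs.2, ht.1]
    nlinarith [sq_nonneg c]
  rw [intervalIntegral.integral_of_le hst] at h2
  calc _ ≤ ENNReal.ofReal (∫ x in Set.Ioc t s, deriv φ x ^ 2) := ENNReal.ofReal_le_ofReal h2
    _ = ∫⁻ x in Set.Ioc t s, ENNReal.ofReal (deriv φ x ^ 2) :=
      ofReal_integral_eq_lintegral_ofReal hi2.1 (ae_of_all _ fun x => sq_nonneg _)
    _ ≤ _ := lintegral_mono_set fun x hx =>
      Set.mem_Ioo.2 ⟨ht.1.trans hx.1, hx.2.trans_lt hs.2⟩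

theorem lineDeriv_finCons_zero {d : ℕ} (u : (Fin (d + 1) → ℝ) → ℝ) (s : ℝ) (y : Fin d → ℝ) :
    lineDeriv ℝ u (Fin.cons s y) (Pi.single 0 1) = deriv (fun x => u (Fin.cons x y)) s := by
  have : ∀ t : ℝ, (Fin.cons s y + t • Pi.single 0 1 : Fin (d + 1) → ℝ) = Fin.cons (s + t) y := by
    intro t
    funext i
    refine Fin.cases ?_ (fun j => ?_) i <;> simp
  simp only [lineDeriv, this]
  have := deriv_comp_const_add (fun x => u (Fin.cons x y)) s 0
  simpa using this

theorem lineDeriv_finCons_succ {d : ℕ} (u : (Fin (d + 1) → ℝ) → ℝ) (s : ℝ) (y : Fin d → ℝ)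
    (i : Fin d) : lineDeriv ℝ u (Fin.cons s y) (Pi.single i.succ 1) =
      lineDeriv ℝ (fun y => u (Fin.cons s y)) y (Pi.single i 1) := by
  have : ∀ t : ℝ, (Fin.cons s y + t • Pi.single i.succ 1 : Fin (d + 1) → ℝ) =
      Fin.cons s (y + t • Pi.single i 1) := by
    intro t
    funext k
    refine Fin.cases ?_ (fun j => ?_) k
    · simp
    · simp [Pi.single_apply]
  simp only [lineDeriv, this]

theorem LipschitzWith.comp_finCons_left {d : ℕ} {K : NNReal} {u : (Fin (d + 1) → ℝ) → ℝ}
    (hu : LipschitzWith K u) (y : Fin d → ℝ) : LipschitzWith K fun x => u (Fin.cons x y) := by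
  have : LipschitzWith 1 fun x : ℝ => (Fin.cons x y : Fin (d + 1) → ℝ) := by
    refine LipschitzWith.of_dist_le_mul fun a b => ?_
    rw [NNReal.coe_one, one_mul, dist_pi_le_iff dist_nonneg]
    refine fun i => Fin.cases ?_ (fun j => ?_) i <;> simp
  simpa using! hu.comp this

theorem LipschitzWith.comp_finCons_right {d : ℕ} {K : NNReal} {u : (Fin (d + 1) → ℝ) → ℝ}
    (hu : LipschitzWith K u) (x : ℝ) :
    LipschitzWith K fun y : Fin d → ℝ => u (Fin.cons x y) := by
  have : LipschitzWith 1 fun y : Fin d → ℝ => (Fin.cons x y : Fin (d + 1) → ℝ) := by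
    refine LipschitzWith.of_dist_le_mul fun a b => ?_
    rw [NNReal.coe_one, one_mul, dist_pi_le_iff dist_nonneg]
    refine fun i => Fin.cases ?_ (fun j => ?_) i
    · simp
    · simpa using dist_le_pi_dist a b j
  simpa using! hu.comp this

theorem ofReal_sq_sub_le (x y z : ℝ) : ENNReal.ofReal ((x - z) ^ 2) ≤
    2 * ENNReal.ofReal ((x - y) ^ 2) + 2 * ENNReal.ofReal ((y - z) ^ 2) := by
  rw [← ENNReal.ofReal_ofNat,
      ← ENNReal.ofReal_mul (by norm_num), ← ENNReal.ofReal_mul (by norm_num),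
    ← ENNReal.ofReal_add (by positivity) (by positivity)]
  exact ENNReal.ofReal_le_ofReal (by nlinarith [sq_nonneg ((x - y) - (y - z))])

set_option maxHeartbeats 1000000 in
/-- Poincaré inequality on the unit cube for Lipschitz functions. -/
theorem exists_poincare_cube (d : ℕ) : ∃ c : NNReal, ∀ (K : NNReal) (u : (Fin d → ℝ) → ℝ),
    LipschitzWith K u →
    ∫⁻ y in cube d, ∫⁻ y' in cube d, ENNReal.ofReal ((u y - u y') ^ 2) ≤
      c * ∫⁻ y in cube d, ∑ i, ENNReal.ofReal (lineDeriv ℝ u y (Pi.single i 1) ^ 2) := by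
  induction d with
  | zero =>
    refine ⟨0, fun K u _ => ?_⟩
    have : ∀ y y', u y = u y' := fun y y' => congrArg u (Subsingleton.elim _ _)
    simp [this _ 0]
  | succ d ih =>
    obtain ⟨c, hc⟩ := ih
    refine ⟨2 * c + 2, fun K u hu => ?_⟩
    have hum : Measurable u := hu.continuous.measurable
    have hlm : ∀ i, Measurable fun w => ENNReal.ofReal (lineDeriv ℝ u w (Pi.single i 1) ^ 2) :=
      fun i => ((measurable_lineDeriv hu.continuous).pow_const 2).ennreal_ofReal
    have hcm := measurable_finCons (d := d)
    set I := Set.Ioo (0 : ℝ) 1 with hI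
    have hI1 : volume I = 1 := by simp [hI]
    have hu2 : Measurable fun q : ℝ × (Fin d → ℝ) => u (Fin.cons q.1 q.2) := hum.comp hcm
    set p : ℝ → (Fin d → ℝ) → ℝ≥0∞ := fun s y =>
      ENNReal.ofReal (lineDeriv ℝ u (Fin.cons s y) (Pi.single 0 1) ^ 2) with hp
    set S : ℝ → (Fin d → ℝ) → ℝ≥0∞ := fun s y => ∑ i : Fin d,
      ENNReal.ofReal (lineDeriv ℝ u (Fin.cons s y) (Pi.single i.succ 1) ^ 2) with hS
    have hpm : Measurable fun q : ℝ × (Fin d → ℝ) => p q.1 q.2 := (hlm 0).comp hcm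
    have hpm1 : ∀ y, Measurable fun x => p x y := fun y =>
      (hlm 0).comp (hcm.comp (measurable_id.prodMk measurable_const))
    have hSm : Measurable fun q : ℝ × (Fin d → ℝ) => S q.1 q.2 :=
      Finset.measurable_sum _ fun i _ => (hlm i.succ).comp hcm
    set b : ℝ → (Fin d → ℝ) → (Fin d → ℝ) → ℝ≥0∞ := fun s y y' =>
      ENNReal.ofReal ((u (Fin.cons s y) - u (Fin.cons s y')) ^ 2) with hb
    have hbm : Measurable fun q : ((Fin d → ℝ) × ℝ) × (Fin d → ℝ) => b q.1.2 q.1.1 q.2 := by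
      have k1 : Measurable fun q : ((Fin d → ℝ) × ℝ) × (Fin d → ℝ) =>
        u (Fin.cons q.1.2 q.1.1) := hu2.comp (measurable_fst.snd.prodMk measurable_fst.fst)
      have k2 : Measurable fun q : ((Fin d → ℝ) × ℝ) × (Fin d → ℝ) =>
        u (Fin.cons q.1.2 q.2) := hu2.comp (measurable_fst.snd.prodMk measurable_snd)
      exact ((k1.sub k2).pow_const 2).ennreal_ofReal
    have hpair : Measurable fun q : (Fin (d + 1) → ℝ) × (Fin (d + 1) → ℝ) =>
        ENNReal.ofReal ((u q.1 - u q.2) ^ 2) :=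
      (((hum.comp measurable_fst).sub (hum.comp measurable_snd)).pow_const 2).ennreal_ofReal
    have hleft : ∀ s ∈ I, ∀ y, ∫⁻ w' in cube (d + 1),
        ENNReal.ofReal ((u (Fin.cons s y) - u w') ^ 2) ≤
        2 * (∫⁻ x in I, p x y) + 2 * ∫⁻ y' in cube d, ∫⁻ s' in I, b s' y y' := by
      intro s hs y
      rw [lintegral_cube_succ (f := fun w' => ENNReal.ofReal ((u (Fin.cons s y) - u w') ^ 2))
        (hpair.comp measurable_prodMk_left)]
      have : ∀ y', ∫⁻ s' in I, ENNReal.ofReal ((u (Fin.cons s y) - u (Fin.cons s' y')) ^ 2) ≤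
          2 * (∫⁻ x in I, p x y) + 2 * ∫⁻ s' in I, b s' y y' := by
        intro y'
        calc _ ≤ ∫⁻ s' in I, (2 * (∫⁻ x in I, p x y) + 2 * b s' y y') := by
              refine setLIntegral_mono' measurableSet_Ioo fun s' hs' => ?_
              refine (ofReal_sq_sub_le _ (u (Fin.cons s' y)) _).trans ?_
              gcongr
              have := sq_sub_le_lintegral_deriv (hu.comp_finCons_left y) hs hs'
              simpa only [hp, lineDeriv_finCons_zero] using this
          _ = _ := by
              rw [lintegral_add_left measurable_const, lintegral_const,
                Measure.restrict_apply_univ, hI1, mul_one, lintegral_const_mul' _ _ (by simp)]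
      refine (lintegral_mono this).trans_eq ?_
      rw [lintegral_add_left measurable_const, lintegral_const,
        Measure.restrict_apply_univ, volume_cube, mul_one, lintegral_const_mul' _ _ (by simp)]
    have hswap : ∫⁻ y in cube d, ∫⁻ y' in cube d, ∫⁻ s' in I, b s' y y' ≤
        c * ∫⁻ y in cube d, ∫⁻ x in I, S x y := by
      calc _ = ∫⁻ y in cube d, ∫⁻ s' in I, ∫⁻ y' in cube d, b s' y y' := by
            refine lintegral_congr fun y => ?_
            refine lintegral_lintegral_swap (Measurable.aemeasurable ?_)
            exact hbm.comp ((measurable_const.prodMk measurable_snd).prodMk measurable_fst)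
        _ = ∫⁻ s' in I, ∫⁻ y in cube d, ∫⁻ y' in cube d, b s' y y' :=
            lintegral_lintegral_swap hbm.lintegral_prod_right'.aemeasurable
        _ ≤ ∫⁻ s' in I, c * ∫⁻ y in cube d, S s' y := by
            refine lintegral_mono fun s' => ?_
            have := hc K _ (hu.comp_finCons_right s')
            simpa only [hS, lineDeriv_finCons_succ] using this
        _ = c * ∫⁻ s' in I, ∫⁻ y in cube d, S s' y := lintegral_const_mul' _ _ (by simp)
        _ = _ := by rw [lintegral_lintegral_swap hSm.aemeasurable]
    rw [lintegral_cube_succ hpair.lintegral_prod_right',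
      lintegral_cube_succ (Finset.measurable_sum _ fun i _ => hlm i)]
    calc _ ≤ ∫⁻ y in cube d, ∫⁻ _ in I,
          (2 * (∫⁻ x in I, p x y) + 2 * ∫⁻ y' in cube d, ∫⁻ s' in I, b s' y y') :=
          lintegral_mono fun y => setLIntegral_mono' measurableSet_Ioo fun s hs => hleft s hs y
      _ = ∫⁻ y in cube d,
          (2 * (∫⁻ x in I, p x y) + 2 * ∫⁻ y' in cube d, ∫⁻ s' in I, b s' y y') := by
          simp only [lintegral_const, Measure.restrict_apply_univ, hI1, mul_one]
      _ = 2 * (∫⁻ y in cube d, ∫⁻ x in I, p x y) +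
          2 * ∫⁻ y in cube d, ∫⁻ y' in cube d, ∫⁻ s' in I, b s' y y' := by
          rw [lintegral_add_left (hpm.lintegral_prod_left'.const_mul 2),
            lintegral_const_mul' _ _ (by simp), lintegral_const_mul' _ _ (by simp)]
      _ ≤ 2 * (∫⁻ y in cube d, ∫⁻ x in I, p x y) + 2 * (c * ∫⁻ y in cube d, ∫⁻ x in I, S x y) := by
          gcongr
      _ ≤ (2 * c + 2) * ((∫⁻ y in cube d, ∫⁻ x in I, p x y) +
          ∫⁻ y in cube d, ∫⁻ x in I, S x y) := by
          rw [mul_add, add_mul, add_mul, ← mul_assoc]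
          gcongr
          · exact le_add_self
          · exact le_self_add
      _ = _ := by
          rw [← lintegral_add_left hpm.lintegral_prod_left']
          push_cast
          congr 1
          refine lintegral_congr fun y => ?_
          rw [← lintegral_add_left (hpm1 y)]
          refine lintegral_congr fun x => ?_
          rw [Fin.sum_univ_succ]

/-! ### Stability of the profile in the strip -/

theorem measurableSet_strip {d : ℕ} {s : Set ℝ} (hs : MeasurableSet s) :
    MeasurableSet {z : Eucl d | z 0 ∈ s ∧ ∀ i : Fin d, z i.succ ∈ Set.Ioo (0 : ℝ) 1} := by
  have h1 : MeasurableSet (⋂ i : Fin d, {w : Eucl d | w i.succ ∈ Set.Ioo (0 : ℝ) 1}) :=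
    MeasurableSet.iInter fun i => (by fun_prop : Measurable fun w : Eucl d => w i.succ)
      measurableSet_Ioo
  convert! ((by fun_prop : Measurable fun w : Eucl d => w 0) hs).inter h1 using 1
  ext w
  simp

theorem lintegral_strip {d : ℕ} {s : Set ℝ} (hs : MeasurableSet s) {f : Eucl d → ℝ≥0∞}
    (hf : Measurable f) :
    ∫⁻ z in {z : Eucl d | z 0 ∈ s ∧ ∀ i : Fin d, z i.succ ∈ Set.Ioo (0 : ℝ) 1}, f z =
      ∫⁻ y in cube d, ∫⁻ x in s, f (WithLp.toLp 2 (Fin.cons x y)) := by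
  rw [← (PiLp.volume_preserving_toLp (Fin (d + 1))).setLIntegral_comp_preimage
    (measurableSet_strip hs) hf]
  exact lintegral_cons_cube hs (hf.comp (WithLp.measurable_toLp 2 _))

theorem domDL_eq (d : ℕ) (L : ℝ) : domDL d L =
    {z : Eucl d | z 0 ∈ Set.Ioo (-L) L ∧ ∀ i : Fin d, z i.succ ∈ Set.Ioo (0 : ℝ) 1} := by
  ext z; simp only [domDL, Set.mem_ofPred_eq, Set.mem_Ioo, abs_lt]

theorem domD_eq (d : ℕ) : domD d =
    {z : Eucl d | z 0 ∈ Set.univ ∧ ∀ i : Fin d, z i.succ ∈ Set.Ioo (0 : ℝ) 1} := by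
  ext z; simp [domD]

theorem measurableSet_domDL (d : ℕ) (L : ℝ) : MeasurableSet (domDL d L) := by
  rw [domDL_eq]; exact measurableSet_strip measurableSet_Ioo

theorem volume_domDL (d : ℕ) (L : ℝ) : volume (domDL d L) = ENNReal.ofReal (2 * L) := by
  have := lintegral_strip (d := d) (s := Set.Ioo (-L) L) measurableSet_Ioo
    (measurable_const (a := (1 : ℝ≥0∞)))
  rw [← domDL_eq] at this
  simp only [lintegral_const, Measure.restrict_apply_univ, one_mul, volume_cube, mul_one,
    Real.volume_Ioo] at this
  rw [this]; congr 1; ring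

instance (d : ℕ) (L : ℝ) : IsFiniteMeasure (volume.restrict (domDL d L)) :=
  ⟨by rw [Measure.restrict_apply_univ, volume_domDL]; exact ENNReal.ofReal_lt_top⟩

theorem abs_coord_le {d : ℕ} {L : ℝ} {z : Eucl d} (hz : z ∈ domDL d L) (i : Fin (d + 1)) :
    |z i| ≤ max L 1 := by
  refine Fin.cases ?_ (fun j => ?_) i
  · exact hz.1.le.trans (le_max_left _ _)
  · have := hz.2 j
    rw [abs_of_pos this.1]
    exact this.2.le.trans (le_max_right _ _)

theorem isBounded_domDL (d : ℕ) (L : ℝ) : Bornology.IsBounded (domDL d L) := by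
  have h1 : Bornology.IsBounded (Metric.closedBall (0 : Fin (d + 1) → ℝ) (max L 1)) :=
    Metric.isBounded_closedBall
  have := (PiLp.lipschitzWith_toLp 2 fun _ : Fin (d + 1) => ℝ).isBounded_image h1
  refine this.subset fun z hz => ⟨WithLp.ofLp z, ?_, rfl⟩
  rw [mem_closedBall_zero_iff]
  exact (pi_norm_le_iff_of_nonneg (by positivity)).2 fun i => abs_coord_le hz i

theorem integrableOn_domDL_of_bound {d : ℕ} {L : ℝ} {f : Eucl d → ℝ} (hf : Measurable f) {B : ℝ}
    (hB : ∀ z ∈ domDL d L, |f z| ≤ B) : IntegrableOn f (domDL d L) :=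
  Measure.integrableOn_of_bounded (M := B) (by rw [volume_domDL]; exact ENNReal.ofReal_ne_top)
    hf.aestronglyMeasurable ((ae_restrict_iff' (measurableSet_domDL d L)).2 (ae_of_all _ hB))

theorem measurable_energy_density {d : ℕ} {F : ℝ → ℝ} {h : Eucl d → ℝ} (hF : Continuous F)
    (hh : Continuous h) : Measurable fun z => 1/2 * ‖fderiv ℝ h z‖ ^ 2 + F (h z) :=
  (((measurable_fderiv ℝ h).norm.pow_const 2).const_mul _).add (hF.comp hh).measurable

theorem LipschitzWith.integrableOn_energy {d : ℕ} {L : ℝ} {F : ℝ → ℝ} {h : Eucl d → ℝ} {K : NNReal}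
    (hF : Continuous F) (hh : LipschitzWith K h) :
    IntegrableOn (fun z => 1/2 * ‖fderiv ℝ h z‖ ^ 2 + F (h z)) (domDL d L) := by
  have hcpt : IsCompact (closure (domDL d L)) := (isBounded_domDL d L).isCompact_closure
  obtain ⟨B, hB⟩ := hcpt.exists_bound_of_continuousOn (hF.comp hh.continuous).continuousOn
  refine integrableOn_domDL_of_bound (measurable_energy_density hF hh.continuous)
    (B := 1/2 * K ^ 2 + B) fun z hz => ?_
  have h1 := hB z (subset_closure hz)
  have h2 : ‖fderiv ℝ h z‖ ≤ K := norm_fderiv_le_of_lipschitz ℝ hh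
  refine (abs_add_le _ _).trans (add_le_add ?_ h1)
  rw [abs_of_nonneg (by positivity)]
  gcongr

theorem ofReal_fullEnergy {d : ℕ} {L : ℝ} {F : ℝ → ℝ} {h : Eucl d → ℝ} {K : NNReal}
    (hF : IsStdPotential F) (hh : LipschitzWith K h) :
    ENNReal.ofReal (fullEnergy d L F h) =
      ∫⁻ z in domDL d L, ENNReal.ofReal (1/2 * ‖fderiv ℝ h z‖ ^ 2 + F (h z)) :=
  ofReal_integral_eq_lintegral_ofReal (hh.integrableOn_energy hF.continuous)
    (ae_of_all _ fun z => add_nonneg (by positivity) (hF.nonneg _))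

theorem sum_lineDeriv_sq_le {d : ℕ} {h : Eucl d → ℝ} {w : Fin (d + 1) → ℝ}
    (hd : DifferentiableAt ℝ h (WithLp.toLp 2 w)) :
    ∑ i, lineDeriv ℝ (fun w => h (WithLp.toLp 2 w)) w (Pi.single i 1) ^ 2 ≤
      ‖fderiv ℝ h (WithLp.toLp 2 w)‖ ^ 2 := by
  set ℓ := fderiv ℝ h (WithLp.toLp 2 w) with hℓ
  have h1 : ∀ i, lineDeriv ℝ (fun w => h (WithLp.toLp 2 w)) w (Pi.single i 1) =
      ℓ (EuclideanSpace.single i 1) := by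
    intro i
    rw [hℓ, ← hd.lineDeriv_eq_fderiv]
    rfl
  simp only [h1]
  set v : Eucl d := ∑ i, ℓ (EuclideanSpace.single i 1) • EuclideanSpace.single i (1 : ℝ) with hv
  have h2 : ℓ v = ∑ i, ℓ (EuclideanSpace.single i 1) ^ 2 := by
    rw [hv, map_sum]
    exact Finset.sum_congr rfl fun i _ => by rw [map_smul, smul_eq_mul, sq]
  have h3 : ‖v‖ ^ 2 = ∑ i, ℓ (EuclideanSpace.single i 1) ^ 2 := by
    rw [EuclideanSpace.norm_sq_eq]
    refine Finset.sum_congr rfl fun i _ => ?_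
    rw [Real.norm_eq_abs, sq_abs, hv]
    simp [Finset.sum_apply, Pi.single_apply]
  set S := ∑ i, ℓ (EuclideanSpace.single i 1) ^ 2 with hS
  have h4 : S ≤ ‖ℓ‖ * ‖v‖ := h2 ▸ (le_abs_self _).trans (ℓ.le_opNorm v)
  have hS0 : 0 ≤ S := Finset.sum_nonneg fun i _ => sq_nonneg _
  by_contra hlt
  push Not at hlt
  nlinarith [norm_nonneg v, norm_nonneg ℓ, mul_nonneg (norm_nonneg ℓ) (norm_nonneg v)]

/-- The longitudinal energy of `k` on the fiber over `y`. -/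
def fiberEnergy {d : ℕ} (F : ℝ → ℝ) (k : (Fin (d + 1) → ℝ) → ℝ) (L : ℝ) (y : Fin d → ℝ) : ℝ≥0∞ :=
  ∫⁻ x in Set.Ioo (-L) L, ENNReal.ofReal
    (1/2 * lineDeriv ℝ k (Fin.cons x y) (Pi.single 0 1) ^ 2 + F (k (Fin.cons x y)))

/-- The transversal Dirichlet energy density of `k`. -/
def transDensity {d : ℕ} (k : (Fin (d + 1) → ℝ) → ℝ) (w : Fin (d + 1) → ℝ) : ℝ≥0∞ :=
  ∑ i : Fin d, ENNReal.ofReal (lineDeriv ℝ k w (Pi.single i.succ 1) ^ 2)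

/-- The squared `L²` distance of `k` on two fibers. -/
def fiberDist {d : ℕ} (k : (Fin (d + 1) → ℝ) → ℝ) (y y' : Fin d → ℝ) : ℝ≥0∞ :=
  ∫⁻ x, ENNReal.ofReal ((k (Fin.cons x y') - k (Fin.cons x y)) ^ 2)

section Fibers

variable {d : ℕ} {K : NNReal} {k : (Fin (d + 1) → ℝ) → ℝ} {F : ℝ → ℝ}

theorem measurable_longDensity (hF : Continuous F) (hk : LipschitzWith K k) : Measurable fun w =>
    ENNReal.ofReal (1/2 * lineDeriv ℝ k w (Pi.single 0 1) ^ 2 + F (k w)) :=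
  ((((measurable_lineDeriv hk.continuous).pow_const 2).const_mul _).add
    (hF.comp hk.continuous).measurable).ennreal_ofReal

theorem measurable_transDensity (hk : LipschitzWith K k) : Measurable (transDensity k) :=
  Finset.measurable_sum _ fun _ _ =>
    ((measurable_lineDeriv hk.continuous).pow_const 2).ennreal_ofReal

theorem measurable_fiberEnergy (hF : Continuous F) (hk : LipschitzWith K k) (L : ℝ) :
    Measurable (fiberEnergy F k L) :=
  ((measurable_longDensity hF hk).comp measurable_finCons).lintegral_prod_left'

theorem measurable_pair_sq (hk : LipschitzWith K k) :
    Measurable fun q : ((Fin d → ℝ) × (Fin d → ℝ)) × ℝ =>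
      ENNReal.ofReal ((k (Fin.cons q.2 q.1.2) - k (Fin.cons q.2 q.1.1)) ^ 2) := by
  have hk2 : Measurable fun q : ℝ × (Fin d → ℝ) => k (Fin.cons q.1 q.2) :=
    hk.continuous.measurable.comp measurable_finCons
  have k1 : Measurable fun q : ((Fin d → ℝ) × (Fin d → ℝ)) × ℝ => k (Fin.cons q.2 q.1.2) :=
    hk2.comp (measurable_snd.prodMk measurable_fst.snd)
  have k2 : Measurable fun q : ((Fin d → ℝ) × (Fin d → ℝ)) × ℝ => k (Fin.cons q.2 q.1.1) :=
    hk2.comp (measurable_snd.prodMk measurable_fst.fst)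
  exact ((k1.sub k2).pow_const 2).ennreal_ofReal

theorem measurable_fiberDist (hk : LipschitzWith K k) :
    Measurable fun q : (Fin d → ℝ) × (Fin d → ℝ) => fiberDist k q.1 q.2 :=
  (measurable_pair_sq hk).lintegral_prod_right'

theorem fiberEnergy_eq (hF : IsStdPotential F) (hk : LipschitzWith K k) {L : ℝ} (hL : 0 ≤ L)
    (y : Fin d → ℝ) :
    fiberEnergy F k L y = ENNReal.ofReal (energy1 F (fun x => k (Fin.cons x y)) (-L) L) := by
  have hi := (hk.comp_finCons_left y).intervalIntegrable_energy hF.continuous (-L) L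
  rw [energy1, intervalIntegral.integral_of_le (by linarith),
    ofReal_integral_eq_lintegral_ofReal hi.1
    (ae_of_all _ fun x => add_nonneg (by positivity) (hF.nonneg _)),
    ← setLIntegral_congr Ioo_ae_eq_Ioc]
  simp only [fiberEnergy, lineDeriv_finCons_zero]

theorem fiberEnergy_add_le {L : ℝ} {h : Eucl d → ℝ} (hF : IsStdPotential F)
    (hh : LipschitzWith K h) {K' : NNReal}
    (hk : LipschitzWith K' fun w : Fin (d + 1) → ℝ => h (WithLp.toLp 2 w)) :
    (∫⁻ y in cube d, fiberEnergy F (fun w => h (WithLp.toLp 2 w)) L y) +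
      2⁻¹ * ∫⁻ y in cube d, ∫⁻ x in Set.Ioo (-L) L,
        transDensity (fun w => h (WithLp.toLp 2 w)) (Fin.cons x y) ≤
      ENNReal.ofReal (fullEnergy d L F h) := by
  have hGm : Measurable fun w : Fin (d + 1) → ℝ => ENNReal.ofReal
      (1/2 * ‖fderiv ℝ h (WithLp.toLp 2 w)‖ ^ 2 + F (h (WithLp.toLp 2 w))) :=
    ((measurable_energy_density hF.continuous hh.continuous).comp
      (WithLp.measurable_toLp 2 _)).ennreal_ofReal
  have hjm := measurable_longDensity hF.continuous hk
  rw [ofReal_fullEnergy hF hh, domDL_eq, lintegral_strip measurableSet_Ioo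
    (measurable_energy_density hF.continuous hh.continuous).ennreal_ofReal,
    ← lintegral_cons_cube measurableSet_Ioo hGm,
    ← lintegral_cons_cube measurableSet_Ioo (measurable_transDensity hk)]
  simp only [fiberEnergy]
  rw [← lintegral_cons_cube measurableSet_Ioo hjm,
    ← lintegral_const_mul' _ _ (by simp), ← lintegral_add_left hjm]
  refine lintegral_mono_ae (ae_restrict_of_ae ?_)
  filter_upwards [hk.ae_differentiableAt] with w hw
  have hd : DifferentiableAt ℝ h (WithLp.toLp 2 w) := by
    have h1 : DifferentiableAt ℝ (fun w => h (WithLp.toLp 2 w))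
      (WithLp.ofLp (WithLp.toLp 2 w)) := hw
    exact h1.comp (WithLp.toLp 2 w)
      (PiLp.continuousLinearEquiv 2 ℝ fun _ : Fin (d + 1) => ℝ).differentiableAt
  have h2 := sum_lineDeriv_sq_le hd
  rw [Fin.sum_univ_succ] at h2
  have h3 : (2⁻¹ : ℝ≥0∞) = ENNReal.ofReal (1/2) := by
    rw [ENNReal.ofReal_div_of_pos two_pos]; simp
  have hnn : ∀ i : Fin (d + 1), 0 ≤ lineDeriv ℝ (fun w => h (WithLp.toLp 2 w)) w
    (Pi.single i 1) ^ 2 := fun i => sq_nonneg _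
  simp only [transDensity]
  rw [← ENNReal.ofReal_sum_of_nonneg fun i _ => hnn (Fin.succ i), h3,
    ← ENNReal.ofReal_mul (by norm_num), ← ENNReal.ofReal_add
    (add_nonneg (by positivity) (hF.nonneg _))
    (mul_nonneg (by norm_num) (Finset.sum_nonneg fun i _ => hnn i.succ))]
  exact ENNReal.ofReal_le_ofReal (by linarith)

set_option maxHeartbeats 1000000 in
theorem lintegral_fiberDist_le {L : ℝ} {c : NNReal} (hk : LipschitzWith K k)
    (htr : ∀ y ∈ cube d, IsTransition (fun x => k (Fin.cons x y)) L)
    (hc : ∀ (K : NNReal) (u : (Fin d → ℝ) → ℝ), LipschitzWith K u →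
      ∫⁻ y in cube d, ∫⁻ y' in cube d, ENNReal.ofReal ((u y - u y') ^ 2) ≤
        c * ∫⁻ y in cube d, ∑ i, ENNReal.ofReal (lineDeriv ℝ u y (Pi.single i 1) ^ 2)) :
    ∫⁻ y in cube d, ∫⁻ y' in cube d, fiberDist k y y' ≤
      c * ∫⁻ y in cube d, ∫⁻ x in Set.Ioo (-L) L, transDensity k (Fin.cons x y) := by
  set I := Set.Ioo (-L) L with hI
  set g : (Fin d → ℝ) → (Fin d → ℝ) → ℝ → ℝ≥0∞ := fun y y' x =>
    ENNReal.ofReal ((k (Fin.cons x y') - k (Fin.cons x y)) ^ 2) with hg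
  have hgm : Measurable fun q : ((Fin d → ℝ) × (Fin d → ℝ)) × ℝ => g q.1.1 q.1.2 q.2 :=
    measurable_pair_sq hk
  have hgm1 : ∀ y, Measurable fun q : (Fin d → ℝ) × ℝ => g y q.1 q.2 := fun y =>
    hgm.comp ((measurable_const.prodMk measurable_fst).prodMk measurable_snd)
  have hgm2 : Measurable fun q : ((Fin d → ℝ) × ℝ) × (Fin d → ℝ) => g q.1.1 q.2 q.1.2 :=
    hgm.comp ((measurable_fst.fst.prodMk measurable_snd).prodMk measurable_fst.snd)
  have hgm3 : Measurable fun q : (Fin d → ℝ) × ℝ => ∫⁻ y' in cube d, g q.1 y' q.2 :=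
    hgm2.lintegral_prod_right'
  have hTm : Measurable fun q : ℝ × (Fin d → ℝ) => transDensity k (Fin.cons q.1 q.2) :=
    (measurable_transDensity hk).comp measurable_finCons
  have hgi : ∀ y ∈ cube d, ∀ y' ∈ cube d, fiberDist k y y' = ∫⁻ x in I, g y y' x := by
    intro y hy y' hy'
    refine (setLIntegral_eq_of_support_subset fun x hx => ?_).symm
    by_contra hxI
    refine hx ?_
    rcases le_or_gt L x with h1 | h1
    · simp [(htr y hy).right x h1, (htr y' hy').right x h1]
    · have h2 : x ≤ -L := by
        by_contra h3
        exact hxI ⟨not_le.1 h3, h1⟩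
      simp [(htr y hy).left x h2, (htr y' hy').left x h2]
  have hpt : ∀ x, ∫⁻ y in cube d, ∫⁻ y' in cube d, g y y' x ≤
      c * ∫⁻ y in cube d, transDensity k (Fin.cons x y) := by
    intro x
    have := hc K _ (hk.comp_finCons_right x)
    simp only [transDensity, hg, lineDeriv_finCons_succ]
    refine le_trans (le_of_eq ?_) this
    refine lintegral_congr fun y => lintegral_congr fun y' => ?_
    congr 1; ring
  calc _ = ∫⁻ y in cube d, ∫⁻ y' in cube d, ∫⁻ x in I, g y y' x :=
        setLIntegral_congr_fun (measurableSet_cube d) fun y hy =>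
          setLIntegral_congr_fun (measurableSet_cube d) fun y' hy' => hgi y hy y' hy'
    _ = ∫⁻ y in cube d, ∫⁻ x in I, ∫⁻ y' in cube d, g y y' x :=
        lintegral_congr fun y => lintegral_lintegral_swap (hgm1 y).aemeasurable
    _ = ∫⁻ x in I, ∫⁻ y in cube d, ∫⁻ y' in cube d, g y y' x :=
        lintegral_lintegral_swap hgm3.aemeasurable
    _ ≤ ∫⁻ x in I, c * ∫⁻ y in cube d, transDensity k (Fin.cons x y) := lintegral_mono hpt
    _ = c * ∫⁻ x in I, ∫⁻ y in cube d, transDensity k (Fin.cons x y) :=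
        lintegral_const_mul' _ _ (by simp)
    _ = _ := by
        congr 1
        exact lintegral_lintegral_swap (f := fun x y => transDensity k (Fin.cons x y))
          hTm.aemeasurable

/-- A fiber on which both the energy and the distance to the other fibers are controlled. -/
theorem exists_good_fiber {L e : ℝ} {c : NNReal} (hF : IsStdPotential F) (hk : LipschitzWith K k)
    (htr : ∀ y ∈ cube d, IsTransition (fun x => k (Fin.cons x y)) L) (he0 : 0 ≤ e) {V : ℝ≥0∞}
    (hD : ∫⁻ y in cube d, ∫⁻ y' in cube d, fiberDist k y y' ≤ c * V)
    (hJV : (∫⁻ y in cube d, fiberEnergy F k L y) + 2⁻¹ * V ≤ ENNReal.ofReal (Cstar F + e)) :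
    ∃ y ∈ cube d, energy1 F (fun x => k (Fin.cons x y)) (-L) L ≤ Cstar F + (1 + 2 * c) * e ∧
      ∫⁻ y' in cube d, fiberDist k y y' ≤ ENNReal.ofReal ((1 + 2 * c) * e) := by
  have hJm := measurable_fiberEnergy hF.continuous hk L
  have hDm : Measurable fun y => ∫⁻ y' in cube d, fiberDist k y y' :=
    (measurable_fiberDist hk).lintegral_prod_right'
  have hCs : 0 ≤ Cstar F := intervalIntegral.integral_nonneg (by norm_num)
    fun x _ => Real.sqrt_nonneg _
  have hJC : ∀ y ∈ cube d, ENNReal.ofReal (Cstar F) ≤ fiberEnergy F k L y := fun y hy => by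
    rw [fiberEnergy_eq hF hk (htr y hy).pos.le]
    exact ENNReal.ofReal_le_ofReal ((htr y hy).Cstar_le hF)
  have h1 : ENNReal.ofReal (Cstar F) ≤ ∫⁻ y in cube d, fiberEnergy F k L y := by
    have := setLIntegral_mono' (μ := volume) (measurableSet_cube d) hJC
    rwa [lintegral_const, Measure.restrict_apply_univ, volume_cube, mul_one] at this
  have h2 : 2⁻¹ * V ≤ ENNReal.ofReal e := by
    refine (ENNReal.add_le_add_iff_left (a := ENNReal.ofReal (Cstar F)) ENNReal.ofReal_ne_top).1 ?_
    rw [← ENNReal.ofReal_add hCs he0]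
    exact (add_le_add_left h1 _).trans hJV
  have h3 : V ≤ 2 * ENNReal.ofReal e := by
    calc V = 2 * (2⁻¹ * V) := by
          rw [← mul_assoc, ENNReal.mul_inv_cancel (by simp) (by simp), one_mul]
      _ ≤ _ := by gcongr
  obtain ⟨y, hy, hle⟩ := exists_notMem_null_le_lintegral (μ := volume.restrict (cube d))
    (N := (cube d)ᶜ) (hJm.add hDm).aemeasurable
    (by rw [Measure.restrict_apply (measurableSet_cube d).compl]; simp)
  replace hy : y ∈ cube d := by simpa using hy
  have hJD : fiberEnergy F k L y + ∫⁻ y' in cube d, fiberDist k y y' ≤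
      ENNReal.ofReal (Cstar F + (1 + 2 * c) * e) := by
    refine hle.trans ?_
    simp only [Pi.add_apply]
    rw [lintegral_add_left hJm]
    calc _ ≤ ENNReal.ofReal (Cstar F + e) + c * (2 * ENNReal.ofReal e) :=
          add_le_add (le_self_add.trans hJV) (hD.trans (by gcongr))
      _ = _ := by
          rw [← ENNReal.ofReal_coe_nnreal, ← ENNReal.ofReal_ofNat, ← ENNReal.ofReal_mul (by simp),
            ← ENNReal.ofReal_mul (by simp), ← ENNReal.ofReal_add (by positivity) (by positivity)]
          congr 1; ring
  refine ⟨y, hy, ?_, ?_⟩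
  · have := le_self_add.trans hJD
    rw [fiberEnergy_eq hF hk (htr y hy).pos.le] at this
    exact (ENNReal.ofReal_le_ofReal_iff (by positivity)).1 this
  · refine (ENNReal.add_le_add_iff_left (a := ENNReal.ofReal (Cstar F)) ENNReal.ofReal_ne_top).1 ?_
    rw [← ENNReal.ofReal_add hCs (by positivity)]
    exact (add_le_add_left (hJC y hy) _).trans hJD

end Fibers

theorem two_mul_ofReal_add {x y : ℝ} (hx : 0 ≤ x) (hy : 0 ≤ y) :
    2 * ENNReal.ofReal x + 2 * ENNReal.ofReal y = ENNReal.ofReal (2 * x + 2 * y) := by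
  rw [ENNReal.ofReal_add (by positivity) (by positivity), ENNReal.ofReal_mul two_pos.le,
    ENNReal.ofReal_mul two_pos.le, ENNReal.ofReal_ofNat]

set_option maxHeartbeats 1000000 in
/-- Functions on the strip with small energy excess are close in `L²` to a translate of the
profile. -/
theorem exists_strip_bound {F m : ℝ → ℝ} (d : ℕ) (hF : IsStdPotential F) (hm : IsProfile F m) :
    ∃ C e₀ : ℝ, 0 < C ∧ 0 < e₀ ∧ ∀ (h : Eucl d → ℝ) (K : NNReal) (L e : ℝ), LipschitzWith K h →
      (∀ z ∈ domD d, L ≤ z 0 → h z = 1) → (∀ z ∈ domD d, z 0 ≤ -L → h z = -1) →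
      0 ≤ e → e < e₀ → fullEnergy d L F h ≤ Cstar F + e → ∃ ξ : ℝ,
        ∫⁻ z in domD d, ENNReal.ofReal ((h z - m (z 0 - ξ)) ^ 2) ≤ ENNReal.ofReal (C * e) := by
  obtain ⟨C, e₀, hC, he₀, H⟩ := exists_profile_bound hF hm
  obtain ⟨c, hc⟩ := exists_poincare_cube d
  have hA0 : (0 : ℝ) < 1 + 2 * c := by positivity
  refine ⟨2 * (1 + 2 * c) + 2 * (C * (1 + 2 * c)), e₀ / (1 + 2 * c), by positivity, by positivity,
    ?_⟩
  intro h K L e hh hR hL he0 he hen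
  set k : (Fin (d + 1) → ℝ) → ℝ := fun w => h (WithLp.toLp 2 w) with hk
  obtain ⟨K', hkl⟩ : ∃ K', LipschitzWith K' k :=
    ⟨_, hh.comp (PiLp.lipschitzWith_toLp 2 fun _ : Fin (d + 1) => ℝ)⟩
  have hyD : ∀ y ∈ cube d, ∀ x : ℝ, (WithLp.toLp 2 (Fin.cons x y) : Eucl d) ∈ domD d :=
    fun y hy x i => by simpa using! hy i
  have htr : ∀ y ∈ cube d, IsTransition (fun x => k (Fin.cons x y)) L := fun y hy =>
    ⟨⟨K', hkl.comp_finCons_left y⟩, fun x hx => hR _ (hyD y hy x) (by simpa using hx),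
      fun x hx => hL _ (hyD y hy x) (by simpa using hx)⟩
  obtain ⟨y, hy, hen1, hD⟩ := exists_good_fiber hF hkl htr he0 (lintegral_fiberDist_le hkl htr hc)
    ((fiberEnergy_add_le hF hh hkl).trans (ENNReal.ofReal_le_ofReal hen))
  obtain ⟨ξ, hξ⟩ := H _ L _ (htr y hy) (by rwa [lt_div_iff₀ hA0, mul_comm] at he) hen1
  refine ⟨ξ, ?_⟩
  have hmm : Measurable m := hm.monotone.measurable
  have hcoord : Measurable fun z : Eucl d => z 0 := by fun_prop
  have hgm : ∀ y', Measurable fun x =>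
      ENNReal.ofReal ((k (Fin.cons x y') - k (Fin.cons x y)) ^ 2) :=
    fun y' => (measurable_pair_sq hkl).comp
      ((measurable_const.prodMk measurable_const).prodMk measurable_id)
  have hdm : Measurable fun z : Eucl d => ENNReal.ofReal ((h z - m (z 0 - ξ)) ^ 2) :=
    ((hh.continuous.measurable.sub (hmm.comp (hcoord.sub_const ξ))).pow_const 2).ennreal_ofReal
  rw [domD_eq, lintegral_strip MeasurableSet.univ hdm]
  calc _ ≤ ∫⁻ y' in cube d, (2 * fiberDist k y y' +
        2 * ∫⁻ x, ENNReal.ofReal ((k (Fin.cons x y) - m (x - ξ)) ^ 2)) := by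
        refine lintegral_mono fun y' => ?_
        rw [Measure.restrict_univ, fiberDist, ← lintegral_const_mul' _ _ (by simp),
          ← lintegral_const_mul' _ _ (by simp), ← lintegral_add_left ((hgm y').const_mul 2)]
        exact lintegral_mono fun x => ofReal_sq_sub_le _ (k (Fin.cons x y)) _
    _ = 2 * (∫⁻ y' in cube d, fiberDist k y y') +
          2 * ∫⁻ x, ENNReal.ofReal ((k (Fin.cons x y) - m (x - ξ)) ^ 2) := by
        rw [lintegral_add_right _ measurable_const, lintegral_const, Measure.restrict_apply_univ,
          volume_cube, mul_one, lintegral_const_mul' _ _ (by simp)]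
    _ ≤ 2 * ENNReal.ofReal ((1 + 2 * c) * e) + 2 * ENNReal.ofReal (C * ((1 + 2 * c) * e)) := by
        gcongr
    _ = _ := by
        rw [two_mul_ofReal_add (by positivity) (by positivity)]
        congr 1; ring

/-! ### Piecewise linear functions as averages of lattice values -/

theorem intervalIntegrable_floor_add (s b c : ℝ) :
    IntervalIntegrable (fun u : ℝ => ((⌊s + u⌋ : ℤ) : ℝ)) volume b c :=
  Monotone.intervalIntegrable fun u v huv => by
    have : ⌊s + u⌋ ≤ ⌊s + v⌋ := Int.floor_le_floor (by linarith)
    exact_mod_cast this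

theorem integral_floor_add (s : ℝ) : ∫ u in (0:ℝ)..1, ((⌊s + u⌋ : ℤ) : ℝ) = s := by
  have hfi : IntervalIntegrable (fun u : ℝ => Int.fract (s + u)) volume 0 1 := by
    have := (Continuous.intervalIntegrable (by fun_prop : Continuous fun u : ℝ => s + u) 0 1).sub
      (intervalIntegrable_floor_add s 0 1)
    exact this
  have h0 : ∫ u in (0:ℝ)..1, Int.fract u = 1/2 := by
    have : ∫ u in (0:ℝ)..1, Int.fract u = ∫ u in (0:ℝ)..1, u := by
      refine intervalIntegral.integral_congr_ae ?_
      filter_upwards [Measure.ae_ne volume (1 : ℝ)] with u hu hu1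
      rw [Set.uIoc_of_le zero_le_one] at hu1
      exact Int.fract_eq_self.2 ⟨hu1.1.le, lt_of_le_of_ne hu1.2 hu⟩
    rw [this, integral_id]; norm_num
  have h1 : ∫ u in (0:ℝ)..1, Int.fract (s + u) = 1/2 := by
    rw [intervalIntegral.integral_comp_add_left (fun u : ℝ => Int.fract u), add_zero, ← h0,
      (Int.fract_periodic ℝ).intervalIntegral_add_eq s 0, zero_add]
  have h2 : (fun u : ℝ => ((⌊s + u⌋ : ℤ) : ℝ)) = fun u => (s + u) - Int.fract (s + u) := by
    funext u; exact (Int.self_sub_fract _).symm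
  rw [h2, intervalIntegral.integral_sub
    (Continuous.intervalIntegrable (by fun_prop) 0 1) hfi, h1]
  simp only [intervalIntegral.integral_add (f := fun _ => s) (g := fun u => u)
    intervalIntegrable_const (Continuous.intervalIntegrable (by fun_prop) 0 1),
    intervalIntegral.integral_const, integral_id]
  norm_num

theorem abs_integral_floor_sub (s t : ℝ) :
    ∫ u in (0:ℝ)..1, |((⌊s + u⌋ : ℤ) : ℝ) - ((⌊t + u⌋ : ℤ) : ℝ)| = |s - t| := by
  wlog hst : t ≤ s generalizing s t
  · rw [abs_sub_comm s t, ← this t s (le_of_not_ge hst)]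
    simp only [abs_sub_comm]
  have h : ∀ u : ℝ, |((⌊s + u⌋ : ℤ) : ℝ) - ((⌊t + u⌋ : ℤ) : ℝ)| =
      ((⌊s + u⌋ : ℤ) : ℝ) - ((⌊t + u⌋ : ℤ) : ℝ) := fun u => by
    have : ⌊t + u⌋ ≤ ⌊s + u⌋ := Int.floor_le_floor (by linarith)
    exact abs_of_nonneg (sub_nonneg.2 (by exact_mod_cast this))
  simp only [h]
  rw [intervalIntegral.integral_sub (intervalIntegrable_floor_add _ _ _)
    (intervalIntegrable_floor_add _ _ _), integral_floor_add, integral_floor_add,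
    abs_of_nonneg (by linarith)]

/-- The lattice point with index `q`. -/
def latPt {d : ℕ} (a : ℝ) (q : Fin (d + 1) → ℤ) : Eucl d := WithLp.toLp 2 fun i => a * q i

@[simp] theorem latPt_apply {d : ℕ} (a : ℝ) (q : Fin (d + 1) → ℤ) (i : Fin (d + 1)) :
    latPt a q i = a * q i := rfl

theorem latticePt_latPt {d : ℕ} (a : ℝ) (q : Fin (d + 1) → ℤ) : latticePt d a (latPt a q) :=
  fun i => ⟨q i, rfl⟩

/-- The index of the lattice point obtained from `z` by rounding with shift `u`. -/
def roundIdx {d : ℕ} (a : ℝ) (z : Eucl d) (u : ℝ) (i : Fin (d + 1)) : ℤ := ⌊z i / a + u⌋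

theorem AffineMap.apply_eq_sum {d : ℕ} (φ : Eucl d →ᵃ[ℝ] ℝ) (z : Eucl d) :
    φ z = ∑ i, z i * φ.linear (EuclideanSpace.single i 1) + φ 0 := by
  have h1 := φ.map_vadd 0 z
  simp only [vadd_eq_add, add_zero] at h1
  rw [h1]
  congr 1
  have h2 : z = ∑ i, z i • EuclideanSpace.single i (1 : ℝ) := by
    ext j
    simp [Finset.sum_apply, Pi.single_apply]
  conv_lhs => rw [h2, map_sum]
  exact Finset.sum_congr rfl fun i _ => by rw [map_smul, smul_eq_mul]

namespace IsPLGrid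

variable {d : ℕ} {a : ℝ} {h h' : Eucl d → ℝ}

/-- On the rounding path of `z`, a piecewise linear function agrees with an affine function. -/
theorem exists_affine (hh : IsPLGrid d a h) (ha : 0 < a) (z : Eucl d) :
    ∃ φ : Eucl d →ᵃ[ℝ] ℝ, h z = φ z ∧
      ∀ u ∈ Set.Ico (0:ℝ) 1, h (latPt a (roundIdx a z u)) = φ (latPt a (roundIdx a z u)) := by
  set p : Fin (d + 1) → ℤ := fun i => ⌊z i / a⌋ with hp
  set t : Fin (d + 1) → ℝ := fun i => Int.fract (z i / a) with ht
  have hz : ∀ i, z i - a * p i = a * t i := fun i => by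
    simp only [hp, ht, Int.fract]; field_simp
  set σ := Tuple.sort fun i => -t i with hσ
  have hmono : ∀ k l : Fin (d + 1), k ≤ l → t (σ l) ≤ t (σ k) := fun k l hkl => by
    have := Tuple.monotone_sort (fun i => -t i) hkl
    simpa using this
  obtain ⟨φ, hφ⟩ := hh.2 p σ
  refine ⟨φ, hφ z (fun i => ?_) fun k l hkl => ?_, fun u hu => ?_⟩
  · have h1 := Int.fract_nonneg (z i / a)
    have h2 := (Int.fract_lt_one (z i / a)).le
    have h3 := hz i
    have h4 : 0 ≤ a * t i := mul_nonneg ha.le h1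
    have h5 : a * t i ≤ a * 1 := mul_le_mul_of_nonneg_left h2 ha.le
    constructor <;> linarith
  · rw [hz, hz]; exact mul_le_mul_of_nonneg_left (hmono k l hkl) ha.le
  · have hr : ∀ i, ((roundIdx a z u i : ℤ) : ℝ) - p i = (⌊t i + u⌋ : ℤ) := fun i => by
      have : z i / a + u = (t i + u) + (p i : ℝ) := by
        simp only [hp, ht, Int.fract]; ring
      rw [roundIdx, this, Int.floor_add_intCast]
      push_cast; ring
    refine hφ _ (fun i => ?_) fun k l hkl => ?_
    · have h1 := Int.fract_nonneg (z i / a)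
      have h2 := Int.fract_lt_one (z i / a)
      have h3 : 0 ≤ ⌊t i + u⌋ := Int.floor_nonneg.2 (add_nonneg h1 hu.1)
      have h4 : ⌊t i + u⌋ ≤ 1 := by
        rw [← Int.lt_add_one_iff, Int.floor_lt]; push_cast
        have := hu.2
        simp only [ht]; linarith
      have h3' : (0:ℝ) ≤ (⌊t i + u⌋ : ℤ) := by exact_mod_cast h3
      have h4' : ((⌊t i + u⌋ : ℤ) : ℝ) ≤ 1 := by exact_mod_cast h4
      rw [← hr] at h3' h4'
      rw [latPt_apply]
      constructor <;> nlinarith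
    · simp only [latPt_apply, ← mul_sub, hr]
      refine mul_le_mul_of_nonneg_left ?_ ha.le
      exact_mod_cast Int.floor_le_floor (by linarith [hmono k l hkl])

theorem eq_integral_aux (hh : IsPLGrid d a h) (ha : 0 < a) (z : Eucl d) :
    IntervalIntegrable (fun u => h (latPt a (roundIdx a z u))) volume 0 1 ∧
      ∫ u in (0:ℝ)..1, h (latPt a (roundIdx a z u)) = h z := by
  obtain ⟨φ, hφz, hφ⟩ := hh.exists_affine ha z
  set c : Fin (d + 1) → ℝ := fun i => φ.linear (EuclideanSpace.single i 1) with hc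
  set G : ℝ → ℝ := fun u => ∑ i, a * ((⌊z i / a + u⌋ : ℤ) : ℝ) * c i + φ 0 with hG
  have hae : ∀ᵐ u ∂volume, u ∈ Set.uIoc (0:ℝ) 1 → h (latPt a (roundIdx a z u)) = G u := by
    filter_upwards [Measure.ae_ne volume (1 : ℝ)] with u hu hu1
    rw [Set.uIoc_of_le zero_le_one] at hu1
    rw [hφ u ⟨hu1.1.le, lt_of_le_of_ne hu1.2 hu⟩, φ.apply_eq_sum]
    rfl
  have hterm : ∀ i, IntervalIntegrable (fun u => a * ((⌊z i / a + u⌋ : ℤ) : ℝ) * c i) volume 0 1 :=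
    fun i => ((intervalIntegrable_floor_add _ _ _).const_mul _).mul_const _
  have hsum : IntervalIntegrable (fun u => ∑ i, a * ((⌊z i / a + u⌋ : ℤ) : ℝ) * c i)
      volume 0 1 := by
    have := IntervalIntegrable.sum Finset.univ fun i _ => hterm i
    convert! this using 1
    funext u
    rw [Finset.sum_apply]
  have hGi : IntervalIntegrable G volume 0 1 := hsum.add intervalIntegrable_const
  refine ⟨hGi.congr_ae ?_, ?_⟩
  · rw [EventuallyEq, ae_restrict_iff' measurableSet_uIoc]
    filter_upwards [hae] with u hu hu1 using (hu hu1).symm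
  · rw [intervalIntegral.integral_congr_ae hae, hφz, φ.apply_eq_sum, hG,
      intervalIntegral.integral_add hsum intervalIntegrable_const,
      intervalIntegral.integral_finsetSum fun i _ => hterm i]
    simp only [intervalIntegral.integral_mul_const, intervalIntegral.integral_const_mul,
      integral_floor_add, intervalIntegral.integral_const]
    congr 1
    · exact Finset.sum_congr rfl fun i _ => by rw [mul_div_cancel₀ _ ha.ne']
    · simp

theorem intervalIntegrable (hh : IsPLGrid d a h) (ha : 0 < a) (z : Eucl d) :
    IntervalIntegrable (fun u => h (latPt a (roundIdx a z u))) volume 0 1 :=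
  (hh.eq_integral_aux ha z).1

theorem integral_eq (hh : IsPLGrid d a h) (ha : 0 < a) (z : Eucl d) :
    ∫ u in (0:ℝ)..1, h (latPt a (roundIdx a z u)) = h z :=
  (hh.eq_integral_aux ha z).2

theorem add (hh : IsPLGrid d a h) (hh' : IsPLGrid d a h') : IsPLGrid d a (fun z => h z + h' z) := by
  refine ⟨hh.1.add hh'.1, fun p σ => ?_⟩
  obtain ⟨φ, hφ⟩ := hh.2 p σ
  obtain ⟨φ', hφ'⟩ := hh'.2 p σ
  exact ⟨φ + φ', fun z h1 h2 => by
    show h z + h' z = _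
    rw [hφ z h1 h2, hφ' z h1 h2]; rfl⟩

end IsPLGrid

/-- The closed strip `ℝ × [0,1]^d`. -/
def closedStrip (d : ℕ) : Set (Eucl d) := {z | ∀ i : Fin d, z i.succ ∈ Set.Icc (0 : ℝ) 1}

theorem domD_subset_closedStrip (d : ℕ) : domD d ⊆ closedStrip d :=
  fun _ hz i => ⟨(hz i).1.le, (hz i).2.le⟩

theorem domDL_subset_domD (d : ℕ) (L : ℝ) : domDL d L ⊆ domD d := fun _ hz => hz.2

theorem isOpen_domD (d : ℕ) : IsOpen (domD d) := by
  have : domD d = ⋂ i : Fin d, {z : Eucl d | z i.succ ∈ Set.Ioo (0 : ℝ) 1} := by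
    ext z; simp [domD]
  rw [this]
  exact isOpen_iInter_of_finite fun i => isOpen_Ioo.preimage
    (by fun_prop : Continuous fun w : Eucl d => w i.succ)

theorem roundIdx_mem_closedStrip {d : ℕ} {a : ℝ} {n : ℕ} (hn : 0 < n) (han : a = 1 / n)
    {z : Eucl d} (hz : z ∈ closedStrip d) {u : ℝ} (hu : u ∈ Set.Ico (0:ℝ) 1) :
    latPt a (roundIdx a z u) ∈ closedStrip d := by
  have hn' : (0:ℝ) < n := by exact_mod_cast hn
  have ha : 0 < a := by rw [han]; positivity
  intro i
  have h0 : 0 ≤ z i.succ / a := div_nonneg (hz i).1 ha.le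
  have h1 : z i.succ / a ≤ n := by
    rw [div_le_iff₀ ha, han, mul_one_div_cancel hn'.ne']; exact (hz i).2
  have h2 : 0 ≤ ⌊z i.succ / a + u⌋ := Int.floor_nonneg.2 (add_nonneg h0 hu.1)
  have h3 : ⌊z i.succ / a + u⌋ ≤ n := by
    rw [← Int.lt_add_one_iff, Int.floor_lt]; push_cast; linarith [hu.2]
  have h2' : (0:ℝ) ≤ (⌊z i.succ / a + u⌋ : ℤ) := by exact_mod_cast h2
  have h3' : ((⌊z i.succ / a + u⌋ : ℤ) : ℝ) ≤ n := by exact_mod_cast h3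
  rw [latPt_apply]
  refine ⟨mul_nonneg ha.le h2', ?_⟩
  calc a * (roundIdx a z u i.succ : ℝ) ≤ a * n := mul_le_mul_of_nonneg_left h3' ha.le
    _ = 1 := by rw [han, one_div_mul_cancel hn'.ne']

namespace IsPLGrid

variable {d : ℕ} {a : ℝ} {h : Eucl d → ℝ} {n : ℕ}

theorem pos_mesh (hn : 0 < n) (han : a = 1 / n) : 0 < a := by
  have hn' : (0:ℝ) < n := by exact_mod_cast hn
  rw [han]; positivity

theorem abs_le (hh : IsPLGrid d a h) (hn : 0 < n) (han : a = 1 / n) {M : ℝ}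
    (hM : ∀ q, latPt a q ∈ closedStrip d → |h (latPt a q)| ≤ M) {z : Eucl d}
    (hz : z ∈ closedStrip d) : |h z| ≤ M := by
  rw [← hh.integral_eq (pos_mesh hn han) z]
  have h1 : ∀ᵐ u ∂volume, u ∈ Set.uIoc (0:ℝ) 1 → ‖h (latPt a (roundIdx a z u))‖ ≤ M := by
    filter_upwards [Measure.ae_ne volume (1 : ℝ)] with u hu hu1
    rw [Set.uIoc_of_le zero_le_one] at hu1
    exact hM _ (roundIdx_mem_closedStrip hn han hz ⟨hu1.1.le, lt_of_le_of_ne hu1.2 hu⟩)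
  simpa using intervalIntegral.norm_integral_le_of_norm_le_const_ae h1

theorem abs_sub_le (hh : IsPLGrid d a h) (hn : 0 < n) (han : a = 1 / n) {M : ℝ}
    (hM : ∀ q, latPt a q ∈ closedStrip d → |h (latPt a q)| ≤ M) {z z' : Eucl d}
    (hz : z ∈ closedStrip d) (hz' : z' ∈ closedStrip d) :
    |h z - h z'| ≤ 2 * M / a * ∑ i, |z i - z' i| := by
  have ha := pos_mesh hn han
  have hM0 : 0 ≤ M := (abs_nonneg _).trans (hh.abs_le hn han hM hz)
  rw [← hh.integral_eq ha z, ← hh.integral_eq ha z',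
    ← intervalIntegral.integral_sub (hh.intervalIntegrable ha z) (hh.intervalIntegrable ha z')]
  set G : ℝ → ℝ := fun u => 2 * M * ∑ i, |((⌊z i / a + u⌋ : ℤ) : ℝ) - ((⌊z' i / a + u⌋ : ℤ) : ℝ)|
    with hG
  have hterm : ∀ i, IntervalIntegrable (fun u => |((⌊z i / a + u⌋ : ℤ) : ℝ) -
      ((⌊z' i / a + u⌋ : ℤ) : ℝ)|) volume 0 1 := fun i =>
    ((intervalIntegrable_floor_add _ _ _).sub (intervalIntegrable_floor_add _ _ _)).norm
  have hsum : IntervalIntegrable (fun u => ∑ i, |((⌊z i / a + u⌋ : ℤ) : ℝ) -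
      ((⌊z' i / a + u⌋ : ℤ) : ℝ)|) volume 0 1 := by
    have := IntervalIntegrable.sum Finset.univ fun i _ => hterm i
    convert! this using 1
    funext u
    rw [Finset.sum_apply]
  have hGi : IntervalIntegrable G volume 0 1 := hsum.const_mul _
  have hle : ∀ᵐ u ∂volume, u ∈ Set.Ioc (0:ℝ) 1 →
      ‖h (latPt a (roundIdx a z u)) - h (latPt a (roundIdx a z' u))‖ ≤ G u := by
    filter_upwards [Measure.ae_ne volume (1 : ℝ)] with u hu hu1
    have hu2 : u ∈ Set.Ico (0:ℝ) 1 := ⟨hu1.1.le, lt_of_le_of_ne hu1.2 hu⟩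
    have b1 := hM _ (roundIdx_mem_closedStrip hn han hz hu2)
    have b2 := hM _ (roundIdx_mem_closedStrip hn han hz' hu2)
    rw [Real.norm_eq_abs, hG]
    by_cases heq : roundIdx a z u = roundIdx a z' u
    · rw [heq, sub_self, abs_zero]
      exact mul_nonneg (by positivity) (Finset.sum_nonneg fun i _ => abs_nonneg _)
    · obtain ⟨i, hi⟩ := Function.ne_iff.1 heq
      have h1 : (1:ℝ) ≤ |((⌊z i / a + u⌋ : ℤ) : ℝ) - ((⌊z' i / a + u⌋ : ℤ) : ℝ)| := by
        have : (1:ℤ) ≤ |⌊z i / a + u⌋ - ⌊z' i / a + u⌋| := Int.one_le_abs (sub_ne_zero.2 hi)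
        exact_mod_cast this
      have h2 := Finset.single_le_sum (f := fun i => |((⌊z i / a + u⌋ : ℤ) : ℝ) -
        ((⌊z' i / a + u⌋ : ℤ) : ℝ)|) (fun i _ => abs_nonneg _) (Finset.mem_univ i)
      calc _ ≤ M + M := (abs_sub _ _).trans (add_le_add b1 b2)
        _ = 2 * M * 1 := by ring
        _ ≤ _ := mul_le_mul_of_nonneg_left (h1.trans h2) (by positivity)
  refine (intervalIntegral.norm_integral_le_of_norm_le zero_le_one hle hGi).trans (le_of_eq ?_)
  rw [hG, intervalIntegral.integral_const_mul,
      intervalIntegral.integral_finsetSum fun i _ => hterm i]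
  simp only [abs_integral_floor_sub]
  rw [div_mul_eq_mul_div, mul_div_assoc, Finset.sum_div]
  congr 1
  refine Finset.sum_congr rfl fun i _ => ?_
  rw [← sub_div, abs_div, abs_of_pos ha]

theorem abs_sub_le_norm (hh : IsPLGrid d a h) (hn : 0 < n) (han : a = 1 / n) {M : ℝ}
    (hM : ∀ q, latPt a q ∈ closedStrip d → |h (latPt a q)| ≤ M) {z z' : Eucl d}
    (hz : z ∈ closedStrip d) (hz' : z' ∈ closedStrip d) :
    |h z - h z'| ≤ 2 * M / a * (d + 1) * ‖z - z'‖ := by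
  have ha := pos_mesh hn han
  have hM0 : 0 ≤ M := (abs_nonneg _).trans (hh.abs_le hn han hM hz)
  refine (hh.abs_sub_le hn han hM hz hz').trans ?_
  rw [mul_assoc]
  refine mul_le_mul_of_nonneg_left ?_ (by positivity)
  calc ∑ i, |z i - z' i| ≤ ∑ _i : Fin (d + 1), ‖z - z'‖ :=
        Finset.sum_le_sum fun i _ => PiLp.norm_apply_le (z - z') i
    _ = _ := by simp

end IsPLGrid

/-! ### The discretized energy -/

theorem fderiv_congr_strip {d : ℕ} {h h' : Eucl d → ℝ} (heq : ∀ z ∈ domD d, h z = h' z)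
    {z : Eucl d} (hz : z ∈ domD d) : fderiv ℝ h z = fderiv ℝ h' z :=
  Filter.EventuallyEq.fderiv_eq (Filter.eventuallyEq_of_mem ((isOpen_domD d).mem_nhds hz) heq)

theorem fullEnergy_congr {d : ℕ} {L : ℝ} {F : ℝ → ℝ} {h h' : Eucl d → ℝ}
    (heq : ∀ z ∈ domD d, h z = h' z) : fullEnergy d L F h = fullEnergy d L F h' :=
  setIntegral_congr_fun (measurableSet_domDL d L) fun z hz => by
    have hz' := domDL_subset_domD d L hz
    simp only [fderiv_congr_strip heq hz', heq z hz']

theorem norm_fderiv_le_of_strip {d : ℕ} {h : Eucl d → ℝ} {C : ℝ} (hC : 0 ≤ C)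
    (hlip : ∀ z ∈ closedStrip d, ∀ z' ∈ closedStrip d, |h z - h z'| ≤ C * ‖z - z'‖)
    {z : Eucl d} (hz : z ∈ domD d) : ‖fderiv ℝ h z‖ ≤ C :=
  norm_fderiv_le_of_lip' ℝ hC <| by
    filter_upwards [(isOpen_domD d).mem_nhds hz] with z' hz'
    exact hlip z' (domD_subset_closedStrip d hz') z (domD_subset_closedStrip d hz)

/-- The (coordinatewise) Lipschitz constant of a piecewise linear function with unit values. -/
def lipConst (d : ℕ) (a : ℝ) : ℝ := 2 * (d + 1) / a

theorem lipConst_pos {d : ℕ} {a : ℝ} (ha : 0 < a) : 0 < lipConst d a := by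
  unfold lipConst; positivity

namespace IsPLGrid

variable {d : ℕ} {a : ℝ} {h : Eucl d → ℝ} {n : ℕ}

theorem lip (hh : IsPLGrid d a h) (hn : 0 < n) (han : a = 1 / n) {M : ℝ}
    (hM : ∀ q, latPt a q ∈ closedStrip d → |h (latPt a q)| ≤ M) :
    ∀ z ∈ closedStrip d, ∀ z' ∈ closedStrip d, |h z - h z'| ≤ lipConst d a * M * ‖z - z'‖ :=
  fun z hz z' hz' => (hh.abs_sub_le_norm hn han hM hz hz').trans
    (le_of_eq (by rw [lipConst]; ring))

theorem bound_nonneg (hh : IsPLGrid d a h) (hn : 0 < n) (han : a = 1 / n) {M : ℝ}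
    (hM : ∀ q, latPt a q ∈ closedStrip d → |h (latPt a q)| ≤ M) : 0 ≤ M :=
  (abs_nonneg _).trans (hh.abs_le hn han hM (z := 0) fun i => by simp)

theorem norm_fderiv_le (hh : IsPLGrid d a h) (hn : 0 < n) (han : a = 1 / n) {M : ℝ}
    (hM : ∀ q, latPt a q ∈ closedStrip d → |h (latPt a q)| ≤ M) {z : Eucl d} (hz : z ∈ domD d) :
    ‖fderiv ℝ h z‖ ≤ lipConst d a * M :=
  norm_fderiv_le_of_strip (mul_nonneg (lipConst_pos (pos_mesh hn han)).le
    (hh.bound_nonneg hn han hM)) (hh.lip hn han hM) hz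

theorem exists_extension (hh : IsPLGrid d a h) (hn : 0 < n) (han : a = 1 / n) {M : ℝ}
    (hM : ∀ q, latPt a q ∈ closedStrip d → |h (latPt a q)| ≤ M) :
    ∃ (h' : Eucl d → ℝ) (K : NNReal), LipschitzWith K h' ∧ ∀ z ∈ domD d, h z = h' z := by
  have hC : 0 ≤ lipConst d a * M := mul_nonneg (lipConst_pos (pos_mesh hn han)).le
    (hh.bound_nonneg hn han hM)
  have hlip : LipschitzOnWith (lipConst d a * M).toNNReal h (closedStrip d) :=
    LipschitzOnWith.of_dist_le_mul fun z hz z' hz' => by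
      rw [Real.coe_toNNReal _ hC, dist_eq_norm, dist_eq_norm]
      exact hh.lip hn han hM z hz z' hz'
  obtain ⟨h', hl, heq⟩ := hlip.extend_real
  exact ⟨h', _, hl, fun z hz => heq (domD_subset_closedStrip d hz)⟩

theorem ae_differentiableAt (hh : IsPLGrid d a h) (hn : 0 < n) (han : a = 1 / n) {M : ℝ}
    (hM : ∀ q, latPt a q ∈ closedStrip d → |h (latPt a q)| ≤ M) :
    ∀ᵐ z ∂volume, z ∈ domD d → DifferentiableAt ℝ h z := by
  obtain ⟨h', K, hl, heq⟩ := hh.exists_extension hn han hM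
  filter_upwards [hl.ae_differentiableAt] with z hz hzD
  exact hz.congr_of_eventuallyEq (eventuallyEq_of_mem ((isOpen_domD d).mem_nhds hzD) heq)

theorem integrableOn_energy (hh : IsPLGrid d a h) (hn : 0 < n) (han : a = 1 / n) {M : ℝ}
    (hM : ∀ q, latPt a q ∈ closedStrip d → |h (latPt a q)| ≤ M) {F : ℝ → ℝ} (hF : Continuous F)
    (L : ℝ) : IntegrableOn (fun z => 1/2 * ‖fderiv ℝ h z‖ ^ 2 + F (h z)) (domDL d L) := by
  obtain ⟨h', K, hl, heq⟩ := hh.exists_extension hn han hM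
  refine (integrableOn_congr_fun (fun z hz => ?_) (measurableSet_domDL d L)).2
    (hl.integrableOn_energy hF)
  have hz' := domDL_subset_domD d L hz
  simp only [fderiv_congr_strip heq hz', heq z hz']

end IsPLGrid

namespace Disc

variable {d n : ℕ} {L a : ℝ} (D : Disc d L a) {g g' : gridSet d L a → ℝ}

theorem discFun_pl (g) : IsPLGrid d a (discFun d L a D g) := D.bc_pl.add (D.interp0_pl g)

theorem discFun_grid (g) {z : Eucl d} (hz : z ∈ gridSet d L a) :
    discFun d L a D g z = g ⟨z, hz⟩ := by
  rw [discFun, D.bc_grid z hz, D.interp0_grid g z hz, zero_add]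

theorem discFun_pos (g) {z : Eucl d} (hl : latticePt d a z) (hz : z ∉ gridSet d L a)
    (h0 : 0 < z 0) : discFun d L a D g z = 1 := by
  rw [discFun, D.bc_lattice_pos z hl hz h0, D.interp0_lattice g z hl hz, add_zero]

theorem discFun_neg (g) {z : Eucl d} (hl : latticePt d a z) (hz : z ∉ gridSet d L a)
    (h0 : z 0 < 0) : discFun d L a D g z = -1 := by
  rw [discFun, D.bc_lattice_neg z hl hz h0, D.interp0_lattice g z hl hz, add_zero]

theorem discFun_right (g) {z : Eucl d} (hz : L ≤ z 0) :
    discFun d L a D g z = 1 := by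
  rw [discFun, D.bc_plus z hz, D.interp0_bd g z (hz.trans (le_abs_self _)), add_zero]

theorem discFun_left (g) {z : Eucl d} (hz : z 0 ≤ -L) :
    discFun d L a D g z = -1 := by
  rw [discFun, D.bc_minus z hz, D.interp0_bd g z (by
    have := neg_le_abs (z 0); linarith), add_zero]

theorem discFun_sub (g g') (z : Eucl d) :
    discFun d L a D g z - discFun d L a D g' z = D.interp0 (g - g') z := by
  rw [map_sub, discFun, discFun, Pi.sub_apply]; ring

end Disc

theorem lt_abs_of_notMem_gridSet {d : ℕ} {L a : ℝ} {z : Eucl d} (hl : latticePt d a z)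
    (hs : z ∈ closedStrip d) (hz : z ∉ gridSet d L a) : L - a < |z 0| := by
  by_contra h
  exact hz ⟨hl, not_lt.1 h, hs⟩

namespace Disc

variable {d n : ℕ} {L a : ℝ} (D : Disc d L a) {g g' : gridSet d L a → ℝ}

theorem abs_discFun_latPt_le (haL : a ≤ L) {B : ℝ} (hB1 : 1 ≤ B) (hg : ∀ z, |g z| ≤ B)
    (q : Fin (d + 1) → ℤ) (hq : latPt a q ∈ closedStrip d) :
    |discFun d L a D g (latPt a q)| ≤ B := by
  by_cases hz : latPt a q ∈ gridSet d L a
  · rw [D.discFun_grid g hz]; exact hg _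
  · have h1 := lt_abs_of_notMem_gridSet (latticePt_latPt a q) hq hz
    have h2 : latPt a q 0 ≠ 0 := abs_pos.1 (by linarith)
    rcases h2.lt_or_gt with h | h
    · rw [D.discFun_neg g (latticePt_latPt a q) hz h]; simpa using hB1
    · rw [D.discFun_pos g (latticePt_latPt a q) hz h]; simpa using hB1

theorem abs_interp0_latPt_le {B : ℝ} (hB : 0 ≤ B) (hg : ∀ z, |g z| ≤ B)
    (q : Fin (d + 1) → ℤ) (_hq : latPt a q ∈ closedStrip d) :
    |D.interp0 g (latPt a q)| ≤ B := by
  by_cases hz : latPt a q ∈ gridSet d L a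
  · rw [D.interp0_grid g _ hz]; exact hg _
  · rw [D.interp0_lattice g _ (latticePt_latPt a q) hz]; simpa using hB

theorem exists_bound (D : Disc d L a) (g : gridSet d L a → ℝ) : ∃ B : ℝ,
    1 ≤ B ∧ ∀ z, |g z| ≤ B := by
  let := D.gridFin
  refine ⟨1 + ∑ z, |g z|, ?_, fun z => ?_⟩
  · have := Finset.sum_nonneg (s := Finset.univ) fun (z : gridSet d L a) _ => abs_nonneg (g z)
    linarith
  · have := Finset.single_le_sum (f := fun z => |g z|) (fun z _ => abs_nonneg (g z))
      (Finset.mem_univ z)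
    linarith

/-- The energy is locally Lipschitz in the grid values. -/
theorem abs_fullEnergy_sub_le (hn : 0 < n) (han : a = 1 / n) (haL : a ≤ L) {F : ℝ → ℝ}
    (hF : Continuous F) {B r κ : ℝ} (hB1 : 1 ≤ B) (hg : ∀ z, |g z| ≤ B) (hg' : ∀ z, |g' z| ≤ B)
    (hr : 0 ≤ r) (hgr : ∀ z, |g z - g' z| ≤ r)
    (hκ : ∀ u v, |u| ≤ B → |v| ≤ B → |F u - F v| ≤ κ * |u - v|) (hκ0 : 0 ≤ κ) :
    |fullEnergy d L F (discFun d L a D g) - fullEnergy d L F (discFun d L a D g')| ≤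
      (lipConst d a ^ 2 * B * r + κ * r) * (2 * L) := by
  have ha := IsPLGrid.pos_mesh hn han
  have hc := lipConst_pos (d := d) ha
  have b1 := D.abs_discFun_latPt_le haL hB1 hg
  have b2 := D.abs_discFun_latPt_le haL hB1 hg'
  have b3 := D.abs_interp0_latPt_le (g := g - g') hr hgr
  have p1 := D.discFun_pl g
  have p2 := D.discFun_pl g'
  have p3 := D.interp0_pl (g - g')
  have i1 := p1.integrableOn_energy hn han b1 hF L
  have i2 := p2.integrableOn_energy hn han b2 hF L
  unfold fullEnergy
  rw [← integral_sub i1 i2]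
  have hvol : (volume.restrict (domDL d L)).real Set.univ = 2 * L := by
    rw [measureReal_restrict_apply_univ, Measure.real, volume_domDL, ENNReal.toReal_ofReal]
    linarith
  rw [← hvol, ← Real.norm_eq_abs]
  refine norm_integral_le_of_norm_le_const (μ := volume.restrict (domDL d L)) ?_
  rw [ae_restrict_iff' (measurableSet_domDL d L)]
  filter_upwards [p1.ae_differentiableAt hn han b1, p2.ae_differentiableAt hn han b2]
    with z d1 d2 hz
  have hzD := domDL_subset_domD d L hz
  have hzC := domD_subset_closedStrip d hzD
  have f1 := p1.norm_fderiv_le hn han b1 hzD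
  have f2 := p2.norm_fderiv_le hn han b2 hzD
  have f3 : ‖fderiv ℝ (discFun d L a D g) z - fderiv ℝ (discFun d L a D g') z‖ ≤
      lipConst d a * r := by
    rw [← fderiv_fun_sub (d1 hzD) (d2 hzD)]
    simp only [D.discFun_sub]
    exact p3.norm_fderiv_le hn han b3 hzD
  have v1 := p1.abs_le hn han b1 hzC
  have v2 := p2.abs_le hn han b2 hzC
  have v3 : |discFun d L a D g z - discFun d L a D g' z| ≤ r := by
    rw [D.discFun_sub]; exact p3.abs_le hn han b3 hzC
  set x := ‖fderiv ℝ (discFun d L a D g) z‖ with hx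
  set y := ‖fderiv ℝ (discFun d L a D g') z‖ with hy
  have hxy : |x - y| ≤ lipConst d a * r := (abs_norm_sub_norm_le _ _).trans f3
  have hx0 : 0 ≤ x := norm_nonneg _
  have hy0 : 0 ≤ y := norm_nonneg _
  have hF1 : |F (discFun d L a D g z) - F (discFun d L a D g' z)| ≤ κ * r :=
    (hκ _ _ v1 v2).trans (mul_le_mul_of_nonneg_left v3 hκ0)
  have hq : |1/2 * x ^ 2 - 1/2 * y ^ 2| ≤ lipConst d a ^ 2 * B * r := by
    have : 1/2 * x ^ 2 - 1/2 * y ^ 2 = (x - y) * ((x + y) / 2) := by ring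
    rw [this, abs_mul, abs_of_nonneg (by positivity : 0 ≤ (x + y) / 2)]
    calc |x - y| * ((x + y) / 2) ≤ (lipConst d a * r) * (lipConst d a * B) := by
          refine mul_le_mul hxy (by linarith) (by positivity) (by positivity)
      _ = _ := by ring
  calc _ = |(1/2 * x ^ 2 - 1/2 * y ^ 2) +
        (F (discFun d L a D g z) - F (discFun d L a D g' z))| := by
        rw [Real.norm_eq_abs]; congr 1; ring
    _ ≤ _ := (abs_add_le _ _).trans (add_le_add hq hF1)

theorem fullEnergy_nonneg {F : ℝ → ℝ} (hF : IsStdPotential F) (h : Eucl d → ℝ) :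
    0 ≤ fullEnergy d L F h :=
  integral_nonneg fun _ => add_nonneg (by positivity) (hF.nonneg _)

end Disc

theorem IsStdPotential.exists_lip {F : ℝ → ℝ} (hF : IsStdPotential F) (B : ℝ) :
    ∃ κ : ℝ, 0 ≤ κ ∧ ∀ u v, |u| ≤ B → |v| ≤ B → |F u - F v| ≤ κ * |u - v| := by
  obtain ⟨κ, hκ⟩ := (isCompact_Icc (a := -B) (b := B)).exists_bound_of_continuousOn
    hF.contDiff_deriv.continuous.continuousOn
  refine ⟨max κ 0, le_max_right _ _, fun u v hu hv => ?_⟩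
  exact (convex_Icc (-B) B).norm_image_sub_le_of_norm_deriv_le
    (fun x _ => hF.differentiable x) (fun x hx => (hκ x hx).trans (le_max_left _ _))
    (abs_le.1 hv) (abs_le.1 hu)

namespace Disc

variable {d n : ℕ} {L a : ℝ} (D : Disc d L a) {g g' : gridSet d L a → ℝ}

theorem continuous_fullEnergy (hn : 0 < n) (han : a = 1 / n) (haL : a ≤ L) {F : ℝ → ℝ}
    (hF : IsStdPotential F) : Continuous fun g => fullEnergy d L F (discFun d L a D g) := by
  let := D.gridFin
  have ha := IsPLGrid.pos_mesh hn han
  rw [continuous_iff_continuousAt]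
  intro g₀
  obtain ⟨B, hB1, hB⟩ := D.exists_bound g₀
  obtain ⟨κ, hκ0, hκ⟩ := hF.exists_lip (B + 1)
  refine tendsto_iff_dist_tendsto_zero.2 (squeeze_zero' (Eventually.of_forall fun _ => dist_nonneg)
    (g := fun g => (lipConst d a ^ 2 * (B + 1) * dist g g₀ + κ * dist g g₀) * (2 * L)) ?_ ?_)
  · filter_upwards [Metric.ball_mem_nhds g₀ one_pos] with g hg
    have hgd : ∀ z, |g z - g₀ z| ≤ dist g g₀ := fun z => dist_le_pi_dist g g₀ z
    refine D.abs_fullEnergy_sub_le hn han haL hF.continuous (by linarith) (fun z => ?_)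
      (fun z => (hB z).trans (by linarith)) dist_nonneg hgd hκ hκ0
    have h1 := hgd z
    have h2 : dist g g₀ < 1 := hg
    have h3 := hB z
    calc |g z| = |(g z - g₀ z) + g₀ z| := by ring_nf
      _ ≤ _ := (abs_add_le _ _).trans (by linarith)
  · have hd : Tendsto (fun g => dist g g₀) (𝓝 g₀) (𝓝 0) := by
      have : Continuous fun g => dist g g₀ := by fun_prop
      simpa using this.tendsto g₀
    have := (((hd.const_mul (lipConst d a ^ 2 * (B + 1))).add (hd.const_mul κ)).mul_const (2 * L))
    simpa using this

end Disc

/-- Configurations far from the set of minimizers have a quadratic energy excess. -/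
theorem exists_energy_gap {F m : ℝ → ℝ} (d : ℕ) (hF : IsStdPotential F) (hm : IsProfile F m) :
    ∃ c δ₀ : ℝ, 0 < c ∧ 0 < δ₀ ∧ ∀ (n : ℕ) (L a : ℝ) (D : Disc d L a) (g : gridSet d L a → ℝ)
      (δ : ℝ), 0 < n → a = 1 / n → a ≤ L → 0 < δ → δ < δ₀ →
      ENNReal.ofReal δ < eDistM d m (discFun d L a D g) →
      Cstar F + c * δ ^ 2 ≤ fullEnergy d L F (discFun d L a D g) := by
  obtain ⟨C, e₀, hC, he₀, H⟩ := exists_strip_bound d hF hm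
  refine ⟨1 / C, Real.sqrt (C * e₀), by positivity, by positivity, ?_⟩
  intro n L a D g δ hn han haL hδ hδ₀ hdist
  by_contra hlt
  push Not at hlt
  have ha := IsPLGrid.pos_mesh hn han
  have hδ2 : δ ^ 2 < C * e₀ := (Real.lt_sqrt hδ.le).1 hδ₀
  obtain ⟨B, hB1, hB⟩ := D.exists_bound g
  obtain ⟨h', K, hl, heq⟩ := (D.discFun_pl g).exists_extension hn han
    (D.abs_discFun_latPt_le haL hB1 hB)
  obtain ⟨ξ, hξ⟩ := H h' K L (1 / C * δ ^ 2) hl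
    (fun z hz h0 => by rw [← heq z hz]; exact D.discFun_right g h0)
    (fun z hz h0 => by rw [← heq z hz]; exact D.discFun_left g h0) (by positivity)
    (by rw [one_div, inv_mul_lt_iff₀ hC]; exact hδ2)
    (by rw [← fullEnergy_congr heq]; exact hlt.le)
  refine absurd hdist (not_lt.2 ((iInf_le _ ξ).trans ?_))
  rw [eL2]
  have h1 : ∫⁻ z in domD d, ENNReal.ofReal ((discFun d L a D g z - m (z 0 - ξ)) ^ 2) ≤
      ENNReal.ofReal (δ ^ 2) := by
    rw [setLIntegral_congr_fun (isOpen_domD d).measurableSet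
      (g := fun z => ENNReal.ofReal ((h' z - m (z 0 - ξ)) ^ 2)) fun z hz => by simp only [heq z hz]]
    refine hξ.trans (ENNReal.ofReal_le_ofReal (le_of_eq ?_))
    field_simp
  calc _ ≤ ENNReal.ofReal (δ ^ 2) ^ (1/2 : ℝ) := ENNReal.rpow_le_rpow h1 (by norm_num)
    _ = ENNReal.ofReal δ := by
      rw [ENNReal.ofReal_rpow_of_nonneg (by positivity) (by norm_num), ← Real.sqrt_eq_rpow,
        Real.sqrt_sq hδ.le]

/-! ### Coercivity of the discretized energy -/

theorem LipschitzWith.abs_le_energy1 {K : NNReal} {F f : ℝ → ℝ} (hF : IsStdPotential F)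
    (hf : LipschitzWith K f) {L x : ℝ} (hL : 0 < L) (hfL : f (-L) = -1)
    (hx : x ∈ Set.Icc (-L) L) : |f x| ≤ 2 + L * energy1 F f (-L) L := by
  set G : ℝ → ℝ := fun t => L * (1/2 * (deriv f t) ^ 2 + F (f t)) + 1 / (2 * L) with hG
  have hGi : ∀ s t, IntervalIntegrable G volume s t := fun s t =>
    ((hf.intervalIntegrable_energy hF.continuous s t).const_mul L).add intervalIntegrable_const
  have hG0 : ∀ t, 0 ≤ G t := fun t => by
    have := hF.nonneg (f t)
    simp only [hG]; positivity
  have hle : ∀ t, ‖deriv f t‖ ≤ G t := fun t => by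
    have h1 := mul_nonneg hL.le (hF.nonneg (f t))
    have h2 : |deriv f t| ≤ L * (1/2 * (deriv f t) ^ 2) + 1 / (2 * L) := by
      have : L * (1/2 * (deriv f t) ^ 2) + 1 / (2 * L) - |deriv f t| =
          (L * |deriv f t| - 1) ^ 2 / (2 * L) := by
        rw [← sq_abs (deriv f t)]; field_simp; ring
      have h3 : 0 ≤ (L * |deriv f t| - 1) ^ 2 / (2 * L) := by positivity
      linarith
    rw [Real.norm_eq_abs]; simp only [hG]; linarith
  have hint : ∫ t in (-L)..L, G t = L * energy1 F f (-L) L + 1 := by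
    simp only [hG]
    rw [intervalIntegral.integral_add
      ((hf.intervalIntegrable_energy hF.continuous _ _).const_mul L) intervalIntegrable_const,
      intervalIntegral.integral_const_mul, intervalIntegral.integral_const, energy1, smul_eq_mul]
    congr 1
    field_simp; ring
  have hftc : ∫ t in (-L)..x, deriv f t = f x - f (-L) := by
    have := hf.integral_comp_mul_deriv (Φ := id) (w := fun _ => 1) hasDerivAt_id
      continuous_const (-L) x
    simpa using this
  have h1 := intervalIntegral.norm_integral_le_of_norm_le hx.1
    (ae_of_all _ fun t _ => hle t) (hGi (-L) x)
  have h2 : ∫ t in (-L)..x, G t ≤ ∫ t in (-L)..L, G t :=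
    intervalIntegral.integral_mono_interval le_rfl hx.1 hx.2 (ae_of_all _ hG0) (hGi _ _)
  rw [hftc, hfL, Real.norm_eq_abs] at h1
  have h3 : |f x| ≤ |f x - -1| + 1 := by
    calc |f x| = |(f x - -1) + -1| := by ring_nf
      _ ≤ |f x - -1| + |(-1 : ℝ)| := abs_add_le _ _
      _ = _ := by simp
  linarith

/-- The energy controls the `L¹` norm. -/
theorem lintegral_abs_le {d : ℕ} {K : NNReal} {F : ℝ → ℝ} {h : Eucl d → ℝ} {L : ℝ}
    (hF : IsStdPotential F) (hh : LipschitzWith K h) (hL : 0 < L)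
    (hl : ∀ z ∈ domD d, z 0 ≤ -L → h z = -1) :
    ∫⁻ z in domDL d L, ENNReal.ofReal |h z| ≤
      ENNReal.ofReal (2 * L * (2 + L * fullEnergy d L F h)) := by
  set k : (Fin (d + 1) → ℝ) → ℝ := fun w => h (WithLp.toLp 2 w) with hk
  obtain ⟨K', hkl⟩ : ∃ K', LipschitzWith K' k :=
    ⟨_, hh.comp (PiLp.lipschitzWith_toLp 2 fun _ : Fin (d + 1) => ℝ)⟩
  have hyD : ∀ y ∈ cube d, ∀ x : ℝ, (WithLp.toLp 2 (Fin.cons x y) : Eucl d) ∈ domD d :=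
    fun y hy x i => by simpa using! hy i
  have hE : ∫⁻ y in cube d, fiberEnergy F k L y ≤ ENNReal.ofReal (fullEnergy d L F h) :=
    le_self_add.trans (fiberEnergy_add_le hF hh hkl)
  have hpt : ∀ y ∈ cube d, ∫⁻ x in Set.Ioo (-L) L, ENNReal.ofReal |k (Fin.cons x y)| ≤
      ENNReal.ofReal (2 * L) * (2 + ENNReal.ofReal L * fiberEnergy F k L y) := by
    intro y hy
    have hf := hkl.comp_finCons_left y
    have hfL : k (Fin.cons (-L) y) = -1 := hl _ (hyD y hy _) (by simp)
    have he0 : 0 ≤ energy1 F (fun x => k (Fin.cons x y)) (-L) L :=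
      intervalIntegral.integral_nonneg (by linarith) fun x _ =>
        add_nonneg (by positivity) (hF.nonneg _)
    rw [fiberEnergy_eq hF hkl hL.le]
    calc _ ≤ ∫⁻ _x in Set.Ioo (-L) L, ENNReal.ofReal
          (2 + L * energy1 F (fun x => k (Fin.cons x y)) (-L) L) :=
          setLIntegral_mono' measurableSet_Ioo fun x hx => ENNReal.ofReal_le_ofReal
            (hf.abs_le_energy1 hF hL hfL ⟨hx.1.le, hx.2.le⟩)
      _ = _ := by
          rw [lintegral_const, Measure.restrict_apply_univ, Real.volume_Ioo, mul_comm,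
            ENNReal.ofReal_add two_pos.le (by positivity), ENNReal.ofReal_mul hL.le,
            ENNReal.ofReal_ofNat]
          congr 2; ring
  have habs : Measurable fun z : Eucl d => ENNReal.ofReal |h z| :=
    hh.continuous.abs.measurable.ennreal_ofReal
  have hE0 := Disc.fullEnergy_nonneg (L := L) hF h
  rw [domDL_eq, lintegral_strip measurableSet_Ioo habs]
  calc _ ≤ ∫⁻ y in cube d, ENNReal.ofReal (2 * L) * (2 + ENNReal.ofReal L * fiberEnergy F k L y) :=
        setLIntegral_mono' (measurableSet_cube d) hpt
    _ = ENNReal.ofReal (2 * L) *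
        (2 + ENNReal.ofReal L * ∫⁻ y in cube d, fiberEnergy F k L y) := by
        rw [lintegral_const_mul' _ _ ENNReal.ofReal_ne_top, lintegral_add_left measurable_const,
          lintegral_const, Measure.restrict_apply_univ, volume_cube, mul_one,
          lintegral_const_mul' _ _ ENNReal.ofReal_ne_top]
    _ ≤ ENNReal.ofReal (2 * L) * (2 + ENNReal.ofReal L * ENNReal.ofReal (fullEnergy d L F h)) := by
        gcongr
    _ = _ := by
        rw [ENNReal.ofReal_mul (p := 2 * L) (by positivity),
          ENNReal.ofReal_add two_pos.le (by positivity), ENNReal.ofReal_mul hL.le,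
          ENNReal.ofReal_ofNat]

theorem volume_box {d : ℕ} (c : Fin (d + 1) → ℝ) {ρ : ℝ} (hρ : 0 ≤ ρ) :
    volume {z : Eucl d | ∀ i, z i ∈ Set.Ioo (c i) (c i + ρ)} = ENNReal.ofReal (ρ ^ (d + 1)) := by
  have hset : MeasurableSet (Set.univ.pi fun i => Set.Ioo (c i) (c i + ρ)) :=
    MeasurableSet.univ_pi fun i => measurableSet_Ioo
  have := (PiLp.volume_preserving_ofLp (Fin (d + 1))).measure_preimage hset.nullMeasurableSet
  rw [Real.volume_pi_Ioo] at this
  simp only [add_sub_cancel_left, Finset.prod_const, Finset.card_univ, Fintype.card_fin] at this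
  rw [ENNReal.ofReal_pow hρ, ← this]
  congr 1
  ext z
  simp

theorem measurableSet_box {d : ℕ} (c : Fin (d + 1) → ℝ) (ρ : ℝ) :
    MeasurableSet {z : Eucl d | ∀ i, z i ∈ Set.Ioo (c i) (c i + ρ)} := by
  have : {z : Eucl d | ∀ i, z i ∈ Set.Ioo (c i) (c i + ρ)} =
      ⋂ i, {z : Eucl d | z i ∈ Set.Ioo (c i) (c i + ρ)} := by ext z; simp
  rw [this]
  exact MeasurableSet.iInter fun i => (by fun_prop : Measurable fun w : Eucl d => w i)
    measurableSet_Ioo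

/-- The constant in the coercivity estimate of the discretized energy. -/
def coerConst (d : ℕ) (L a : ℝ) : ℝ := 4 * L ^ 2 / (a / (4 * (d + 1))) ^ (d + 1)

theorem one_le_coerConst {d : ℕ} {L a : ℝ} (ha : 0 < a) (ha1 : a ≤ 1) (hL : 1 ≤ L) :
    1 ≤ coerConst d L a := by
  rw [coerConst, one_le_div (by positivity)]
  have h1 : a / (4 * (d + 1)) ≤ 1 := by
    rw [div_le_one (by positivity)]
    have : (0:ℝ) ≤ d := Nat.cast_nonneg d
    linarith
  have h2 := pow_le_one₀ (n := d + 1) (by positivity : 0 ≤ a / (4 * (d + 1))) h1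
  nlinarith

/-- The energy controls the grid values. -/
theorem Disc.abs_le_energy {d n : ℕ} {L a : ℝ} (D : Disc d L a) (hn : 0 < n) (han : a = 1 / n)
    (hL : 1 ≤ L) {F : ℝ → ℝ} (hF : IsStdPotential F) (g : gridSet d L a → ℝ)
    (z : gridSet d L a) :
    |g z| ≤ coerConst d L a * (fullEnergy d L F (discFun d L a D g) + 2) := by
  have ha := IsPLGrid.pos_mesh hn han
  have ha1 : a ≤ 1 := by
    rw [han, div_le_one (by exact_mod_cast hn)]; exact_mod_cast hn
  have haL : a ≤ L := ha1.trans hL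
  have hs := one_le_coerConst (d := d) ha ha1 hL
  have hE0 := fullEnergy_nonneg (L := L) hF (discFun d L a D g)
  set E := fullEnergy d L F (discFun d L a D g) with hE
  let := D.gridFin
  have : Nonempty (gridSet d L a) := ⟨z⟩
  obtain ⟨zs, hzs⟩ := Finite.exists_max fun z => |g z|
  refine (hzs z).trans ?_
  set M := |g zs| with hM
  rcases le_or_gt M 1 with hM1 | hM1
  · nlinarith
  have hb := D.abs_discFun_latPt_le haL hM1.le hzs
  have hpl := D.discFun_pl g
  obtain ⟨h', K, hl, heq⟩ := hpl.exists_extension hn han hb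
  have hL1 := lintegral_abs_le hF hl (by linarith : 0 < L)
    (fun z hz h0 => by rw [← heq z hz]; exact D.discFun_left g h0)
  rw [← fullEnergy_congr heq, ← hE] at hL1
  set ρ := a / (4 * (d + 1)) with hρ
  have hd0 : (0:ℝ) ≤ d := Nat.cast_nonneg d
  have hρ0 : 0 < ρ := by positivity
  have hρa : ρ ≤ a / 4 := by
    rw [hρ]; gcongr; linarith
  obtain ⟨hlat, hz0, hzi⟩ := zs.2
  set c : Fin (d + 1) → ℝ := Fin.cons (zs.1 0)
    fun i : Fin d => if zs.1 i.succ ≤ 1/2 then zs.1 i.succ else zs.1 i.succ - ρ with hc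
  set Q := {w : Eucl d | ∀ i, w i ∈ Set.Ioo (c i) (c i + ρ)} with hQ
  have hclose : ∀ w ∈ Q, ∀ i, |w i - zs.1 i| ≤ ρ := by
    intro w hw i
    refine Fin.cases ?_ (fun j => ?_) i
    · have := hw 0
      simp only [hc, Fin.cons_zero, Set.mem_Ioo] at this
      rw [_root_.abs_le]; constructor <;> linarith [this.1, this.2]
    · have := hw j.succ
      simp only [hc, Fin.cons_succ, Set.mem_Ioo] at this
      rw [_root_.abs_le]
      split_ifs at this <;> constructor <;> linarith [this.1, this.2]
  have hQD : Q ⊆ domDL d L := by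
    intro w hw
    refine ⟨?_, fun j => ?_⟩
    · have h1 := hclose w hw 0
      calc |w 0| = |(w 0 - zs.1 0) + zs.1 0| := by ring_nf
        _ ≤ ρ + (L - a) := (abs_add_le _ _).trans (add_le_add h1 hz0)
        _ < L := by linarith
    · have := hw j.succ
      have hj := hzi j
      simp only [hc, Fin.cons_succ, Set.mem_Ioo] at this
      split_ifs at this with hif
      · exact ⟨by linarith [hj.1, this.1], by linarith [this.2]⟩
      · exact ⟨by linarith [this.1], by linarith [hj.2, this.2]⟩
  have hlow : ∀ w ∈ Q, M / 2 ≤ |h' w| := by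
    intro w hw
    have hwD := domDL_subset_domD d L (hQD hw)
    rw [← heq w hwD]
    have h1 := hpl.abs_sub_le hn han hb (domD_subset_closedStrip d hwD) hzi
    rw [D.discFun_grid g zs.2] at h1
    have h2 : ∑ i, |w i - zs.1 i| ≤ (d + 1) * ρ := by
      calc _ ≤ ∑ _i : Fin (d + 1), ρ := Finset.sum_le_sum fun i _ => hclose w hw i
        _ = _ := by simp
    have h3 : 2 * M / a * ∑ i, |w i - zs.1 i| ≤ M / 2 := by
      calc _ ≤ 2 * M / a * ((d + 1) * ρ) := by gcongr
        _ = M / 2 := by rw [hρ]; field_simp; ring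
    have h4 : M ≤ |discFun d L a D g w| + |discFun d L a D g w - g zs| := by
      calc M = |discFun d L a D g w - (discFun d L a D g w - g zs)| := by rw [hM]; ring_nf
        _ ≤ _ := abs_sub _ _
    have h5 : |discFun d L a D g w - g zs| ≤ M / 2 := h1.trans h3
    linarith
  have h1 : ENNReal.ofReal (M / 2 * ρ ^ (d + 1)) ≤ ENNReal.ofReal (2 * L * (2 + L * E)) := by
    rw [ENNReal.ofReal_mul (by positivity), ← volume_box c hρ0.le]
    calc _ = ∫⁻ _w in Q, ENNReal.ofReal (M / 2) := by
          rw [lintegral_const, Measure.restrict_apply_univ]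
      _ ≤ ∫⁻ w in Q, ENNReal.ofReal |h' w| :=
          setLIntegral_mono' (measurableSet_box c ρ) fun w hw =>
            ENNReal.ofReal_le_ofReal (hlow w hw)
      _ ≤ ∫⁻ w in domDL d L, ENNReal.ofReal |h' w| := lintegral_mono_set hQD
      _ ≤ _ := hL1
  rw [ENNReal.ofReal_le_ofReal_iff (by positivity)] at h1
  have hρd : 0 < ρ ^ (d + 1) := by positivity
  rw [coerConst, ← hρ, div_mul_eq_mul_div, le_div_iff₀ hρd]
  nlinarith [mul_nonneg (by linarith : 0 ≤ L - 1) (by linarith : (0:ℝ) ≤ L)]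

/-! ### Estimates for finite-dimensional Gibbs measures -/

theorem integrable_exp_neg_mul_abs {b : ℝ} (hb : 0 < b) :
    Integrable fun x : ℝ => Real.exp (-b * |x|) := by
  rw [← integrableOn_univ, ← Set.Iic_union_Ioi (a := (0:ℝ))]
  refine IntegrableOn.union ?_ ?_
  · refine (integrableOn_exp_mul_Iic hb 0).congr_fun (fun x hx => ?_) measurableSet_Iic
    simp only [abs_of_nonpos (show x ≤ 0 from hx)]; ring_nf
  · refine (integrableOn_exp_mul_Ioi (neg_lt_zero.2 hb) 0).congr_fun (fun x hx => ?_)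
      measurableSet_Ioi
    simp only [abs_of_pos (show 0 < x from hx)]

theorem integral_exp_neg_mul_abs {b : ℝ} (hb : 0 < b) :
    ∫ x : ℝ, Real.exp (-b * |x|) = 2 / b := by
  rw [integral_comp_abs (f := fun x => Real.exp (-b * x)), integral_exp_mul_Ioi (neg_lt_zero.2 hb)]
  simp
  field_simp

section Finite

variable {ι : Type*} [Fintype ι] {E : (ι → ℝ) → ℝ} {s β : ℝ}

theorem exp_neg_le_prod (hE0 : ∀ g, 0 ≤ E g) (hs : 0 < s)
    (hE : ∀ g i, |g i| ≤ s * (E g + 2)) (hβ : 0 < β) (g : ι → ℝ) :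
    Real.exp (-β * E g) ≤
      Real.exp (2 * β) * ∏ i, Real.exp (-(β / (Fintype.card ι * s)) * |g i|) := by
  rw [← Real.exp_sum, ← Real.exp_add, Real.exp_le_exp]
  rcases isEmpty_or_nonempty ι with h | h
  · have := mul_nonneg hβ.le (hE0 g)
    simp only [Finset.univ_eq_empty, Finset.sum_empty]
    linarith
  · have hN : (0:ℝ) < Fintype.card ι := by exact_mod_cast Fintype.card_pos
    have h1 : ∑ i, |g i| ≤ Fintype.card ι * (s * (E g + 2)) := by
      have := Finset.sum_le_card_nsmul Finset.univ (fun i => |g i|) _ fun i _ => hE g i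
      simpa using this
    rw [← Finset.mul_sum]
    have h2 : β / (Fintype.card ι * s) * ∑ i, |g i| ≤ β * (E g + 2) := by
      rw [div_mul_eq_mul_div, div_le_iff₀ (by positivity)]
      nlinarith
    linarith

theorem integrable_exp_neg_energy (hEc : Continuous E) (hE0 : ∀ g, 0 ≤ E g) (hs : 0 < s)
    (hE : ∀ g i, |g i| ≤ s * (E g + 2)) (hβ : 0 < β) :
    Integrable (fun g => Real.exp (-β * E g)) (Measure.pi fun _ : ι => (volume : Measure ℝ)) ∧
    ∫ g, Real.exp (-β * E g) ∂(Measure.pi fun _ : ι => (volume : Measure ℝ)) ≤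
      Real.exp (2 * β) * (2 * Fintype.card ι * s / β) ^ Fintype.card ι := by
  have hb : ∀ _ : ι, 0 < β / (Fintype.card ι * s) := fun i => by
    have : (0:ℝ) < Fintype.card ι := by exact_mod_cast Fintype.card_pos_iff.2 ⟨i⟩
    positivity
  have hint : Integrable (fun g : ι → ℝ => Real.exp (2 * β) *
      ∏ i, Real.exp (-(β / (Fintype.card ι * s)) * |g i|))
      (Measure.pi fun _ : ι => (volume : Measure ℝ)) :=
    (Integrable.fintype_prod (f := fun _ : ι => fun x : ℝ =>
      Real.exp (-(β / (Fintype.card ι * s)) * |x|))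
      fun i => integrable_exp_neg_mul_abs (hb i)).const_mul _
  have hi : Integrable (fun g => Real.exp (-β * E g))
      (Measure.pi fun _ : ι => (volume : Measure ℝ)) := by
    refine hint.mono' (Continuous.aestronglyMeasurable (by fun_prop)) (ae_of_all _ fun g => ?_)
    rw [Real.norm_eq_abs, abs_of_pos (Real.exp_pos _)]
    exact exp_neg_le_prod hE0 hs hE hβ g
  refine ⟨hi, (integral_mono hi hint fun g => exp_neg_le_prod hE0 hs hE hβ g).trans ?_⟩
  rw [integral_const_mul]
  rw [integral_fintype_prod_eq_pow (fun x : ℝ => Real.exp (-(β / (Fintype.card ι * s)) * |x|))]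
  rcases isEmpty_or_nonempty ι with h | ⟨⟨i⟩⟩
  · simp
  · rw [integral_exp_neg_mul_abs (hb i)]
    refine le_of_eq ?_
    congr 2
    have : (Fintype.card ι : ℝ) ≠ 0 := by
      exact_mod_cast (Fintype.card_pos_iff.2 ⟨i⟩).ne'
    field_simp

theorem pi_closedBall_eq (g₀ : ι → ℝ) {r : ℝ} (hr : 0 ≤ r) :
    (Measure.pi fun _ : ι => (volume : Measure ℝ)) (Metric.closedBall g₀ r) =
      ENNReal.ofReal ((2 * r) ^ Fintype.card ι) := Real.volume_pi_closedBall g₀ hr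

theorem le_integral_exp_neg_energy (hi : Integrable (fun g => Real.exp (-β * E g))
      (Measure.pi fun _ : ι => (volume : Measure ℝ))) (hβ : 0 < β) {g₀ : ι → ℝ} {r A : ℝ}
    (hr : 0 ≤ r) (hA : ∀ g ∈ Metric.closedBall g₀ r, E g ≤ A) :
    (2 * r) ^ Fintype.card ι * Real.exp (-β * A) ≤
      ∫ g, Real.exp (-β * E g) ∂(Measure.pi fun _ : ι => (volume : Measure ℝ)) := by
  have hv := pi_closedBall_eq g₀ hr
  calc (2 * r) ^ Fintype.card ι * Real.exp (-β * A)
      = ∫ _g in Metric.closedBall g₀ r, Real.exp (-β * A)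
          ∂(Measure.pi fun _ : ι => (volume : Measure ℝ)) := by
        rw [setIntegral_const, measureReal_def, hv, ENNReal.toReal_ofReal (by positivity),
          smul_eq_mul]
    _ ≤ ∫ g in Metric.closedBall g₀ r, Real.exp (-β * E g)
          ∂(Measure.pi fun _ : ι => (volume : Measure ℝ)) := by
        refine setIntegral_mono_on ?_ hi.integrableOn Metric.isClosed_closedBall.measurableSet ?_
        · exact integrableOn_const (by rw [hv]; exact ENNReal.ofReal_ne_top)
        · intro g hg
          rw [Real.exp_le_exp]
          nlinarith [hA g hg]
    _ ≤ _ := setIntegral_le_integral hi (ae_of_all _ fun g => (Real.exp_pos _).le)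

end Finite

section Finite

variable {ι : Type*} [Fintype ι] {E : (ι → ℝ) → ℝ} {s ε : ℝ}

/-- Logarithmic upper bound for the Gibbs measure of a set of high energy. -/
theorem measure_le_of_energy_ge (hEc : Continuous E) (hE0 : ∀ g, 0 ≤ E g) (hs : 0 < s)
    (hE : ∀ g i, |g i| ≤ s * (E g + 2)) (hε : 0 < ε) {γ A A₀ r : ℝ} (hγ : 0 < γ) (hγ1 : γ ≤ 1)
    (hr : 0 < r) {g₀ : ι → ℝ} (hA₀ : ∀ g ∈ Metric.closedBall g₀ r, E g ≤ A₀)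
    {S : Set (ι → ℝ)} (hS : ∀ g ∈ S, A ≤ E g) :
    ((Measure.pi fun _ : ι => (volume : Measure ℝ)).withDensity fun g =>
      ENNReal.ofReal (Real.exp (-(1/ε) * E g) /
        ∫ g, Real.exp (-(1/ε) * E g) ∂(Measure.pi fun _ : ι => (volume : Measure ℝ)))) S ≤
    ENNReal.ofReal (Real.exp (-((1 - γ) / ε) * A) * (Real.exp (2 * (γ / ε)) *
      (2 * Fintype.card ι * s / (γ / ε)) ^ Fintype.card ι) /
      ((2 * r) ^ Fintype.card ι * Real.exp (-(1/ε) * A₀))) := by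
  set P : Measure (ι → ℝ) := Measure.pi fun _ : ι => (volume : Measure ℝ) with hP
  have hε1 : 0 < 1 / ε := by positivity
  obtain ⟨hi, -⟩ := integrable_exp_neg_energy hEc hE0 hs hE hε1
  obtain ⟨hi', hi2⟩ := integrable_exp_neg_energy hEc hE0 hs hE (div_pos hγ hε)
  have hZ := le_integral_exp_neg_energy hi hε1 hr.le hA₀
  set Z := ∫ g, Real.exp (-(1/ε) * E g) ∂P with hZdef
  have hZ0 : 0 < (2 * r) ^ Fintype.card ι * Real.exp (-(1/ε) * A₀) := by positivity
  have hZ1 : 0 < Z := hZ0.trans_le hZ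
  rw [withDensity_apply']
  calc ∫⁻ g in S, ENNReal.ofReal (Real.exp (-(1/ε) * E g) / Z) ∂P
      ≤ ∫⁻ g in S, ENNReal.ofReal
          (Real.exp (-((1 - γ) / ε) * A) * Real.exp (-(γ / ε) * E g) / Z) ∂P := by
        refine setLIntegral_mono (Measurable.ennreal_ofReal ?_) fun g hg => ?_
        · exact Continuous.measurable (by fun_prop)
        · refine ENNReal.ofReal_le_ofReal ?_
          gcongr
          rw [← Real.exp_add, Real.exp_le_exp]
          have h1 : 0 ≤ (1 - γ) / ε := div_nonneg (by linarith) hε.le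
          have h2 := mul_le_mul_of_nonneg_left (hS g hg) h1
          have h3 : 1 / ε = (1 - γ) / ε + γ / ε := by rw [← add_div]; ring
          rw [h3]; linarith
    _ ≤ ∫⁻ g, ENNReal.ofReal
          (Real.exp (-((1 - γ) / ε) * A) * Real.exp (-(γ / ε) * E g) / Z) ∂P :=
        setLIntegral_le_lintegral _ _
    _ = ENNReal.ofReal (∫ g, Real.exp (-((1 - γ) / ε) * A) * Real.exp (-(γ / ε) * E g) / Z ∂P) :=
        (ofReal_integral_eq_lintegral_ofReal ((hi'.const_mul _).div_const _)
          (ae_of_all _ fun g => by positivity)).symm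
    _ ≤ _ := by
        refine ENNReal.ofReal_le_ofReal ?_
        rw [integral_div, integral_const_mul]
        gcongr

/-- Logarithmic lower bound for the Gibbs measure of a set containing a box. -/
theorem le_measure_of_energy_le (hEc : Continuous E) (hE0 : ∀ g, 0 ≤ E g) (hs : 0 < s)
    (hE : ∀ g i, |g i| ≤ s * (E g + 2)) (hε : 0 < ε) {A₁ r : ℝ}
    (hr : 0 < r) {g₁ : ι → ℝ} (hA₁ : ∀ g ∈ Metric.closedBall g₁ r, E g ≤ A₁)
    {S : Set (ι → ℝ)} (hS : Metric.closedBall g₁ r ⊆ S) :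
    ENNReal.ofReal ((2 * r) ^ Fintype.card ι * (Real.exp (-(1/ε) * A₁) /
      (Real.exp (2 * (1 / ε)) * (2 * Fintype.card ι * s / (1 / ε)) ^ Fintype.card ι))) ≤
    ((Measure.pi fun _ : ι => (volume : Measure ℝ)).withDensity fun g =>
      ENNReal.ofReal (Real.exp (-(1/ε) * E g) /
        ∫ g, Real.exp (-(1/ε) * E g) ∂(Measure.pi fun _ : ι => (volume : Measure ℝ)))) S := by
  set P : Measure (ι → ℝ) := Measure.pi fun _ : ι => (volume : Measure ℝ) with hP
  have hε1 : 0 < 1 / ε := by positivity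
  obtain ⟨hi, hi2⟩ := integrable_exp_neg_energy hEc hE0 hs hE hε1
  have hZ := le_integral_exp_neg_energy hi hε1 hr.le hA₁
  set Z := ∫ g, Real.exp (-(1/ε) * E g) ∂P with hZdef
  have hZ0 : 0 < (2 * r) ^ Fintype.card ι * Real.exp (-(1/ε) * A₁) := by positivity
  have hZ1 : 0 < Z := hZ0.trans_le hZ
  refine le_trans ?_ (measure_mono hS)
  rw [withDensity_apply']
  calc _ ≤ ENNReal.ofReal ((2 * r) ^ Fintype.card ι * (Real.exp (-(1/ε) * A₁) / Z)) := by
        refine ENNReal.ofReal_le_ofReal ?_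
        gcongr
    _ = ∫⁻ _g in Metric.closedBall g₁ r, ENNReal.ofReal (Real.exp (-(1/ε) * A₁) / Z) ∂P := by
        rw [setLIntegral_const, pi_closedBall_eq g₁ hr.le, ENNReal.ofReal_mul (by positivity),
          mul_comm]
    _ ≤ _ := by
        refine setLIntegral_mono' Metric.isClosed_closedBall.measurableSet fun g hg => ?_
        refine ENNReal.ofReal_le_ofReal ?_
        gcongr ?_ / Z
        rw [Real.exp_le_exp]
        nlinarith [hA₁ g hg]

theorem log_measure_bounds (hEc : Continuous E) (hE0 : ∀ g, 0 ≤ E g) (hs : 0 < s)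
    (hE : ∀ g i, |g i| ≤ s * (E g + 2)) (hε : 0 < ε) {γ A A₀ A₁ r : ℝ} (hγ : 0 < γ)
    (hγ1 : γ ≤ 1) (hr : 0 < r) {g₀ g₁ : ι → ℝ} (hA₀ : ∀ g ∈ Metric.closedBall g₀ r, E g ≤ A₀)
    (hA₁ : ∀ g ∈ Metric.closedBall g₁ r, E g ≤ A₁)
    {S : Set (ι → ℝ)} (hS : ∀ g ∈ S, A ≤ E g) (hS₁ : Metric.closedBall g₁ r ⊆ S) :
    ε * Real.log (((Measure.pi fun _ : ι => (volume : Measure ℝ)).withDensity fun g =>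
      ENNReal.ofReal (Real.exp (-(1/ε) * E g) /
        ∫ g, Real.exp (-(1/ε) * E g) ∂(Measure.pi fun _ : ι => (volume : Measure ℝ)))) S).toReal ∈
    Set.Icc
      (-A₁ - 2 + ε * Fintype.card ι *
        (Real.log (2 * r) - Real.log (2 * Fintype.card ι * s * ε)))
      (-A + (A₀ + γ * (A + 2)) + ε * Fintype.card ι *
        (Real.log (2 * Fintype.card ι * s * ε / γ) - Real.log (2 * r))) := by
  have hup := measure_le_of_energy_ge hEc hE0 hs hE hε hγ hγ1 hr hA₀ hS
  have hlo := le_measure_of_energy_le hEc hE0 hs hE hε hr hA₁ hS₁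
  set μ := ((Measure.pi fun _ : ι => (volume : Measure ℝ)).withDensity fun g =>
      ENNReal.ofReal (Real.exp (-(1/ε) * E g) /
        ∫ g, Real.exp (-(1/ε) * E g) ∂(Measure.pi fun _ : ι => (volume : Measure ℝ)))) S
  have hpow : ∀ x : ℝ, 0 < x → 0 < (2 * Fintype.card ι * s / x) ^ Fintype.card ι := fun x hx => by
    rcases isEmpty_or_nonempty ι with h | h
    · simp
    · have : (0:ℝ) < Fintype.card ι := by exact_mod_cast Fintype.card_pos
      positivity
  have hp1 := hpow (1 / ε) (by positivity)
  have hpγ := hpow (γ / ε) (by positivity)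
  have hμ : μ ≠ ⊤ := ne_top_of_le_ne_top ENNReal.ofReal_ne_top hup
  have hup' := ENNReal.toReal_le_of_le_ofReal (by positivity) hup
  have hlo' := (ENNReal.ofReal_le_iff_le_toReal hμ).1 hlo
  have hμ0 : 0 < μ.toReal := lt_of_lt_of_le (by positivity) hlo'
  constructor
  · have h := mul_le_mul_of_nonneg_left (Real.log_le_log (by positivity) hlo') hε.le
    refine le_trans (le_of_eq ?_) h
    rw [Real.log_mul (pow_pos (mul_pos two_pos hr) _).ne' (by positivity),
      Real.log_div (by positivity) (by positivity), Real.log_mul (by positivity) hp1.ne',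
          Real.log_exp, Real.log_exp, Real.log_pow, Real.log_pow,
      div_div_eq_mul_div, div_one]
    field_simp
    ring
  · have h := mul_le_mul_of_nonneg_left (Real.log_le_log hμ0 hup') hε.le
    refine h.trans (le_of_eq ?_)
    rw [Real.log_div (by positivity) (by positivity),
      Real.log_mul (Real.exp_pos _).ne' (by positivity), Real.log_mul (by positivity) hpγ.ne',
      Real.log_mul (pow_pos (mul_pos two_pos hr) _).ne' (Real.exp_pos _).ne',
      Real.log_exp, Real.log_exp, Real.log_exp, Real.log_pow, Real.log_pow, div_div_eq_mul_div]
    field_simp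
    ring

end Finite

/-! ### The number of grid points -/

theorem gridCard_le {d n : ℕ} {L a : ℝ} (D : Disc d L a) (hn : 0 < n) (han : a = 1 / n)
    (haL : a ≤ L) : (gridCard d L a D : ℝ) ≤ 3 * 2 ^ d * (L / a ^ (d + 1)) := by
  let := D.gridFin
  have ha := IsPLGrid.pos_mesh hn han
  have hn1 : (1:ℝ) ≤ n := by exact_mod_cast hn
  have hna : (n : ℝ) = 1 / a := by rw [han]; field_simp
  choose k hk using fun z : gridSet d L a => z.2.1
  have h0 : ∀ z, k z 0 ∈ Finset.Icc (-⌊L / a⌋) ⌊L / a⌋ := fun z => by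
    have h1 : |a * (k z 0 : ℝ)| ≤ L := by rw [← hk]; linarith [z.2.2.1]
    rw [abs_mul, abs_of_pos ha, ← le_div_iff₀' ha, abs_le] at h1
    rw [Finset.mem_Icc, neg_le, Int.le_floor, Int.le_floor]
    push_cast
    exact ⟨by linarith, h1.2⟩
  have h1 : ∀ z, ∀ i : Fin d, k z i.succ ∈ Finset.Icc (0:ℤ) n := fun z i => by
    have h := z.2.2.2 i
    rw [hk] at h
    have hl : (0:ℝ) ≤ k z i.succ := by
      by_contra hneg
      push Not at hneg
      linarith [mul_neg_of_pos_of_neg ha hneg, h.1]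
    have hr : (k z i.succ : ℝ) ≤ n := by rw [hna, le_div_iff₀ ha]; linarith [h.2]
    rw [Finset.mem_Icc]
    exact ⟨by exact_mod_cast hl, by exact_mod_cast hr⟩
  let f : gridSet d L a → (Finset.Icc (-⌊L / a⌋) ⌊L / a⌋) × (Fin d → Finset.Icc (0:ℤ) n) :=
    fun z => (⟨k z 0, h0 z⟩, fun i => ⟨k z i.succ, h1 z i⟩)
  have hf : Function.Injective f := fun z w hzw => by
    simp only [f, Prod.mk.injEq, Subtype.mk.injEq, funext_iff] at hzw
    refine Subtype.ext (PiLp.ext fun i => ?_)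
    rw [hk, hk]
    refine Fin.cases ?_ (fun j => ?_) i
    · rw [hzw.1]
    · rw [hzw.2 j]
  have hcard := Fintype.card_le_of_injective f hf
  have hfl : 0 ≤ ⌊L / a⌋ := Int.floor_nonneg.2 (div_nonneg (ha.le.trans haL) ha.le)
  have hc : ((Fintype.card (gridSet d L a) : ℕ) : ℝ) ≤ (2 * ⌊L / a⌋ + 1) * (n + 1) ^ d := by
    have : ((Fintype.card (gridSet d L a) : ℕ) : ℤ) ≤ (2 * ⌊L / a⌋ + 1) * (n + 1) ^ d := by
      have h := Int.ofNat_le.2 hcard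
      simp only [Fintype.card_prod, Fintype.card_coe, Int.card_Icc, Fintype.card_pi,
        Finset.prod_const, Finset.card_univ, Fintype.card_fin] at h
      refine h.trans (le_of_eq ?_)
      push_cast
      rw [Int.toNat_of_nonneg (by omega), Int.toNat_of_nonneg (by omega)]
      ring
    exact_mod_cast this
  have hLa : 1 ≤ L / a := (one_le_div ha).2 haL
  calc (gridCard d L a D : ℝ) ≤ (2 * ⌊L / a⌋ + 1) * (n + 1) ^ d := hc
    _ ≤ (3 * (L / a)) * (2 * (1 / a)) ^ d := by
        have := Int.floor_le (L / a)
        have h2 : (0:ℝ) ≤ ⌊L / a⌋ := by exact_mod_cast hfl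
        gcongr
        · linarith
        · rw [← hna]; linarith
    _ = _ := by
        rw [mul_pow, one_div_pow, pow_succ]; field_simp

/-! ### Piecewise linear interpolation of one-dimensional profiles -/

/-- The piecewise linear interpolation of `φ` with mesh `a`. -/
def pint (φ : ℝ → ℝ) (a x : ℝ) : ℝ := ∫ u in (0:ℝ)..1, φ (a * ⌊x / a + u⌋)

theorem abs_floor_sub_le {a : ℝ} (ha : 0 < a) (x : ℝ) {u : ℝ} (hu : u ∈ Set.Icc (0:ℝ) 1) :
    |a * ⌊x / a + u⌋ - x| ≤ a := by
  have h1 := Int.floor_le (x / a + u)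
  have h2 := Int.lt_floor_add_one (x / a + u)
  have hx : x = a * (x / a) := by field_simp
  rw [abs_le]
  constructor
  · have := mul_le_mul_of_nonneg_left (show x / a - 1 ≤ (⌊x / a + u⌋ : ℝ) by linarith [hu.1]) ha.le
    linarith
  · have := mul_le_mul_of_nonneg_left (show (⌊x / a + u⌋ : ℝ) ≤ x / a + 1 by linarith [hu.2]) ha.le
    linarith

theorem intervalIntegrable_comp_floor {φ : ℝ → ℝ} (hφ : Continuous φ) {a : ℝ} (ha : 0 < a)
    (x : ℝ) : IntervalIntegrable (fun u => φ (a * ⌊x / a + u⌋)) volume 0 1 := by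
  obtain ⟨C, hC⟩ := (isCompact_Icc (a := x - a) (b := x + a)).exists_bound_of_continuousOn
    hφ.continuousOn
  refine (intervalIntegrable_const (c := C)).mono_fun' ?_ ?_
  · have : Measurable fun u : ℝ => (⌊x / a + u⌋ : ℝ) := by fun_prop
    exact (hφ.measurable.comp (this.const_mul a)).aestronglyMeasurable
  · refine (ae_restrict_iff' measurableSet_uIoc).2 (ae_of_all _ fun u hu => ?_)
    rw [Set.uIoc_of_le zero_le_one] at hu
    have := abs_le.1 (abs_floor_sub_le ha x ⟨hu.1.le, hu.2⟩)
    exact hC _ ⟨by linarith, by linarith⟩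

theorem abs_pint_sub_le {φ : ℝ → ℝ} (hφ : Continuous φ) {a ρ K x y : ℝ} (ha : 0 < a)
    (hK : ∀ s t, |s - x| ≤ ρ + a → |t - x| ≤ ρ + a → |φ s - φ t| ≤ K * |s - t|)
    (hxy : |y - x| ≤ ρ) : |pint φ a y - pint φ a x| ≤ K * |y - x| := by
  have hρ := (abs_nonneg _).trans hxy
  rw [pint, pint, ← intervalIntegral.integral_sub (intervalIntegrable_comp_floor hφ ha y)
    (intervalIntegrable_comp_floor hφ ha x)]
  have hfi := ((intervalIntegrable_floor_add (y / a) 0 1).sub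
    (intervalIntegrable_floor_add (x / a) 0 1)).abs.const_mul (K * a)
  have h := intervalIntegral.norm_integral_le_of_norm_le (f := fun u =>
    φ (a * ⌊y / a + u⌋) - φ (a * ⌊x / a + u⌋)) zero_le_one (ae_of_all _ fun u hu => ?_) hfi
  · rw [Real.norm_eq_abs, intervalIntegral.integral_const_mul, abs_integral_floor_sub,
      ← sub_div, abs_div, abs_of_pos ha] at h
    refine h.trans (le_of_eq ?_)
    field_simp
  · have h1 := abs_floor_sub_le ha y ⟨hu.1.le, hu.2⟩
    have h2 := abs_floor_sub_le ha x ⟨hu.1.le, hu.2⟩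
    refine (hK _ _ ?_ (h2.trans (by linarith))).trans (le_of_eq ?_)
    · calc |a * ⌊y / a + u⌋ - x| = |(a * ⌊y / a + u⌋ - y) + (y - x)| := by ring_nf
        _ ≤ _ := (abs_add_le _ _).trans (by linarith)
    · rw [← mul_sub, abs_mul, abs_of_pos ha, mul_assoc]

theorem LipschitzWith.abs_sub_le_mul {K : NNReal} {φ : ℝ → ℝ} (hφ : LipschitzWith K φ) (s t : ℝ) :
    |φ s - φ t| ≤ K * |s - t| := by
  simpa [Real.dist_eq] using! hφ.dist_le_mul s t

theorem LipschitzWith.pint {K : NNReal} {φ : ℝ → ℝ} (hφ : LipschitzWith K φ) {a : ℝ}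
    (ha : 0 < a) : LipschitzWith K (pint φ a) :=
  LipschitzWith.of_dist_le_mul fun y x => by
    rw [Real.dist_eq, Real.dist_eq]
    exact abs_pint_sub_le hφ.continuous ha (fun s t _ _ => hφ.abs_sub_le_mul s t) le_rfl

/-- The interpolation inherits bounds from nearby values. -/
theorem abs_pint_sub_const_le {φ : ℝ → ℝ} (hφ : Continuous φ) {a b c x : ℝ} (ha : 0 < a)
    (h : ∀ s, |s - x| ≤ a → |φ s - c| ≤ b) : |pint φ a x - c| ≤ b := by
  have h1 := intervalIntegral.norm_integral_le_of_norm_le_const (a := (0:ℝ)) (b := 1) (C := b)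
    (f := fun u => φ (a * ⌊x / a + u⌋) - c) fun u hu => by
      rw [Set.uIoc_of_le zero_le_one] at hu
      exact h _ (abs_floor_sub_le ha x ⟨hu.1.le, hu.2⟩)
  rw [intervalIntegral.integral_sub (intervalIntegrable_comp_floor hφ ha x)
    intervalIntegrable_const, intervalIntegral.integral_const] at h1
  simpa [_root_.pint] using h1

theorem IsTransition.discFun_eq_pint {φ : ℝ → ℝ} {R : ℝ} (hφ : IsTransition φ R) {d n : ℕ}
    {L a : ℝ} (D : Disc d L a) (hn : 0 < n) (han : a = 1 / n) (hR : R ≤ L - a) {z : Eucl d}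
    (hz : z ∈ closedStrip d) :
    discFun d L a D (fun w => φ (w.1 0)) z = pint φ a (z 0) := by
  have ha := IsPLGrid.pos_mesh hn han
  rw [← (D.discFun_pl _).integral_eq ha z, pint]
  refine intervalIntegral.integral_congr_ae ?_
  filter_upwards [Measure.ae_ne volume (1 : ℝ)] with u hu hu1
  rw [Set.uIoc_of_le zero_le_one] at hu1
  have hq := roundIdx_mem_closedStrip hn han hz ⟨hu1.1.le, lt_of_le_of_ne hu1.2 hu⟩
  have hl := latticePt_latPt a (roundIdx a z u)
  have h0 : latPt a (roundIdx a z u) 0 = a * ⌊z 0 / a + u⌋ := rfl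
  rw [← h0]
  set w := latPt a (roundIdx a z u) with hw
  by_cases hg : w ∈ gridSet d L a
  · rw [D.discFun_grid _ hg]
  · have hlt := lt_abs_of_notMem_gridSet hl hq hg
    have hR0 := hφ.pos
    rcases lt_abs.1 hlt with h | h
    · rw [D.discFun_pos _ hl hg (by linarith), hφ.right _ (by linarith)]
    · rw [D.discFun_neg _ hl hg (by linarith), hφ.left _ (by linarith)]

/-- Energy of a one-dimensional configuration on the strip. -/
theorem fullEnergy_le_of_profile {d : ℕ} {L R : ℝ} {F f Q : ℝ → ℝ} {h : Eucl d → ℝ} {K : NNReal}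
    (hF : IsStdPotential F) (hf : LipschitzWith K f) (hh : ∀ z ∈ domD d, h z = f (z 0))
    (hR : 0 ≤ R) (hQ : Continuous Q)
    (hin : ∀ x, |x| ≤ R → ∃ b, 0 ≤ b ∧ (∀ᶠ y in 𝓝 x, |f y - f x| ≤ b * |y - x|) ∧
      1 / 2 * b ^ 2 + F (f x) ≤ Q x)
    (hr : ∀ x, R ≤ x → f x = 1) (hl : ∀ x, x ≤ -R → f x = -1) :
    fullEnergy d L F h ≤ ∫ x in (-R)..R, Q x := by
  have hfh : LipschitzWith K fun z : Eucl d => f (z 0) := by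
    have := hf.comp (LipschitzWith.of_dist_le_mul (K := 1) fun z w : Eucl d => by
      simpa using PiLp.dist_apply_le z w 0 : LipschitzWith 1 fun z : Eucl d => z 0)
    simpa using! this
  have hQ0 : ∀ x, |x| ≤ R → 0 ≤ Q x := fun x hx => by
    obtain ⟨b, -, -, hb⟩ := hin x hx
    exact le_trans (add_nonneg (by positivity) (hF.nonneg _)) hb
  rw [fullEnergy_congr hh]
  refine (ENNReal.ofReal_le_ofReal_iff (intervalIntegral.integral_nonneg (by linarith)
    fun x hx => hQ0 x (abs_le.2 hx))).1 ?_
  rw [ofReal_fullEnergy hF hfh]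
  have hfd : ∀ (x b : ℝ), 0 ≤ b → (∀ᶠ y in 𝓝 x, |f y - f x| ≤ b * |y - x|) → ∀ z : Eucl d,
      z 0 = x → ‖fderiv ℝ (fun z : Eucl d => f (z 0)) z‖ ≤ b := by
    intro x b hb he z hz
    refine norm_fderiv_le_of_lip' ℝ hb ?_
    have hc : Tendsto (fun w : Eucl d => w 0) (𝓝 z) (𝓝 x) := by
      rw [← hz]
      exact (by fun_prop : Continuous fun w : Eucl d => w 0).tendsto z
    filter_upwards [hc.eventually he] with w hw
    rw [hz]
    refine hw.trans (mul_le_mul_of_nonneg_left ?_ hb)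
    rw [← hz]
    simpa using PiLp.norm_apply_le (w - z) 0
  have hpt : ∀ z : Eucl d, ENNReal.ofReal
      (1/2 * ‖fderiv ℝ (fun z : Eucl d => f (z 0)) z‖ ^ 2 + F (f (z 0))) ≤
      (Set.Icc (-R) R).indicator (fun x => ENNReal.ofReal (Q x)) (z 0) := by
    intro z
    by_cases hz : z 0 ∈ Set.Icc (-R) R
    · rw [Set.indicator_of_mem hz]
      obtain ⟨b, hb0, hb, hbQ⟩ := hin _ (abs_le.2 hz)
      have := hfd _ b hb0 hb z rfl
      refine ENNReal.ofReal_le_ofReal (le_trans ?_ hbQ)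
      gcongr
    · rw [Set.indicator_of_notMem hz]
      have hcase : R < z 0 ∨ z 0 < -R := by
        by_contra hcon
        push Not at hcon
        exact hz ⟨hcon.2, hcon.1⟩
      have hloc : (∀ᶠ y in 𝓝 (z 0), f y = f (z 0)) ∧ F (f (z 0)) = 0 := by
        rcases hcase with h1 | h1
        · rw [hr _ h1.le]
          exact ⟨(lt_mem_nhds h1).mono fun y hy => hr y (le_of_lt hy), hF.apply_one⟩
        · rw [hl _ h1.le]
          exact ⟨(gt_mem_nhds h1).mono fun y hy => hl y (le_of_lt hy), hF.apply_neg_one⟩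
      have := hfd (z 0) 0 le_rfl (hloc.1.mono fun y hy => by simp [hy]) z rfl
      rw [hloc.2, le_antisymm this (norm_nonneg _)]
      simp
  have hm : Measurable fun z : Eucl d =>
      (Set.Icc (-R) R).indicator (fun x => ENNReal.ofReal (Q x)) (z 0) :=
    (hQ.measurable.ennreal_ofReal.indicator measurableSet_Icc).comp
      (by fun_prop : Measurable fun w : Eucl d => w 0)
  refine (lintegral_mono hpt).trans ?_
  rw [domDL_eq, lintegral_strip measurableSet_Ioo hm]
  simp only [Fin.cons_zero]
  rw [setLIntegral_const, volume_cube, mul_one]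
  refine (setLIntegral_le_lintegral _ _).trans (le_of_eq ?_)
  rw [lintegral_indicator measurableSet_Icc, intervalIntegral.integral_of_le (by linarith),
    ← integral_Icc_eq_integral_Ioc]
  refine (ofReal_integral_eq_lintegral_ofReal hQ.continuousOn.integrableOn_Icc ?_).symm
  exact (ae_restrict_iff' measurableSet_Icc).2 (ae_of_all _ fun x hx => hQ0 x (abs_le.2 hx))

/-! ### Test profiles -/

/-- Truncation at the levels `±1`. -/
def clampOne (u : ℝ) : ℝ := max (-1) (min 1 u)

theorem abs_clampOne_le (u : ℝ) : |clampOne u| ≤ 1 :=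
  abs_le.2 ⟨le_max_left _ _, max_le (by norm_num) (min_le_left _ _)⟩

theorem lipschitzWith_clampOne : LipschitzWith 1 clampOne :=
  (LipschitzWith.id.const_min 1).const_max (-1)

theorem clampOne_of_one_le {u : ℝ} (h : 1 ≤ u) : clampOne u = 1 := by
  rw [clampOne, min_eq_left h, max_eq_right (by norm_num)]

theorem clampOne_of_le_neg_one {u : ℝ} (h : u ≤ -1) : clampOne u = -1 := by
  rw [clampOne, min_eq_right (by linarith), max_eq_left h]

theorem clampOne_neg (u : ℝ) : clampOne (-u) = -clampOne u := by
  rcases le_total u (-1) with h | h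
  · rw [clampOne_of_le_neg_one h, clampOne_of_one_le (by linarith), neg_neg]
  rcases le_total u 1 with h' | h'
  · rw [clampOne, clampOne, min_eq_right h', min_eq_right (by linarith), max_eq_right h,
      max_eq_right (by linarith)]
  · rw [clampOne_of_one_le h', clampOne_of_le_neg_one (by linarith)]

theorem IsStdPotential.antitoneOn {F : ℝ → ℝ} (hF : IsStdPotential F) :
    AntitoneOn F (Set.Icc 0 1) := by
  refine antitoneOn_of_deriv_nonpos (convex_Icc 0 1) hF.continuous.continuousOn
    hF.differentiable.differentiableOn fun x hx => ?_
  rw [interior_Icc] at hx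
  by_contra hpos
  push Not at hpos
  obtain ⟨c, hc, hcd⟩ := exists_deriv_eq_slope F hx.2 hF.continuous.continuousOn
    hF.differentiable.differentiableOn
  have hFx := hF.pos (u := x) (by linarith [hx.2]) (by linarith [hx.1])
  have hneg : deriv F c < 0 := by
    rw [hcd, hF.apply_one]
    exact div_neg_of_neg_of_pos (by linarith) (by linarith [hx.2])
  obtain ⟨y, hy, hy0⟩ := intermediate_value_Icc' hc.1.le
    (hF.contDiff_deriv.continuous.continuousOn) ⟨hneg.le, hpos.le⟩
  rcases (hF.deriv_zero_iff y).1 hy0 with h | h | h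
  · linarith [hy.1, hx.1]
  · linarith [hy.2, hc.2]
  · linarith [hy.1, hx.1]

theorem IsStdPotential.apply_clampOne_le {F : ℝ → ℝ} (hF : IsStdPotential F) {κ u : ℝ}
    (hκ : 0 ≤ κ) (hu : |u| ≤ 1) : F (clampOne ((1 + κ) * u)) ≤ F u := by
  wlog hu0 : 0 ≤ u generalizing u
  · have := this (u := -u) (by rwa [abs_neg]) (by linarith)
    rwa [mul_neg, clampOne_neg, hF.symm, hF.symm] at this
  rw [abs_of_nonneg hu0] at hu
  have h1 : u ≤ (1 + κ) * u := by nlinarith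
  have h2 : u ≤ clampOne ((1 + κ) * u) := le_max_of_le_right (le_min hu h1)
  exact hF.antitoneOn ⟨hu0, hu⟩ ⟨hu0.trans h2, (abs_le.1 (abs_clampOne_le _)).2⟩ h2

theorem Cstar_nonneg (F : ℝ → ℝ) : 0 ≤ Cstar F :=
  intervalIntegral.integral_nonneg (by norm_num) fun _ _ => Real.sqrt_nonneg _

/-- The energy of the optimal profile on an interval is at most `C*`. -/
theorem IsProfile.integral_sq_le {F m : ℝ → ℝ} (hF : IsStdPotential F) (hm : IsProfile F m)
    {R : ℝ} (hR : 0 ≤ R) : ∫ x in (-R)..R, Real.sqrt (2 * F (m x)) ^ 2 ≤ Cstar F := by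
  obtain ⟨K, hK⟩ := hm.lipschitz hF
  have hw := hF.continuous_sqrt
  have h := hK.integral_comp_mul_deriv (hasDerivAt_primitive hw) hw (-R) R
  rw [primitive_sub hw] at h
  have hd : ∀ x, Real.sqrt (2 * F (m x)) ^ 2 = Real.sqrt (2 * F (m x)) * deriv m x := fun x => by
    rw [(hm.ode x).deriv, sq]
  simp only [hd]
  rw [h, Cstar]
  exact intervalIntegral.integral_mono_interval (hm.mem_Icc _).1
    (hm.monotone (by linarith)) (hm.mem_Icc _).2
    (ae_of_all _ fun x => Real.sqrt_nonneg _) (hw.intervalIntegrable _ _)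

theorem IsTransition.pint_right {φ : ℝ → ℝ} {R : ℝ} (hφ : IsTransition φ R) {a x : ℝ}
    (ha : 0 < a) (hx : R + a ≤ x) : pint φ a x = 1 := by
  obtain ⟨K, hK⟩ := hφ.lip
  have := abs_pint_sub_const_le hK.continuous (b := 0) (c := 1) (x := x) ha fun s hs => by
    rw [hφ.right s (by linarith [(abs_le.1 hs).1])]; simp
  exact sub_eq_zero.1 (abs_nonpos_iff.1 this)

theorem IsTransition.pint_left {φ : ℝ → ℝ} {R : ℝ} (hφ : IsTransition φ R) {a x : ℝ}
    (ha : 0 < a) (hx : x ≤ -(R + a)) : pint φ a x = -1 := by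
  obtain ⟨K, hK⟩ := hφ.lip
  have := abs_pint_sub_const_le hK.continuous (b := 0) (c := -1) (x := x) ha fun s hs => by
    rw [hφ.left s (by linarith [(abs_le.1 hs).2])]; simp
  exact sub_eq_zero.1 (abs_nonpos_iff.1 this)

/-- Test profiles with almost optimal discretized energy. -/
theorem exists_test_profile {F m : ℝ → ℝ} (hF : IsStdPotential F) (hm : IsProfile F m)
    {η : ℝ} (hη : 0 < η) : ∃ (φ : ℝ → ℝ) (R a₀ : ℝ), (∀ x, |φ x| ≤ 1) ∧ 0 < a₀ ∧
      ∀ (d n : ℕ) (L a : ℝ) (D : Disc d L a), 0 < n → a = 1 / n → a ≤ a₀ → R ≤ L - a →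
        fullEnergy d L F (discFun d L a D fun w => φ (w.1 0)) ≤ Cstar F + η := by
  obtain ⟨K, hK⟩ := hm.lipschitz hF
  obtain ⟨κF, hκF0, hκF⟩ := hF.exists_lip 1
  have hC := Cstar_nonneg F
  set G : ℝ → ℝ := fun x => Real.sqrt (2 * F (m x)) with hG
  have hGc : Continuous G := hF.continuous_sqrt.comp hK.continuous
  have hG0 : ∀ x, 0 ≤ G x := fun x => Real.sqrt_nonneg _
  have hG2 : ∀ x, G x ^ 2 = 2 * F (m x) := fun x =>
    Real.sq_sqrt (mul_nonneg two_pos.le (hF.nonneg _))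
  have hGK : ∀ x, G x ≤ K := fun x => by
    have := hK.abs_deriv_le x
    rw [(hm.ode x).deriv, abs_of_nonneg (Real.sqrt_nonneg _)] at this
    exact this
  obtain ⟨κ, hκ0, hκ1, hκη⟩ : ∃ κ : ℝ, 0 < κ ∧ κ ≤ 1 ∧ κ * (3 * (Cstar F + 1)) ≤ η :=
    ⟨min 1 (η / (3 * (Cstar F + 1))), by positivity, min_le_left _ _, by
      rw [← le_div_iff₀ (by positivity)]; exact min_le_right _ _⟩
  set φ : ℝ → ℝ := fun x => clampOne ((1 + κ) * m x) with hφdef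
  have hφ1 : ∀ x, |φ x| ≤ 1 := fun x => abs_clampOne_le _
  have hφm : ∀ s t, |φ s - φ t| ≤ (1 + κ) * |m s - m t| := fun s t => by
    have := lipschitzWith_clampOne.abs_sub_le_mul ((1 + κ) * m s) ((1 + κ) * m t)
    rwa [← mul_sub, abs_mul, abs_of_pos (by linarith : 0 < 1 + κ), NNReal.coe_one, one_mul] at this
  have hφL : LipschitzWith (2 * K) φ := LipschitzWith.of_dist_le_mul fun s t => by
    rw [Real.dist_eq, Real.dist_eq, NNReal.coe_mul, NNReal.coe_ofNat, mul_assoc]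
    exact (hφm s t).trans (mul_le_mul (by linarith) (hK.abs_sub_le_mul s t) (abs_nonneg _)
      two_pos.le)
  have hinv : 1 / (1 + κ) < 1 := by rw [div_lt_one (by linarith)]; linarith
  obtain ⟨R₁, hR₁⟩ := eventually_atTop.1 (hm.limit_top.eventually_const_le hinv)
  obtain ⟨R₂, hR₂⟩ := eventually_atBot.1 (hm.limit_bot.eventually_le_const (neg_lt_neg hinv))
  obtain ⟨R, hR0, hRR₁, hRR₂⟩ : ∃ R : ℝ, 0 < R ∧ R₁ ≤ R ∧ -R ≤ R₂ :=
    ⟨max 1 (max R₁ (-R₂)), by positivity, by simp, by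
      have : -R₂ ≤ max 1 (max R₁ (-R₂)) := by simp
      linarith⟩
  have hT : IsTransition φ R :=
    { lip := ⟨_, hφL⟩
      right := fun x hx => clampOne_of_one_le (by
        have := hR₁ x (by linarith)
        rwa [div_le_iff₀' (by linarith)] at this)
      left := fun x hx => clampOne_of_le_neg_one (by
        have := neg_le_neg (hR₂ x (by linarith))
        rw [neg_neg, div_le_iff₀' (by linarith)] at this
        linarith) }
  have hK0 : (0:ℝ) ≤ K := K.2
  set R' := R + 1 with hR'
  obtain ⟨θ, hθ0, hθ1, hθη⟩ : ∃ θ : ℝ, 0 < θ ∧ θ ≤ 1 ∧ θ * (4 * R' * (4 * K + 3)) ≤ η := by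
    have hp : 0 < 4 * R' * (4 * K + 3) := by positivity
    exact ⟨min 1 (η / (4 * R' * (4 * K + 3))), by positivity, min_le_left _ _, by
      rw [← le_div_iff₀ hp]; exact min_le_right _ _⟩
  obtain ⟨ρ, hρ0, hρ⟩ := Metric.uniformContinuousOn_iff.1
    ((isCompact_Icc (a := -(R' + 2)) (b := R' + 2)).uniformContinuousOn_of_continuous
      hGc.continuousOn) θ hθ0
  refine ⟨φ, R, min (min 1 (ρ / 4)) (θ / (κF * (2 * K) + 1)), hφ1, by positivity,
    fun d n L a D hn han ha₀ hRL => ?_⟩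
  have ha := IsPLGrid.pos_mesh hn han
  have ha1 : a ≤ 1 := ha₀.trans ((min_le_left _ _).trans (min_le_left _ _))
  have haρ : a ≤ ρ / 4 := ha₀.trans ((min_le_left _ _).trans (min_le_right _ _))
  have haθ : κF * (2 * K * a) ≤ θ := by
    have h1 : a ≤ θ / (κF * (2 * K) + 1) := ha₀.trans (min_le_right _ _)
    rw [le_div_iff₀ (by positivity)] at h1
    linarith
  have hR'0 : 0 ≤ R' := by linarith
  have hle := fullEnergy_le_of_profile (L := L)
    (Q := fun x => 1 / 2 * ((1 + κ) * (G x + θ)) ^ 2 + (F (m x) + θ)) hF (hφL.pint ha)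
    (fun z hz => hT.discFun_eq_pint D hn han hRL (domD_subset_closedStrip d hz)) hR'0
    (by have := hF.continuous; have := hK.continuous; fun_prop) (fun x hx => ?_)
    (fun x hx => hT.pint_right ha (by linarith)) (fun x hx => hT.pint_left ha (by linarith))
  · refine hle.trans ?_
    have hQi : ∀ x, 1 / 2 * ((1 + κ) * (G x + θ)) ^ 2 + (F (m x) + θ) ≤
        1 / 2 * ((1 + κ) ^ 2 + 1) * G x ^ 2 + θ * (4 * K + 3) := fun x => by
      have h1 : F (m x) = 1 / 2 * G x ^ 2 := by rw [hG2]; ring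
      have h2 : (1 + κ) ^ 2 ≤ 4 := by nlinarith
      have h3 : 2 * G x * θ + θ ^ 2 ≤ θ * (2 * K + 1) := by nlinarith [hGK x]
      have h4 : 0 ≤ 2 * G x * θ + θ ^ 2 := by have := hG0 x; positivity
      have h5 : (1 + κ) ^ 2 * (2 * G x * θ + θ ^ 2) ≤ 4 * (θ * (2 * K + 1)) :=
        mul_le_mul h2 h3 h4 (by norm_num)
      rw [h1]
      nlinarith
    have hGi : IntervalIntegrable (fun x => G x ^ 2) volume (-R') R' :=
      (hGc.pow 2).intervalIntegrable _ _
    calc _ ≤ ∫ x in (-R')..R', (1 / 2 * ((1 + κ) ^ 2 + 1) * G x ^ 2 + θ * (4 * K + 3)) := by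
          refine intervalIntegral.integral_mono_on (by linarith)
            (Continuous.intervalIntegrable ?_ _ _) (Continuous.intervalIntegrable ?_ _ _)
            fun x _ => hQi x
          · have := hF.continuous; have := hK.continuous; fun_prop
          · fun_prop
      _ = 1 / 2 * ((1 + κ) ^ 2 + 1) * (∫ x in (-R')..R', G x ^ 2) +
          2 * R' * (θ * (4 * K + 3)) := by
          rw [intervalIntegral.integral_add (hGi.const_mul _) intervalIntegrable_const,
            intervalIntegral.integral_const_mul, intervalIntegral.integral_const, smul_eq_mul]
          ring
      _ ≤ _ := by
          have h1 := hm.integral_sq_le hF hR'0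
          have h2 : 1 / 2 * ((1 + κ) ^ 2 + 1) * (∫ x in (-R')..R', G x ^ 2) ≤
              1 / 2 * ((1 + κ) ^ 2 + 1) * Cstar F :=
            mul_le_mul_of_nonneg_left h1 (by positivity)
          have h3 : 1 / 2 * ((1 + κ) ^ 2 + 1) ≤ 1 + 3 / 2 * κ := by nlinarith
          have h4 := mul_le_mul_of_nonneg_right h3 hC
          nlinarith
  · have hx' := abs_le.1 hx
    have hmv : ∀ s t, |s - x| ≤ a + a → |t - x| ≤ a + a →
        |φ s - φ t| ≤ (1 + κ) * (G x + θ) * |s - t| := by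
      intro s t hs ht
      have hs' := abs_le.1 hs
      have ht' := abs_le.1 ht
      have := (convex_Icc (x - (a + a)) (x + (a + a))).norm_image_sub_le_of_norm_hasDerivWithin_le
        (f := m) (C := G x + θ) (fun y _ => (hm.ode y).hasDerivWithinAt) (fun y hy => ?_)
        (x := t) (y := s) ⟨by linarith, by linarith⟩ ⟨by linarith, by linarith⟩
      · refine (hφm s t).trans ?_
        rw [mul_assoc]
        exact mul_le_mul_of_nonneg_left this (by linarith)
      · have h1 := hρ y ⟨by linarith [hy.1], by linarith [hy.2]⟩ x
          ⟨by linarith, by linarith⟩ (by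
            rw [Real.dist_eq, abs_lt]; constructor <;> linarith [hy.1, hy.2])
        rw [Real.dist_eq, abs_lt] at h1
        rw [Real.norm_eq_abs, abs_of_nonneg (Real.sqrt_nonneg _)]
        linarith [h1.2]
    refine ⟨(1 + κ) * (G x + θ), mul_nonneg (by linarith) (by linarith [hG0 x]), ?_, ?_⟩
    · filter_upwards [Metric.closedBall_mem_nhds x ha] with y hy
      exact abs_pint_sub_le hφL.continuous ha hmv hy
    · have h0 : |pint φ a x - 0| ≤ 1 :=
        abs_pint_sub_const_le hφL.continuous ha fun s _ => by simpa using hφ1 s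
      have h1 := hκF (pint φ a x) (φ x) (by simpa using h0) (hφ1 x)
      have h2 : |pint φ a x - φ x| ≤ 2 * K * a :=
        abs_pint_sub_const_le hφL.continuous ha fun s hs => by
          refine (hφL.abs_sub_le_mul s x).trans ?_
          push_cast
          gcongr
      have h3 := hF.apply_clampOne_le hκ0.le (hm.abs_le x)
      have h4 := mul_le_mul_of_nonneg_left h2 hκF0
      have h5 := (abs_le.1 h1).2
      have h6 : F (φ x) ≤ F (m x) := h3
      linarith

/-- A transition that is far from all minimizers. -/
def farProfile (x : ℝ) : ℝ := clampOne x + max 0 (5 - |x|)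

theorem lipschitzWith_farProfile : LipschitzWith 2 farProfile := by
  have h1 : LipschitzWith 1 fun x : ℝ => 5 - |x| := LipschitzWith.of_dist_le_mul fun x y => by
    rw [Real.dist_eq, Real.dist_eq, NNReal.coe_one, one_mul, abs_sub_comm x y]
    have : (5 - |x|) - (5 - |y|) = |y| - |x| := by ring
    rw [this]
    exact abs_abs_sub_abs_le y x
  have := lipschitzWith_clampOne.add (h1.const_max 0)
  rwa [one_add_one_eq_two] at this

theorem abs_farProfile_le (x : ℝ) : |farProfile x| ≤ 6 := by
  have h1 := abs_le.1 (abs_clampOne_le x)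
  have h2 : max 0 (5 - |x|) ≤ 5 := max_le (by norm_num) (by linarith [abs_nonneg x])
  have h3 : 0 ≤ max 0 (5 - |x|) := le_max_left _ _
  exact abs_le.2 ⟨by unfold farProfile; linarith, by unfold farProfile; linarith⟩

theorem three_le_farProfile {x : ℝ} (hx : |x| ≤ 1) : 3 ≤ farProfile x := by
  have h1 := abs_le.1 (abs_clampOne_le x)
  have h2 : 4 ≤ max 0 (5 - |x|) := le_max_of_le_right (by linarith)
  unfold farProfile; linarith

theorem isTransition_farProfile : IsTransition farProfile 5 where
  lip := ⟨_, lipschitzWith_farProfile⟩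
  right x hx := by
    rw [farProfile, clampOne_of_one_le (by linarith), abs_of_pos (by linarith),
      max_eq_left (by linarith), add_zero]
  left x hx := by
    rw [farProfile, clampOne_of_le_neg_one (by linarith), abs_of_neg (by linarith),
      max_eq_left (by linarith), add_zero]

theorem exists_fullEnergy_farProfile_le {F : ℝ → ℝ} (hF : IsStdPotential F) :
    ∃ A : ℝ, ∀ (d n : ℕ) (L a : ℝ) (D : Disc d L a), 0 < n → a = 1 / n → a ≤ 1 → 6 ≤ L →
      fullEnergy d L F (discFun d L a D fun w => farProfile (w.1 0)) ≤ A := by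
  obtain ⟨B, hB⟩ := (isCompact_Icc (a := (-6:ℝ)) (b := 6)).exists_bound_of_continuousOn
    hF.continuous.continuousOn
  refine ⟨∫ _x in (-6:ℝ)..6, (2 + B), fun d n L a D hn han ha1 hL => ?_⟩
  have ha := IsPLGrid.pos_mesh hn han
  refine fullEnergy_le_of_profile (f := pint farProfile a) hF (lipschitzWith_farProfile.pint ha)
    (fun z hz => isTransition_farProfile.discFun_eq_pint D hn han (by linarith)
      (domD_subset_closedStrip d hz)) (by norm_num) continuous_const (fun x _ => ?_)
    (fun x hx => isTransition_farProfile.pint_right ha (by linarith))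
    (fun x hx => isTransition_farProfile.pint_left ha (by linarith))
  refine ⟨2, two_pos.le, Eventually.of_forall fun y =>
    (lipschitzWith_farProfile.pint ha).abs_sub_le_mul y x, ?_⟩
  have h0 : |pint farProfile a x - 0| ≤ 6 :=
    abs_pint_sub_const_le lipschitzWith_farProfile.continuous ha fun s _ => by
      simpa using abs_farProfile_le s
  rw [sub_zero] at h0
  have := (le_abs_self _).trans (hB _ (abs_le.1 h0))
  linarith

theorem lt_eDistM_of_near_farProfile {F m : ℝ → ℝ} (hm : IsProfile F m) {d n : ℕ} {L a : ℝ}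
    (D : Disc d L a) (hn : 0 < n) (han : a = 1 / n) (ha2 : a ≤ 1 / 2) (hL : 6 ≤ L)
    {g : gridSet d L a → ℝ} (hg : ∀ z, |g z - farProfile (z.1 0)| ≤ 1) {δ : ℝ} (hδ : δ < 1) :
    ENNReal.ofReal δ < eDistM d m (discFun d L a D g) := by
  have ha := IsPLGrid.pos_mesh hn han
  have h2 : ∀ z ∈ domDL d (1 / 2), 2 ≤ discFun d L a D g z := by
    intro z hz
    have hzc := domD_subset_closedStrip d (domDL_subset_domD d _ hz)
    have h1 := isTransition_farProfile.discFun_eq_pint D hn han (by linarith) hzc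
    have h3 : |pint farProfile a (z 0) - 6| ≤ 3 :=
      abs_pint_sub_const_le lipschitzWith_farProfile.continuous ha fun s hs => by
        have hz0 : |z 0| < 1 / 2 := hz.1
        have hs1 : |s| ≤ 1 := by
          calc |s| = |(s - z 0) + z 0| := by ring_nf
            _ ≤ _ := (abs_add_le _ _).trans (by linarith)
        have := three_le_farProfile hs1
        have := (abs_le.1 (abs_farProfile_le s)).2
        exact abs_le.2 ⟨by linarith, by linarith⟩
    have h4 : |discFun d L a D g z - discFun d L a D (fun w => farProfile (w.1 0)) z| ≤ 1 := by
      rw [D.discFun_sub]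
      exact (D.interp0_pl _).abs_le hn han (D.abs_interp0_latPt_le zero_le_one hg) hzc
    rw [h1] at h4
    linarith [(abs_le.1 h3).1, (abs_le.1 h4).1]
  have hL2 : ∀ ξ : ℝ, 1 ≤ eL2 d (fun z => discFun d L a D g z - m (z 0 - ξ)) := by
    intro ξ
    rw [eL2]
    refine ENNReal.one_le_rpow ?_ (by norm_num)
    calc (1 : ℝ≥0∞) = ∫⁻ _z in domDL d (1 / 2), 1 := by
          rw [setLIntegral_one, volume_domDL]; norm_num
      _ ≤ ∫⁻ z in domDL d (1 / 2),
          ENNReal.ofReal ((discFun d L a D g z - m (z 0 - ξ)) ^ 2) := by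
          refine setLIntegral_mono' (measurableSet_domDL d _) fun z hz => ?_
          rw [← ENNReal.ofReal_one]
          refine ENNReal.ofReal_le_ofReal ?_
          have := h2 z hz
          have := (hm.mem_Icc (z 0 - ξ)).2
          nlinarith
      _ ≤ _ := lintegral_mono_set (domDL_subset_domD d _)
  refine lt_of_lt_of_le ?_ (le_iInf hL2)
  rw [← ENNReal.ofReal_one]
  exact (ENNReal.ofReal_lt_ofReal_iff one_pos).2 hδ

/-! ### Asymptotics of the discretization parameters -/

theorem entropy_le {ε θ p K γ C s : ℝ} {N : ℕ} (hε : 0 < ε) (hε1 : ε < 1) (hγ : 0 < γ)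
    (hq : 0 ≤ θ + p + K) (hC : 0 < C) (hN : (N : ℝ) ≤ C * ε ^ (-θ)) (hs : 0 < s)
    (hsC : s ≤ C * ε ^ (-p)) (hCγ : C ^ 2 / γ * ε ≤ 1) :
    ε * N * (Real.log (2 * N * s * ε / γ) - Real.log (2 * ε ^ K)) ≤
      C * (θ + p + K) * -(Real.log ε * ε ^ (1 - θ)) := by
  have hlog : Real.log ε ≤ 0 := Real.log_nonpos hε.le hε1.le
  have hεθ : ε * ε ^ (-θ) = ε ^ (1 - θ) := by
    rw [sub_eq_add_neg, Real.rpow_add hε, Real.rpow_one]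
  rcases Nat.eq_zero_or_pos N with h0 | h0
  · subst h0
    have := Real.rpow_nonneg hε.le (1 - θ)
    have h2 : 0 ≤ C * (θ + p + K) * (-Real.log ε * ε ^ (1 - θ)) := by
      have : 0 ≤ - Real.log ε := by linarith
      positivity
    simp only [Nat.cast_zero, mul_zero, zero_mul]
    linarith
  have hN0 : (0:ℝ) < N := by exact_mod_cast h0
  have hK := Real.rpow_pos_of_pos hε K
  have hX : Real.log (2 * N * s * ε / γ) - Real.log (2 * ε ^ K) ≤ -((θ + p + K) * Real.log ε) := by
    rw [← Real.log_div (by positivity) (by positivity), ← neg_mul, ← Real.log_rpow hε]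
    refine Real.log_le_log (by positivity) ?_
    calc 2 * N * s * ε / γ / (2 * ε ^ K) = (N * s) * (ε / γ * (ε ^ K)⁻¹) := by field_simp
      _ ≤ ((C * ε ^ (-θ)) * (C * ε ^ (-p))) * (ε / γ * (ε ^ K)⁻¹) := by gcongr
      _ = (C ^ 2 / γ * ε) * (ε ^ (-θ) * ε ^ (-p) * ε ^ (-K)) := by
          rw [Real.rpow_neg hε.le K]; ring
      _ ≤ 1 * (ε ^ (-θ) * ε ^ (-p) * ε ^ (-K)) := by gcongr
      _ = ε ^ (-(θ + p + K)) := by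
          rw [one_mul, ← Real.rpow_add hε, ← Real.rpow_add hε]; ring_nf
  have h3 : 0 ≤ -((θ + p + K) * Real.log ε) := by nlinarith
  calc ε * N * (Real.log (2 * N * s * ε / γ) - Real.log (2 * ε ^ K))
      ≤ ε * N * -((θ + p + K) * Real.log ε) := by gcongr
    _ ≤ ε * (C * ε ^ (-θ)) * -((θ + p + K) * Real.log ε) := by gcongr
    _ = C * (θ + p + K) * -(Real.log ε * (ε * ε ^ (-θ))) := by ring
    _ = _ := by rw [hεθ]

theorem gridCard_le_rpow {d n : ℕ} {L a ε lam alp : ℝ} (D : Disc d L a) (hn : 0 < n)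
    (han : a = 1 / n) (haL : a ≤ L) (hε : 0 < ε) (hL : L ≤ 2 * ε ^ (-lam))
    (ha : ε ^ alp / 2 ≤ a) :
    (gridCard d L a D : ℝ) ≤ 3 * 2 ^ d * (2 * 2 ^ (d + 1)) * ε ^ (-(lam + (d + 1) * alp)) := by
  refine (gridCard_le D hn han haL).trans ?_
  have h1 := Real.rpow_pos_of_pos hε alp
  have h2 : (ε ^ alp) ^ (d + 1) = ε ^ ((d + 1) * alp) := by
    rw [← Real.rpow_natCast, ← Real.rpow_mul hε.le, mul_comm]; push_cast; rfl
  calc 3 * 2 ^ d * (L / a ^ (d + 1))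
      ≤ 3 * 2 ^ d * (2 * ε ^ (-lam) / (ε ^ alp / 2) ^ (d + 1)) := by gcongr
    _ = 3 * 2 ^ d * (2 * 2 ^ (d + 1)) * (ε ^ (-lam) * (ε ^ ((d + 1) * alp))⁻¹) := by
        rw [div_pow, h2]; field_simp
    _ = _ := by rw [← Real.rpow_neg hε.le, ← Real.rpow_add hε]; ring_nf

theorem coerConst_le_rpow {d : ℕ} {L a ε lam alp : ℝ} (hL0 : 0 ≤ L) (hε : 0 < ε)
    (hL : L ≤ 2 * ε ^ (-lam)) (ha : ε ^ alp / 2 ≤ a) :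
    coerConst d L a ≤ 16 * (8 * (d + 1)) ^ (d + 1) * ε ^ (-(2 * lam + (d + 1) * alp)) := by
  have h1 := Real.rpow_pos_of_pos hε alp
  have h2 : (ε ^ alp) ^ (d + 1) = ε ^ ((d + 1) * alp) := by
    rw [← Real.rpow_natCast, ← Real.rpow_mul hε.le, mul_comm]; push_cast; rfl
  have h3 : (ε ^ (-lam)) ^ 2 = ε ^ (-(2 * lam)) := by
    rw [← Real.rpow_natCast, ← Real.rpow_mul hε.le]; push_cast; ring_nf
  rw [coerConst]
  calc 4 * L ^ 2 / (a / (4 * (d + 1))) ^ (d + 1)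
      ≤ 4 * (2 * ε ^ (-lam)) ^ 2 / ((ε ^ alp / 2) / (4 * (d + 1))) ^ (d + 1) := by gcongr
    _ = 16 * (8 * (d + 1)) ^ (d + 1) * (ε ^ (-(2 * lam)) * (ε ^ ((d + 1) * alp))⁻¹) := by
        rw [mul_pow, h3, div_div, div_pow, h2, show (2:ℝ) * (4 * (d + 1)) = 8 * (d + 1) by ring]
        field_simp
        norm_num
    _ = _ := by rw [← Real.rpow_neg hε.le, ← Real.rpow_add hε]; ring_nf

theorem perturbation_le_rpow {d : ℕ} {L a ε lam alp κ : ℝ} (hε : 0 < ε) (hε1 : ε ≤ 1)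
    (halp : 0 ≤ alp) (hκ : 0 ≤ κ) (hL0 : 0 ≤ L) (hL : L ≤ 2 * ε ^ (-lam)) (ha : ε ^ alp / 2 ≤ a) :
    (lipConst d a ^ 2 * 7 * ε ^ (2 * alp + lam + 1) + κ * ε ^ (2 * alp + lam + 1)) * (2 * L) ≤
      (448 * (d + 1) ^ 2 + 4 * κ) * ε := by
  have h1 := Real.rpow_pos_of_pos hε alp
  have h2 := Real.rpow_pos_of_pos hε lam
  have hK : ε ^ (2 * alp + lam + 1) = (ε ^ alp) ^ 2 * ε ^ lam * ε := by
    rw [Real.rpow_add hε, Real.rpow_add hε, Real.rpow_one, mul_comm 2 alp, Real.rpow_mul hε.le,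
      Real.rpow_ofNat]
  have ha0 : 0 < a := by linarith
  have h4 : (ε ^ alp) ^ 2 ≤ 1 := pow_le_one₀ h1.le (Real.rpow_le_one hε.le hε1 halp)
  rw [hK, lipConst]
  rw [Real.rpow_neg hε.le] at hL
  calc ((2 * (d + 1) / a) ^ 2 * 7 * ((ε ^ alp) ^ 2 * ε ^ lam * ε) +
        κ * ((ε ^ alp) ^ 2 * ε ^ lam * ε)) * (2 * L)
      ≤ ((2 * (d + 1) / (ε ^ alp / 2)) ^ 2 * 7 * ((ε ^ alp) ^ 2 * ε ^ lam * ε) +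
        κ * (1 * ε ^ lam * ε)) * (2 * (2 * (ε ^ lam)⁻¹)) := by gcongr
    _ = _ := by field_simp; ring

theorem eventually_rpow_bounds {lam alp : ℝ} {L a : ℝ → ℝ}
    (hL : Tendsto (fun ε : ℝ => L ε * ε ^ lam) (𝓝[>] (0:ℝ)) (𝓝 1))
    (ha : Tendsto (fun ε : ℝ => a ε / ε ^ alp) (𝓝[>] (0:ℝ)) (𝓝 1)) :
    ∀ᶠ ε in 𝓝[>] (0:ℝ), ε ^ (-lam) / 2 ≤ L ε ∧ L ε ≤ 2 * ε ^ (-lam) ∧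
      ε ^ alp / 2 ≤ a ε ∧ a ε ≤ 2 * ε ^ alp := by
  have hI : Set.Icc (1/2:ℝ) 2 ∈ 𝓝 (1:ℝ) := Icc_mem_nhds (by norm_num) (by norm_num)
  filter_upwards [hL hI, ha hI, self_mem_nhdsWithin] with ε h1 h2 hε
  have hε : 0 < ε := hε
  have p1 := Real.rpow_pos_of_pos hε lam
  have p2 := Real.rpow_pos_of_pos hε alp
  obtain ⟨h1, h1'⟩ := h1
  obtain ⟨h2, h2'⟩ := h2
  dsimp only at h1 h1' h2 h2'
  rw [le_div_iff₀ p2] at h2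
  rw [div_le_iff₀ p2] at h2'
  rw [Real.rpow_neg hε.le]
  refine ⟨?_, ?_, by linarith, h2'⟩
  · rw [← one_div, div_div, div_le_iff₀ (by positivity)]; linarith
  · rw [← div_eq_mul_inv, le_div_iff₀ p1]; exact h1'

/-! ### Concentration of the Gibbs measures -/

theorem log_gibbs_mem_Icc {d n : ℕ} {L a : ℝ} (D : Disc d L a) (hn : 0 < n) (han : a = 1 / n)
    (haL : a ≤ L) (hL : 1 ≤ L) {F : ℝ → ℝ} (hF : IsStdPotential F) {ε γ r A A₀ A₁ e κ : ℝ}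
    (hε : 0 < ε) (hγ : 0 < γ) (hγ1 : γ ≤ 1) (hr : 0 < r) (hr1 : r ≤ 1) (hκ0 : 0 ≤ κ)
    (hκ : ∀ u v, |u| ≤ 7 → |v| ≤ 7 → |F u - F v| ≤ κ * |u - v|)
    (he : (lipConst d a ^ 2 * 7 * r + κ * r) * (2 * L) ≤ e) {g₀ g₁ : gridSet d L a → ℝ}
    (hg₀ : ∀ z, |g₀ z| ≤ 6) (hg₁ : ∀ z, |g₁ z| ≤ 6)
    (hA₀ : fullEnergy d L F (discFun d L a D g₀) ≤ A₀)
    (hA₁ : fullEnergy d L F (discFun d L a D g₁) ≤ A₁) {S : Set (gridSet d L a → ℝ)}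
    (hS : ∀ g ∈ S, A ≤ fullEnergy d L F (discFun d L a D g))
    (hS₁ : ∀ g, (∀ z, |g z - g₁ z| ≤ 1) → g ∈ S) :
    ε * Real.log ((gibbs d L a D F ε S).toReal) ∈ Set.Icc
      (-(A₁ + e) - 2 + ε * gridCard d L a D *
        (Real.log (2 * r) - Real.log (2 * gridCard d L a D * coerConst d L a * ε)))
      (-A + (A₀ + e + γ * (A + 2)) + ε * gridCard d L a D *
        (Real.log (2 * gridCard d L a D * coerConst d L a * ε / γ) - Real.log (2 * r))) := by
  let := D.gridFin
  have ha := IsPLGrid.pos_mesh hn han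
  have ha1 : a ≤ 1 := by
    rw [han, div_le_one (by exact_mod_cast hn)]; exact_mod_cast hn
  have hball : ∀ {g g' : gridSet d L a → ℝ}, g ∈ Metric.closedBall g' r → ∀ z, |g z - g' z| ≤ r :=
    fun {g g'} hg z => (dist_le_pi_dist g g' z).trans hg
  have hpert : ∀ {g' : gridSet d L a → ℝ} {B : ℝ}, (∀ z, |g' z| ≤ 6) →
      fullEnergy d L F (discFun d L a D g') ≤ B → ∀ g ∈ Metric.closedBall g' r,
      fullEnergy d L F (discFun d L a D g) ≤ B + e := by
    intro g' B hg' hB g hg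
    have h := D.abs_fullEnergy_sub_le (g := g) (g' := g') hn han haL hF.continuous (by norm_num)
      (fun z => ?_) (fun z => (hg' z).trans (by norm_num)) hr.le (hball hg) hκ hκ0
    · linarith [(abs_le.1 h).2]
    · calc |g z| = |(g z - g' z) + g' z| := by ring_nf
        _ ≤ _ := (abs_add_le _ _).trans (by linarith [hball hg z, hg' z])
  exact log_measure_bounds (D.continuous_fullEnergy hn han haL hF)
    (fun g => Disc.fullEnergy_nonneg hF _)
    (zero_lt_one.trans_le (one_le_coerConst ha ha1 hL)) (D.abs_le_energy hn han hL hF) hε hγ hγ1 hr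
    (hpert hg₀ hA₀) (hpert hg₁ hA₁) hS fun g hg => hS₁ g fun z => (hball hg z).trans hr1

/-- Exponential concentration of the Gibbs measures `μ^ε = μ^{L(ε),a(ε),ε}`
around the set `M` of minimizers of the free energy, in the joint limit `ε → 0`,
`L(ε) ~ ε^{-λ}`, `a(ε) ~ ε^α` with `λ + (d+1)α < 1`. -/
theorem statement0 (d : ℕ) (F m : ℝ → ℝ) (hF : IsStdPotential F) (hm : IsProfile F m)
    (lam alp : ℝ) (hlam : 0 < lam) (halp : 0 < alp)
    (hsum : lam + (d + 1 : ℝ) * alp < 1)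
    (L a : ℝ → ℝ)
    (hLasymp : Tendsto (fun ε : ℝ => L ε * ε ^ lam) (𝓝[>] (0:ℝ)) (𝓝 1))
    (haasymp : Tendsto (fun ε : ℝ => a ε / ε ^ alp) (𝓝[>] (0:ℝ)) (𝓝 1))
    (ε₁ : ℝ) (hε₁ : 0 < ε₁)
    (hmesh : ∀ ε ∈ Set.Ioo (0:ℝ) ε₁, ∃ n : ℕ, 0 < n ∧ a ε = 1 / n)
    (disc : ∀ ε ∈ Set.Ioo (0:ℝ) ε₁, Disc d (L ε) (a ε)) :
    ∃ c₀ δ₀ : ℝ, 0 < c₀ ∧ 0 < δ₀ ∧ ∀ δ : ℝ, 0 < δ → δ < δ₀ →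
      Filter.limsup (fun ε : ℝ =>
          if hε : ε ∈ Set.Ioo (0:ℝ) ε₁ then
            ε * Real.log ((gibbs d (L ε) (a ε) (disc ε hε) F ε
                {g | ENNReal.ofReal δ <
                      eDistM d m (discFun d (L ε) (a ε) (disc ε hε) g)}).toReal)
          else 0)
        (𝓝[>] (0:ℝ)) ≤ -c₀ * δ ^ 2 := by
  obtain ⟨c, δ₁, hc, hδ₁, hgap⟩ := exists_energy_gap d hF hm
  refine ⟨c / 2, min δ₁ 1, by positivity, by positivity, fun δ hδ hδ0 => ?_⟩
  have hδ1 : δ < δ₁ := hδ0.trans_le (min_le_left _ _)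
  have hδ2 : δ < 1 := hδ0.trans_le (min_le_right _ _)
  have hC0 := Cstar_nonneg F
  set t := c * δ ^ 2 with ht
  have ht0 : 0 < t := by positivity
  obtain ⟨φ, R, a₀, hφ1, ha₀, hφ⟩ := exists_test_profile hF hm (η := t / 16) (by positivity)
  obtain ⟨A₁, hA₁⟩ := exists_fullEnergy_farProfile_le hF
  obtain ⟨κ, hκ0, hκ⟩ := hF.exists_lip 7
  set γ := min 1 (t / 16 / (Cstar F + t + 2)) with hγdef
  have hγ : 0 < γ := by positivity
  have hγ1 : γ ≤ 1 := min_le_left _ _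
  have hγA : γ * (Cstar F + t + 2) ≤ t / 16 := by
    rw [← le_div_iff₀ (by positivity)]; exact min_le_right _ _
  set θ := lam + (d + 1 : ℝ) * alp with hθ
  set p := 2 * lam + (d + 1 : ℝ) * alp with hp
  set K := 2 * alp + lam + 1 with hK
  have hdα : 0 < (d + 1 : ℝ) * alp := by positivity
  set C : ℝ := max (3 * 2 ^ d * (2 * 2 ^ (d + 1))) (16 * (8 * (d + 1)) ^ (d + 1)) with hC
  have hCpos : 0 < C := lt_max_of_lt_left (by positivity)
  have hid : Tendsto (fun ε : ℝ => ε) (𝓝[>] (0:ℝ)) (𝓝 0) := nhdsWithin_le_nhds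
  have hαt : Tendsto (fun ε : ℝ => 2 * ε ^ alp) (𝓝[>] (0:ℝ)) (𝓝 0) := by
    have := ((Real.continuousAt_rpow_const 0 alp (Or.inr halp.le)).tendsto.mono_left
      (nhdsWithin_le_nhds (s := Set.Ioi 0))).const_mul 2
    simpa [Real.zero_rpow halp.ne'] using! this
  have hLt : Tendsto (fun ε : ℝ => ε ^ (-lam)) (𝓝[>] (0:ℝ)) atTop :=
    tendsto_rpow_neg_nhdsGT_zero (neg_lt_zero.2 hlam)
  have hentT : Tendsto (fun ε : ℝ => C * (θ + p + K) * -(Real.log ε * ε ^ (1 - θ)))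
      (𝓝[>] (0:ℝ)) (𝓝 0) := by
    have := (tendsto_log_mul_rpow_nhdsGT_zero (r := 1 - θ) (by linarith)).neg.const_mul
      (C * (θ + p + K))
    simpa using! this
  have hmain : ∀ᶠ ε in 𝓝[>] (0:ℝ), ∀ hε : ε ∈ Set.Ioo (0:ℝ) ε₁,
      ε * Real.log ((gibbs d (L ε) (a ε) (disc ε hε) F ε
        {g | ENNReal.ofReal δ < eDistM d m (discFun d (L ε) (a ε) (disc ε hε) g)}).toReal) ∈
      Set.Icc (-A₁ - 4) (-(c / 2) * δ ^ 2) := by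
    have e1 := (hid.const_mul (448 * ((d:ℝ) + 1) ^ 2 + 4 * κ)).eventually_le_const
      (u := min 1 (t / 16)) (by rw [mul_zero]; positivity)
    have e2 := (hid.const_mul (C ^ 2 / γ)).eventually_le_const (u := 1) (by simp)
    have e3 := (hid.const_mul (C ^ 2 / 1)).eventually_le_const (u := 1) (by simp)
    have e4 := hentT.eventually_le_const (u := min 1 (t / 16)) (by positivity)
    have e5 := hαt.eventually_le_const (u := min (1 / 2) a₀) (by positivity)
    have e6 := hLt.eventually_ge_atTop (2 * max 6 (R + 1))
    filter_upwards [e1, e2, e3, e4, e5, e6, hid.eventually_lt_const zero_lt_one,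
      eventually_rpow_bounds hLasymp haasymp] with ε e1 e2 e3 e4 e5 e6 hε1 ⟨b1, b2, b3, b4⟩ hε
    obtain ⟨n, hn, han⟩ := hmesh ε hε
    have hε0 := hε.1
    have ha2 : a ε ≤ 1 / 2 := b4.trans (e5.trans (min_le_left _ _))
    have haa₀ : a ε ≤ a₀ := b4.trans (e5.trans (min_le_right _ _))
    have hL6 : 6 ≤ L ε := by linarith [le_max_left 6 (R + 1)]
    have hLR : R + 1 ≤ L ε := by linarith [le_max_right 6 (R + 1)]
    have hK0 : 0 < ε ^ K := Real.rpow_pos_of_pos hε0 K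
    have ha0 := IsPLGrid.pos_mesh hn han
    have hs := one_le_coerConst (d := d) ha0 (by linarith) (by linarith : 1 ≤ L ε)
    have hsC : coerConst d (L ε) (a ε) ≤ C * ε ^ (-p) :=
      (coerConst_le_rpow (by linarith) hε0 b2 b3).trans (by gcongr; exact le_max_right _ _)
    have hN : (gridCard d (L ε) (a ε) (disc ε hε) : ℝ) ≤ C * ε ^ (-θ) :=
      (gridCard_le_rpow (disc ε hε) hn han (by linarith) hε0 b2 b3).trans
        (by gcongr; exact le_max_left _ _)
    have hbd := log_gibbs_mem_Icc (disc ε hε) hn han (by linarith) (by linarith) hF hε0 hγ hγ1 hK0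
      (Real.rpow_le_one hε0.le hε1.le (by positivity)) hκ0 hκ
      ((perturbation_le_rpow hε0 hε1.le halp.le hκ0 (by linarith) b2 b3).trans e1)
      (fun z => (hφ1 _).trans (by norm_num)) (fun z => abs_farProfile_le _)
      (hφ d n _ _ (disc ε hε) hn han haa₀ (by linarith))
      (hA₁ d n _ _ (disc ε hε) hn han (by linarith) hL6)
      (S := {g | ENNReal.ofReal δ < eDistM d m (discFun d (L ε) (a ε) (disc ε hε) g)})
      (fun g hg => hgap n _ _ (disc ε hε) g δ hn han (by linarith) hδ hδ1 hg)
      (fun g hg => lt_eDistM_of_near_farProfile hm (disc ε hε) hn han ha2 hL6 hg hδ2)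
    have hq : 0 ≤ θ + p + K := by positivity
    have u1 := entropy_le hε0 hε1 hγ hq hCpos hN (by linarith) hsC e2
    have u2 := entropy_le hε0 hε1 one_pos hq hCpos hN (by linarith) hsC e3
    rw [div_one] at u2
    have m1 := min_le_left 1 (t / 16)
    have m2 := min_le_right 1 (t / 16)
    refine ⟨le_trans ?_ hbd.1, hbd.2.trans ?_⟩
    · linarith
    · have : c / 2 * δ ^ 2 = t / 2 := by rw [ht]; ring
      linarith
  have hev : ∀ᶠ ε in 𝓝[>] (0:ℝ), ε ∈ Set.Ioo (0:ℝ) ε₁ := Ioo_mem_nhdsGT hε₁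
  refine Filter.limsup_le_of_le (IsBoundedUnder.isCoboundedUnder_le ⟨-A₁ - 4, ?_⟩) ?_
  · rw [eventually_map]
    filter_upwards [hmain, hev] with ε h hε
    rw [dif_pos hε]
    exact (h hε).1
  · filter_upwards [hmain, hev] with ε h hε
    rw [dif_pos hε]
    exact (h hε).2

end
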